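/- For every positive integer n, M(1,2,n) = 4n if n = 2 or n = 3, and M(1,2,n) = 4n + 1 if n = 1 or n ≥ 4. -/

import Mathlib

/-- A finite directed multigraph. -/
structure MultiDigraph where
  V : Type
  E : Type
  fintV : Fintype V
  fintE : Fintype E
  src : E → V
  dst : E → V

namespace MultiDigraph

/-- `p` is a (nonempty) directed path from `u` to `v`, given as its list of edges. -/
def IsPathFrom (G : MultiDigraph) (u v : G.V) (p : List G.E) : Prop :=
  p ≠ [] ∧ List.Chain' (fun e f => G.dst e = G.src f) p ∧
    (∀ e ∈ p.head?, G.src e = u) ∧ ∀ e ∈ p.getLast?, G.dst e = v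

/-- `G` is acyclic: there is no (nonempty) directed path from a vertex to itself. -/
def Acyclic (G : MultiDigraph) : Prop :=
  ∀ (v : G.V) (p : List G.E), ¬ G.IsPathFrom v v p

/-- `α` is a family of `c` pairwise edge-disjoint directed paths from `u` to `v`. -/
def MengerSystem (G : MultiDigraph) (u v : G.V) (c : ℕ) (α : Fin c → List G.E) : Prop :=
  (∀ i, G.IsPathFrom u v (α i)) ∧ ∀ i j, i ≠ j → ∀ e, e ∈ α i → e ∉ α j

/-- The min-cut between `u` and `v` equals `c`: by Menger's theorem, this means the
maximum number of pairwise edge-disjoint directed paths from `u` to `v` is exactly `c`. -/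
def MinCut (G : MultiDigraph) (u v : G.V) (c : ℕ) : Prop :=
  (∃ α : Fin c → List G.E, G.MengerSystem u v c α) ∧
    ¬∃ α : Fin (c + 1) → List G.E, G.MengerSystem u v (c + 1) α

/-- Edge `e` is the starting edge of a merging among paths from (at least) two different
groups: `e` lies on a path of group `i` and on a path of group `j ≠ i`, and there are two
distinct edges immediately ahead of `e` on these two paths.  Mergings are counted without
multiplicity: one merging per such edge `e`. -/
def MergingEdge (G : MultiDigraph) {l : ℕ} {c : Fin l → ℕ}
    (α : (i : Fin l) → Fin (c i) → List G.E) (e : G.E) : Prop :=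
  ∃ i j : Fin l, i ≠ j ∧ ∃ (a : Fin (c i)) (b : Fin (c j)) (f g : G.E),
    f ≠ g ∧ [f, e] <:+: α i a ∧ [g, e] <:+: α j b

/-- The number of mergings among paths from different groups, `|G|_M(α₁,…,α_l)`. -/
noncomputable def mergingCount (G : MultiDigraph) {l : ℕ} {c : Fin l → ℕ}
    (α : (i : Fin l) → Fin (c i) → List G.E) : ℕ :=
  Set.ncard {e : G.E | G.MergingEdge α e}

end MultiDigraph

open MultiDigraph

/-- `G` is a finite acyclic directed multigraph with designated sources `S i`, pairwise
distinct sinks `R i`, and min-cut `c i` between `S i` and `R i`. -/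
def GoodConfig {l : ℕ} (G : MultiDigraph) (S R : Fin l → G.V) (c : Fin l → ℕ) : Prop :=
  G.Acyclic ∧ Function.Injective R ∧ ∀ i, G.MinCut (S i) (R i) (c i)

/-- `M(c₁,…,c_l) ≤ B`: in every acyclic graph with distinct sources, distinct sinks and
the given min-cuts, some choice of Menger path systems yields at most `B` mergings. -/
def MAtMost {l : ℕ} (c : Fin l → ℕ) (B : ℕ) : Prop :=
  ∀ (G : MultiDigraph) (S R : Fin l → G.V), GoodConfig G S R c → Function.Injective S →
    ∃ α : (i : Fin l) → Fin (c i) → List G.E,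
      (∀ i, G.MengerSystem (S i) (R i) (c i) (α i)) ∧ G.mergingCount α ≤ B

/-- `M(c₁,…,c_l) ≥ B`: some acyclic graph with distinct sources, distinct sinks and the
given min-cuts yields at least `B` mergings for every choice of Menger path systems. -/
def MAtLeast {l : ℕ} (c : Fin l → ℕ) (B : ℕ) : Prop :=
  ∃ (G : MultiDigraph) (S R : Fin l → G.V), GoodConfig G S R c ∧ Function.Injective S ∧
    ∀ α : (i : Fin l) → Fin (c i) → List G.E,
      (∀ i, G.MengerSystem (S i) (R i) (c i) (α i)) → B ≤ G.mergingCount α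

/-- `M(c₁,…,c_l) = B`: the largest possible value, over all acyclic graphs with distinct
sources and distinct sinks realizing the min-cuts `c`, of the minimum number of mergings
over all choices of Menger path systems, equals `B`. -/
def MEq {l : ℕ} (c : Fin l → ℕ) (B : ℕ) : Prop := MAtMost c B ∧ MAtLeast c B

/-- `M*(c₁,…,c_l) ≤ B`: as `MAtMost`, but with all sources identical. -/
def MstarAtMost {l : ℕ} (c : Fin l → ℕ) (B : ℕ) : Prop :=
  ∀ (G : MultiDigraph) (S R : Fin l → G.V), GoodConfig G S R c → (∀ i j, S i = S j) →
    ∃ α : (i : Fin l) → Fin (c i) → List G.E,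
      (∀ i, G.MengerSystem (S i) (R i) (c i) (α i)) ∧ G.mergingCount α ≤ B

/-- `M*(c₁,…,c_l) ≥ B`: as `MAtLeast`, but with all sources identical. -/
def MstarAtLeast {l : ℕ} (c : Fin l → ℕ) (B : ℕ) : Prop :=
  ∃ (G : MultiDigraph) (S R : Fin l → G.V), GoodConfig G S R c ∧ (∀ i j, S i = S j) ∧
    ∀ α : (i : Fin l) → Fin (c i) → List G.E,
      (∀ i, G.MengerSystem (S i) (R i) (c i) (α i)) → B ≤ G.mergingCount α

/-- `M*(c₁,…,c_l) = B`: as `MEq`, but with all sources identical. -/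
def MstarEq {l : ℕ} (c : Fin l → ℕ) (B : ℕ) : Prop := MstarAtMost c B ∧ MstarAtLeast c B

namespace MTwo
open MultiDigraph

theorem path_cons {G : MultiDigraph} {u v : G.V} {e : G.E} {l : List G.E}
    (h : G.IsPathFrom u v (e :: l)) :
    G.src e = u ∧ ((l = [] ∧ G.dst e = v) ∨ G.IsPathFrom (G.dst e) v l) := by
  obtain ⟨-, h2, h3, h4⟩ := h
  refine ⟨h3 e (by simp), ?_⟩
  rcases l with _ | ⟨f, l⟩
  · left; exact ⟨rfl, h4 e (by simp)⟩
  · right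
    have h2' := List.isChain_cons_cons.1 h2
    refine ⟨by simp, h2'.2, ?_, ?_⟩
    · intro x hx; simp at hx; subst hx; exact h2'.1.symm
    · intro x hx; exact h4 x (by simpa using hx)

theorem path_single {G : MultiDigraph} {u v : G.V} {e : G.E} (h1 : G.src e = u)
    (h2 : G.dst e = v) : G.IsPathFrom u v [e] :=
  ⟨by simp, List.isChain_singleton _, by simp [h1], by simp [h2]⟩

theorem path_cons' {G : MultiDigraph} {u v : G.V} {e : G.E} {l : List G.E}
    (h1 : G.src e = u) (h : G.IsPathFrom (G.dst e) v l) : G.IsPathFrom u v (e :: l) := by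
  obtain ⟨h0, h2, h3, h4⟩ := h
  rcases l with _ | ⟨f, l⟩
  · exact absurd rfl h0
  refine ⟨by simp, List.isChain_cons_cons.2 ⟨(h3 f (by simp)).symm, h2⟩, by simp [h1], ?_⟩
  intro x hx; exact h4 x (by simpa using hx)

theorem path_sum {G : MultiDigraph} (h : G.V → ℤ) {l : List G.E} : ∀ {u v : G.V},
    G.IsPathFrom u v l → (l.map (fun e => h (G.dst e) - h (G.src e))).sum = h v - h u := by
  induction l with
  | nil => intro u v hp; exact absurd rfl hp.1
  | cons e l ih =>
    intro u v hp
    obtain ⟨h1, h2 | h2⟩ := path_cons hp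
    · obtain ⟨rfl, h3⟩ := h2; simp [h1, h3]
    · have := ih h2
      simp only [List.map_cons, List.sum_cons, this, h1]; ring

theorem acyclic_of_rank {G : MultiDigraph} (h : G.V → ℤ)
    (hh : ∀ e, h (G.src e) < h (G.dst e)) : G.Acyclic := by
  intro v p hp
  have h1 := path_sum h hp
  have h2 : 0 < (p.map (fun e => h (G.dst e) - h (G.src e))).sum := by
    apply List.sum_pos
    · intro x hx
      obtain ⟨e, -, rfl⟩ := List.mem_map.1 hx
      have := hh e; omega
    · simpa using hp.1
  omega

theorem path_nodup {G : MultiDigraph} (hG : G.Acyclic) {l : List G.E} : ∀ {u v : G.V},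
    G.IsPathFrom u v l → l.Nodup := by
  -- no repeated edges
  intro u v hp
  by_contra hd
  obtain ⟨x, hx⟩ := List.exists_duplicate_iff_not_nodup.2 hd
  have hs := List.duplicate_iff_sublist.1 hx
  obtain ⟨l1, l2, rfl, -, h2⟩ : ∃ l1 l2, l = l1 ++ x :: l2 ∧ True ∧ x ∈ l2 := by
    clear hp hd hs
    induction hx with
    | cons_mem h => rename_i l'; exact ⟨[], l', rfl, trivial, h⟩
    | cons_duplicate h ih =>
      rename_i y l'
      obtain ⟨l1, l2, rfl, -, h2⟩ := ih
      exact ⟨y :: l1, l2, rfl, trivial, h2⟩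
  obtain ⟨l3, l4, rfl⟩ := List.append_of_mem h2
  obtain ⟨-, hc, -, -⟩ := hp
  have hc1 := (List.isChain_append.1 hc).2.1
  have hc2 : List.IsChain (fun e f => G.dst e = G.src f) ((x :: l3) ++ x :: l4) := hc1
  have h5 := List.isChain_append.1 hc2
  apply hG (G.src x) (x :: l3)
  refine ⟨by simp, h5.1, by simp, ?_⟩
  intro e he
  exact h5.2.2 e he x (by simp)

theorem mem_infix {α : Type*} {l : List α} {e : α} (he : e ∈ l) (hh : ∀ x ∈ l.head?, x ≠ e) :
    ∃ f, [f, e] <:+: l := by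
  induction l with
  | nil => simp at he
  | cons a l ih =>
    have hae : a ≠ e := hh a (by simp)
    rcases List.mem_cons.1 he with h | h
    · exact absurd h.symm hae
    rcases l with _ | ⟨b, l⟩
    · simp at h
    by_cases hb : b = e
    · subst hb; exact ⟨a, ⟨[], l, by simp⟩⟩
    · obtain ⟨f, hf⟩ := ih h (by simpa using hb)
      exact ⟨f, hf.trans (List.suffix_cons a _).isInfix⟩

end MTwo

namespace MLow
open MTwo
open MultiDigraph

open Classical in
theorem menger_sum {G : MultiDigraph} (hG : G.Acyclic) {u v : G.V} {c : ℕ}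
    {α : Fin c → List G.E} (hα : G.MengerSystem u v c α) (h : G.V → ℤ) :
    ∑ e ∈ Finset.univ.biUnion (fun k => (α k).toFinset), (h (G.dst e) - h (G.src e))
      = c * (h v - h u) := by
  rw [Finset.sum_biUnion]
  · have : ∀ k, ∑ e ∈ (α k).toFinset, (h (G.dst e) - h (G.src e)) = h v - h u := by
      intro k
      rw [List.sum_toFinset _ (path_nodup hG (hα.1 k))]
      exact path_sum h (hα.1 k)
    simp only [this, Finset.sum_const, Finset.card_univ, Fintype.card_fin, nsmul_eq_mul]
  · intro i _ j _ hij
    rw [Function.onFun, Finset.disjoint_left]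
    intro e he he'
    exact hα.2 i j hij e (by simpa using he) (by simpa using he')

open Classical in
theorem menger_uniq {G : MultiDigraph} (hG : G.Acyclic) {u v : G.V} {c : ℕ}
    {α α0 : Fin c → List G.E} (hα : G.MengerSystem u v c α) (hα0 : G.MengerSystem u v c α0)
    (h : G.V → ℤ) (h1 : ∀ e, (∃ k, e ∈ α0 k) → h (G.dst e) < h (G.src e))
    (h2 : ∀ e, (¬ ∃ k, e ∈ α0 k) → h (G.src e) < h (G.dst e)) (e : G.E) :
    (∃ k, e ∈ α k) ↔ (∃ k, e ∈ α0 k) := by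
  set X := Finset.univ.biUnion (fun k => (α k).toFinset) with hX
  set X0 := Finset.univ.biUnion (fun k => (α0 k).toFinset) with hX0
  have m1 : ∀ e, e ∈ X ↔ ∃ k, e ∈ α k := by intro e; simp [hX]
  have m0 : ∀ e, e ∈ X0 ↔ ∃ k, e ∈ α0 k := by intro e; simp [hX0]
  set d : G.E → ℤ := fun e => h (G.dst e) - h (G.src e) with hd
  have s1 : ∑ e ∈ X, d e = ∑ e ∈ X0, d e := by
    rw [hX, hX0, hd, menger_sum hG hα h, menger_sum hG hα0 h]
  have s2 := Finset.sum_inter_add_sum_sdiff X X0 d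
  have s3 := Finset.sum_inter_add_sum_sdiff X0 X d
  rw [Finset.inter_comm] at s3
  have p1 : ∀ e ∈ X \ X0, 0 < d e := by
    intro e he
    have := h2 e (by rw [← m0]; exact (Finset.mem_sdiff.1 he).2)
    simp only [hd]; omega
  have p2 : ∀ e ∈ X0 \ X, d e < 0 := by
    intro e he
    have := h1 e ((m0 e).1 (Finset.mem_sdiff.1 he).1)
    simp only [hd]; omega
  have q1 := Finset.sum_nonneg (fun e he => (p1 e he).le)
  have q2 := Finset.sum_nonpos (fun e he => (p2 e he).le)
  rw [← m1, ← m0]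
  constructor
  · intro he
    by_contra he'
    have := Finset.sum_pos p1 ⟨e, by simp [he, he']⟩
    omega
  · intro he
    by_contra he'
    have := Finset.sum_neg p2 ⟨e, by simp [he, he']⟩
    omega

/-- Combinatorial data describing an explicit graph with a unique Menger system. -/
structure LBData (c : Fin 3 → ℕ) where
  P : Type
  fin : Fintype P
  first : (Σ i, Fin (c i)) → P × Bool
  next : P × Bool → Option (P × Bool)
  tr : P × Bool → (Σ i, Fin (c i))
  tr_first : ∀ t, tr (first t) = t
  tr_next : ∀ x y, next x = some y → tr y = tr x
  tr_ne : ∀ p, (tr (p, false)).1 ≠ (tr (p, true)).1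
  prev : ∀ x, first (tr x) = x ∨ ∃ y, next y = some x
  time : P → ℕ
  time_lt : ∀ x y, next x = some y → time x.1 < time y.1
  hi : Fin 3 → P → ℤ
  ho : Fin 3 → P → ℤ
  hpt : ∀ i p, (∃ s, (tr (p, s)).1 = i) → ho i p < hi i p
  hpt' : ∀ i p, (¬ ∃ s, (tr (p, s)).1 = i) → hi i p < ho i p
  hnx : ∀ i x y, next x = some y → (tr x).1 = i → hi i y.1 < ho i x.1
  hnx' : ∀ i x y, next x = some y → (tr x).1 ≠ i → ho i x.1 < hi i y.1

namespace LBData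
variable {c : Fin 3 → ℕ} (D : LBData c)

def toV (i : Fin 3) : Option (D.P × Bool) → (D.P × Bool) ⊕ (Bool × Fin 3)
  | none => Sum.inr (true, i)
  | some y => Sum.inl (y.1, false)

@[reducible] def G : MultiDigraph where
  V := (D.P × Bool) ⊕ (Bool × Fin 3)
  E := D.P ⊕ ((D.P × Bool) ⊕ (Σ i, Fin (c i)))
  fintV := by have := D.fin; infer_instance
  fintE := by have := D.fin; infer_instance
  src := fun e => match e with
    | Sum.inl p => Sum.inl (p, false)
    | Sum.inr (Sum.inl x) => Sum.inl (x.1, true)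
    | Sum.inr (Sum.inr t) => Sum.inr (false, t.1)
  dst := fun e => match e with
    | Sum.inl p => Sum.inl (p, true)
    | Sum.inr (Sum.inl x) => D.toV (D.tr x).1 (D.next x)
    | Sum.inr (Sum.inr t) => Sum.inl ((D.first t).1, false)

def S (i : Fin 3) : D.G.V := Sum.inr (false, i)
def R (i : Fin 3) : D.G.V := Sum.inr (true, i)

/-- group membership of edges -/
def grp (t : Σ i, Fin (c i)) : D.G.E → Prop
  | Sum.inl p => ∃ s, D.tr (p, s) = t
  | Sum.inr (Sum.inl x) => D.tr x = t
  | Sum.inr (Sum.inr t') => t' = t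

theorem exists_bound (i : Fin 3) : ∃ K : ℤ, ∀ p, -K < D.hi i p ∧ D.hi i p < K ∧
    -K < D.ho i p ∧ D.ho i p < K := by
  have := D.fin
  refine ⟨1 + ∑ p, (|D.hi i p| + |D.ho i p|), fun p => ?_⟩
  have := Finset.single_le_sum (f := fun p => |D.hi i p| + |D.ho i p|)
    (fun p _ => by positivity) (Finset.mem_univ p)
  have a1 := abs_lt.1 (show |D.hi i p| < 1 + ∑ p, (|D.hi i p| + |D.ho i p|) by
    have := abs_nonneg (D.ho i p); omega)
  have a2 := abs_lt.1 (show |D.ho i p| < 1 + ∑ p, (|D.hi i p| + |D.ho i p|) by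
    have := abs_nonneg (D.hi i p); omega)
  exact ⟨a1.1, a1.2, a2.1, a2.2⟩

theorem exists_bound_time : ∃ K : ℕ, ∀ p, D.time p < K := by
  have := D.fin
  refine ⟨1 + ∑ p, D.time p, fun p => ?_⟩
  have := Finset.single_le_sum (f := fun p => D.time p)
    (fun p _ => by positivity) (Finset.mem_univ p)
  omega

theorem acyclic : D.G.Acyclic := by
  obtain ⟨K, hK⟩ := D.exists_bound_time
  apply acyclic_of_rank (G := D.G) (fun v => match v with
    | Sum.inl (p, false) => 2 * (D.time p : ℤ) + 1
    | Sum.inl (p, true) => 2 * (D.time p : ℤ) + 2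
    | Sum.inr (false, _) => 0
    | Sum.inr (true, _) => 2 * (K : ℤ) + 5)
  rintro (p | x | t)
  · simp [G]
  · simp only [G]
    rcases hx : D.next x with _ | y
    · simp only [toV]
      have := hK x.1; omega
    · simp only [toV]
      have := D.time_lt x y hx; omega
  · simp only [G]; omega

/-- the path of a track -/
theorem exists_path (x : D.P × Bool) : ∃ l : List D.G.E,
    D.G.IsPathFrom (Sum.inl (x.1, false)) (D.R (D.tr x).1) l ∧
    (∀ e ∈ l, D.grp (D.tr x) e) ∧ Sum.inl x.1 ∈ l ∧ Sum.inr (Sum.inl x) ∈ l ∧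
    (∀ y, Relation.ReflTransGen (fun a b => D.next a = some b) x y →
      Sum.inl y.1 ∈ l ∧ Sum.inr (Sum.inl y) ∈ l) := by
  obtain ⟨K, hK⟩ := D.exists_bound_time
  generalize hm : K - D.time x.1 = m
  induction m using Nat.strong_induction_on generalizing x with
  | _ m ih =>
  rcases hx : D.next x with _ | y
  · refine ⟨[Sum.inl x.1, Sum.inr (Sum.inl x)], ?_, ?_, by simp, by simp, ?_⟩
    · refine path_cons' (G := D.G) rfl ?_
      refine path_single (G := D.G) rfl ?_
      simp [G, hx, toV, R]
    · intro e he
      simp at he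
      rcases he with rfl | rfl
      · exact ⟨x.2, rfl⟩
      · exact rfl
    · intro y hy
      rcases Relation.ReflTransGen.cases_head hy with rfl | ⟨z, hz, -⟩
      · simp
      · rw [hx] at hz; cases hz
  · have t1 := D.time_lt x y hx
    have t2 := hK x.1
    have t3 := hK y.1
    obtain ⟨l, hl1, hl2, hl3, hl4, hl5⟩ := ih (K - D.time y.1) (by omega) y rfl
    have hty := D.tr_next x y hx
    refine ⟨Sum.inl x.1 :: Sum.inr (Sum.inl x) :: l, ?_, ?_, by simp, by simp, ?_⟩
    · refine path_cons' (G := D.G) rfl ?_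
      refine path_cons' (G := D.G) rfl ?_
      rw [← hty]
      have : D.G.dst (Sum.inr (Sum.inl x)) = Sum.inl (y.1, false) := by
        simp [G, hx, toV]
      rw [this]; exact hl1
    · intro e he
      rcases List.mem_cons.1 he with rfl | he
      · exact ⟨x.2, rfl⟩
      rcases List.mem_cons.1 he with rfl | he
      · exact rfl
      rw [← hty]; exact hl2 e he
    · intro z hz
      rcases Relation.ReflTransGen.cases_head hz with rfl | ⟨w, hw, hz⟩
      · simp
      · rw [hx] at hw; cases hw
        have := hl5 z hz
        simp [this]

theorem exists_track (t : Σ i, Fin (c i)) : ∃ l : List D.G.E,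
    D.G.IsPathFrom (D.S t.1) (D.R t.1) l ∧ (∀ e, e ∈ l ↔ D.grp t e) := by
  obtain ⟨l, h1, h2, h3, h4, h5⟩ := D.exists_path (D.first t)
  have key : ∀ x, D.tr x = t →
      Relation.ReflTransGen (fun a b => D.next a = some b) (D.first t) x := by
    intro x hx
    generalize hm : D.time x.1 = m
    induction m using Nat.strong_induction_on generalizing x with
    | _ m ih =>
    rcases D.prev x with h | ⟨y, hy⟩
    · rw [← hx, h]
    · have := D.time_lt y x hy
      exact (ih _ (by omega) y (by rw [← hx, D.tr_next y x hy]) rfl).tail hy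
  refine ⟨Sum.inr (Sum.inr t) :: l, ?_, ?_⟩
  · refine path_cons' (G := D.G) rfl ?_
    rw [D.tr_first] at h1
    exact h1
  · rw [D.tr_first] at h2
    intro e
    constructor
    · intro he
      rcases List.mem_cons.1 he with rfl | he
      · exact rfl
      · exact h2 e he
    · rcases e with p | x | t'
      · rintro ⟨s, hs⟩
        have := h5 _ (key _ hs)
        simp [this]
      · intro hx
        have := h5 _ (key _ hx)
        simp [this]
      · intro ht; change t' = t at ht; simp [ht]

theorem exists_sys (i : Fin 3) : ∃ α : Fin (c i) → List D.G.E,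
    D.G.MengerSystem (D.S i) (D.R i) (c i) α ∧ ∀ k e, e ∈ α k ↔ D.grp ⟨i, k⟩ e := by
  choose f hf1 hf2 using fun k : Fin (c i) => D.exists_track ⟨i, k⟩
  refine ⟨f, ⟨hf1, ?_⟩, hf2⟩
  intro a b hab e ha hb
  rw [hf2] at ha hb
  rcases e with p | x | t
  · obtain ⟨s, hs⟩ := ha
    obtain ⟨s', hs'⟩ := hb
    have hne := D.tr_ne p
    have : s ≠ s' := by
      rintro rfl
      rw [hs] at hs'
      apply hab
      simpa using hs'
    rcases s <;> rcases s' <;> simp_all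
  · change D.tr x = _ at ha
    change D.tr x = _ at hb
    rw [ha] at hb
    exact hab (by simpa using hb)
  · change t = _ at ha
    change t = _ at hb
    rw [ha] at hb
    exact hab (by simpa using hb)

theorem no_more (i : Fin 3) :
    ¬∃ α : Fin (c i + 1) → List D.G.E, D.G.MengerSystem (D.S i) (D.R i) (c i + 1) α := by
  rintro ⟨α, h1, h2⟩
  have : ∀ k, ∃ a : Fin (c i), (Sum.inr (Sum.inr ⟨i, a⟩) : D.G.E) ∈ α k := by
    intro k
    have hk := h1 k
    rcases hα : α k with _ | ⟨e, l⟩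
    · rw [hα] at hk; exact absurd rfl hk.1
    rw [hα] at hk
    have hs := (path_cons hk).1
    rcases e with p | x | t
    · simp [G, S] at hs
    · simp [G, S] at hs
    · have : t.1 = i := by simpa [G, S] using hs
      subst this
      exact ⟨t.2, by simp⟩
  choose a ha using this
  obtain ⟨k, k', hk, hkk⟩ := Fintype.exists_ne_map_eq_of_card_lt a (by simp)
  exact h2 k k' hk _ (ha k) (hkk ▸ ha k')

theorem good : GoodConfig D.G D.S D.R c := by
  refine ⟨D.acyclic, ?_, fun i => ⟨?_, D.no_more i⟩⟩
  · intro i j h; simpa [R] using h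
  · obtain ⟨α, h, -⟩ := D.exists_sys i
    exact ⟨α, h⟩

theorem uniq (i : Fin 3) {α : Fin (c i) → List D.G.E}
    (hα : D.G.MengerSystem (D.S i) (D.R i) (c i) α) (e : D.G.E) :
    (∃ k, e ∈ α k) ↔ ∃ k, D.grp ⟨i, k⟩ e := by
  obtain ⟨α0, h0, h0'⟩ := D.exists_sys i
  obtain ⟨K, hK⟩ := D.exists_bound i
  have hgr : ∀ t : Σ i, Fin (c i), (∃ k, t = ⟨i, k⟩) ↔ t.1 = i := by
    rintro ⟨j, k⟩
    constructor
    · rintro ⟨k', h⟩; exact congrArg Sigma.fst h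
    · rintro rfl; exact ⟨k, rfl⟩
  have hgp : ∀ p, (∃ k, D.grp ⟨i, k⟩ (Sum.inl p)) ↔ ∃ s, (D.tr (p, s)).1 = i := by
    intro p
    constructor
    · rintro ⟨k, s, hs⟩; exact ⟨s, (hgr _).1 ⟨k, hs⟩⟩
    · rintro ⟨s, hs⟩; obtain ⟨k, hk⟩ := (hgr _).2 hs; exact ⟨k, s, hk⟩
  rw [show (∃ k, D.grp ⟨i, k⟩ e) ↔ ∃ k, e ∈ α0 k by simp [h0']]
  apply menger_uniq D.acyclic hα h0 (fun v => match v with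
    | Sum.inl (p, false) => D.hi i p
    | Sum.inl (p, true) => D.ho i p
    | Sum.inr (false, j) => if j = i then K else -K
    | Sum.inr (true, j) => if j = i then -K else K)
  · intro e he
    simp only [h0'] at he
    rcases e with p | x | t
    · exact D.hpt i p ((hgp p).1 he)
    · have hx : (D.tr x).1 = i := (hgr _).1 he
      simp only [G]
      rcases hn : D.next x with _ | y
      · simp only [toV, hx, if_true]; exact (hK _).2.2.1
      · simp only [toV]; exact D.hnx i x y hn hx
    · have hx : t.1 = i := (hgr _).1 he
      simp only [G, hx, if_true]; exact (hK _).2.1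
  · intro e he
    simp only [h0'] at he
    rcases e with p | x | t
    · exact D.hpt' i p (fun h => he ((hgp p).2 h))
    · have hx : ¬ (D.tr x).1 = i := fun h => he ((hgr _).2 h)
      simp only [G]
      rcases hn : D.next x with _ | y
      · simp only [toV, hx, if_false]; exact (hK _).2.2.2
      · simp only [toV]; exact D.hnx' i x y hn hx
    · have hx : ¬ t.1 = i := fun h => he ((hgr _).2 h)
      simp only [G, hx, if_false]; exact (hK _).1

theorem mAtLeast (N : ℕ) (hN : N ≤ Nat.card D.P) : MAtLeast c N := by
  refine ⟨D.G, D.S, D.R, D.good, ?_, ?_⟩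
  · intro i j h; simpa [S] using h
  intro α hα
  have := D.fin
  have := D.G.fintE
  have key : ∀ p : D.P, ∀ s, ∃ k f, [f, Sum.inl p] <:+: α (D.tr (p, s)).1 k ∧
      (∃ k', D.grp ⟨(D.tr (p, s)).1, k'⟩ f) ∧ D.G.dst f = Sum.inl (p, false) := by
    intro p s
    have h1 : ∃ k, D.grp ⟨(D.tr (p, s)).1, k⟩ (Sum.inl p) := ⟨(D.tr (p, s)).2, s, rfl⟩
    obtain ⟨k, hk⟩ := (D.uniq _ (hα _) _).2 h1
    have hpath := (hα (D.tr (p, s)).1).1 k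
    obtain ⟨f, hf⟩ := mem_infix hk (by
      intro x hx hxe
      have := hpath.2.2.1 x hx
      subst hxe
      simp [G, S] at this)
    refine ⟨k, f, hf, (D.uniq _ (hα _) _).1 ⟨k, hf.subset (by simp)⟩, ?_⟩
    have := List.IsChain.infix hpath.2.1 hf
    simpa [G] using this
  have hmerge : ∀ p : D.P, D.G.MergingEdge α (Sum.inl p) := by
    intro p
    obtain ⟨k, f, h1, ⟨j, h2⟩, h3⟩ := key p false
    obtain ⟨k', f', h1', ⟨j', h2'⟩, h3'⟩ := key p true
    refine ⟨_, _, D.tr_ne p, k, k', f, f', ?_, h1, h1'⟩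
    rintro rfl
    rcases f with q | x | t
    · simp [G] at h3
    · change D.tr x = _ at h2
      change D.tr x = _ at h2'
      rw [h2] at h2'
      exact D.tr_ne p (Sigma.mk.inj h2').1
    · change t = _ at h2
      change t = _ at h2'
      rw [h2] at h2'
      exact D.tr_ne p (Sigma.mk.inj h2').1
  refine hN.trans ?_
  rw [mergingCount, ← Set.ncard_univ]
  refine Set.ncard_le_ncard_of_injOn (fun p => (Sum.inl p : D.G.E)) (fun p _ => hmerge p) ?_
    (Set.toFinite _)
  intro a _ b _ h
  exact Sum.inl_injective h

end LBData
end MLow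

namespace MLow
open MTwo
set_option maxRecDepth 100000
set_option maxHeartbeats 0
def D1 : LBData ![1, 2, 1] where
  P := Fin 5
  fin := inferInstance
  first := fun t => match t with
    | ⟨0, _⟩ => (0, false)
    | ⟨1, b⟩ => (![(0, true), (1, true)] : Fin 2 → Fin 5 × Bool) b
    | ⟨2, b⟩ => (![(2, true)] : Fin 1 → Fin 5 × Bool) b
  next := fun x => match x.2 with
    | false => (![some (1, false), some (2, false), none, none, none] : Fin 5 → Option (Fin 5 × Bool)) x.1
    | true => (![some (3, false), some (4, false), some (3, true), some (4, true), none] : Fin 5 → Option (Fin 5 × Bool)) x.1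
  tr := fun x => match x.2 with
    | false => (![⟨0, ⟨0, by decide⟩⟩, ⟨0, ⟨0, by decide⟩⟩, ⟨0, ⟨0, by decide⟩⟩, ⟨1, ⟨0, by decide⟩⟩, ⟨1, ⟨1, by decide⟩⟩] : Fin 5 → Σ i, Fin ((![1, 2, 1] : Fin 3 → ℕ) i)) x.1
    | true => (![⟨1, ⟨0, by decide⟩⟩, ⟨1, ⟨1, by decide⟩⟩, ⟨2, ⟨0, by decide⟩⟩, ⟨2, ⟨0, by decide⟩⟩, ⟨2, ⟨0, by decide⟩⟩] : Fin 5 → Σ i, Fin ((![1, 2, 1] : Fin 3 → ℕ) i)) x.1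
  time := ![0, 2, 4, 6, 8]
  hi := ![![5, 3, 1, 5, 7], ![7, 7, 3, 5, 1], ![0, 2, 8, 6, 4]]
  ho := ![![4, 2, 0, 6, 8], ![6, 2, 4, 0, 0], ![1, 3, 7, 5, 0]]
  tr_first := by decide
  tr_next := by decide
  tr_ne := by decide
  prev := by decide
  time_lt := by decide
  hpt := by decide
  hpt' := by decide
  hnx := by decide
  hnx' := by decide

def D2 : LBData ![1, 2, 2] where
  P := Fin 8
  fin := inferInstance
  first := fun t => match t with
    | ⟨0, _⟩ => (0, false)
    | ⟨1, b⟩ => (![(2, true), (6, false)] : Fin 2 → Fin 8 × Bool) b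
    | ⟨2, b⟩ => (![(0, true), (1, true)] : Fin 2 → Fin 8 × Bool) b
  next := fun x => match x.2 with
    | false => (![some (1, false), some (2, false), none, some (4, false), some (5, false), none, some (7, false), none] : Fin 8 → Option (Fin 8 × Bool)) x.1
    | true => (![some (3, true), some (7, true), some (3, false), some (6, true), none, none, some (5, true), some (4, true)] : Fin 8 → Option (Fin 8 × Bool)) x.1
  tr := fun x => match x.2 with
    | false => (![⟨0, ⟨0, by decide⟩⟩, ⟨0, ⟨0, by decide⟩⟩, ⟨0, ⟨0, by decide⟩⟩, ⟨1, ⟨0, by decide⟩⟩, ⟨1, ⟨0, by decide⟩⟩, ⟨1, ⟨0, by decide⟩⟩, ⟨1, ⟨1, by decide⟩⟩, ⟨1, ⟨1, by decide⟩⟩] : Fin 8 → Σ i, Fin ((![1, 2, 2] : Fin 3 → ℕ) i)) x.1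
    | true => (![⟨2, ⟨0, by decide⟩⟩, ⟨2, ⟨1, by decide⟩⟩, ⟨1, ⟨0, by decide⟩⟩, ⟨2, ⟨0, by decide⟩⟩, ⟨2, ⟨1, by decide⟩⟩, ⟨2, ⟨0, by decide⟩⟩, ⟨2, ⟨0, by decide⟩⟩, ⟨2, ⟨1, by decide⟩⟩] : Fin 8 → Σ i, Fin ((![1, 2, 2] : Fin 3 → ℕ) i)) x.1
  time := ![0, 2, 4, 6, 12, 14, 8, 10]
  hi := ![![5, 3, 1, 5, 11, 13, 7, 9], ![0, 2, 12, 10, 8, 6, 10, 4], ![13, 13, 9, 11, 5, 1, 3, 7]]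
  ho := ![![4, 2, 0, 6, 12, 14, 8, 10], ![1, 3, 11, 9, 7, 0, 5, 0], ![12, 8, 10, 4, 0, 0, 2, 6]]
  tr_first := by decide
  tr_next := by decide
  tr_ne := by decide
  prev := by decide
  time_lt := by decide
  hpt := by decide
  hpt' := by decide
  hnx := by decide
  hnx' := by decide

def D3 : LBData ![1, 2, 3] where
  P := Fin 12
  fin := inferInstance
  first := fun t => match t with
    | ⟨0, _⟩ => (0, false)
    | ⟨1, b⟩ => (![(3, true), (8, false)] : Fin 2 → Fin 12 × Bool) b
    | ⟨2, b⟩ => (![(0, true), (1, true), (2, true)] : Fin 3 → Fin 12 × Bool) b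
  next := fun x => match x.2 with
    | false => (![some (1, false), some (2, false), some (3, false), none, some (5, false), some (6, false), some (7, false), none, some (9, false), some (10, false), some (11, false), none] : Fin 12 → Option (Fin 12 × Bool)) x.1
    | true => (![some (4, true), some (9, true), some (7, true), some (4, false), some (8, true), none, some (11, true), some (10, true), some (6, true), some (5, true), none, none] : Fin 12 → Option (Fin 12 × Bool)) x.1
  tr := fun x => match x.2 with
    | false => (![⟨0, ⟨0, by decide⟩⟩, ⟨0, ⟨0, by decide⟩⟩, ⟨0, ⟨0, by decide⟩⟩, ⟨0, ⟨0, by decide⟩⟩, ⟨1, ⟨0, by decide⟩⟩, ⟨1, ⟨0, by decide⟩⟩, ⟨1, ⟨0, by decide⟩⟩, ⟨1, ⟨0, by decide⟩⟩, ⟨1, ⟨1, by decide⟩⟩, ⟨1, ⟨1, by decide⟩⟩, ⟨1, ⟨1, by decide⟩⟩, ⟨1, ⟨1, by decide⟩⟩] : Fin 12 → Σ i, Fin ((![1, 2, 3] : Fin 3 → ℕ) i)) x.1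
    | true => (![⟨2, ⟨0, by decide⟩⟩, ⟨2, ⟨1, by decide⟩⟩, ⟨2, ⟨2, by decide⟩⟩, ⟨1, ⟨0, by decide⟩⟩, ⟨2, ⟨0, by decide⟩⟩, ⟨2, ⟨1, by decide⟩⟩, ⟨2, ⟨0, by decide⟩⟩, ⟨2, ⟨2, by decide⟩⟩, ⟨2, ⟨0, by decide⟩⟩, ⟨2, ⟨1, by decide⟩⟩, ⟨2, ⟨2, by decide⟩⟩, ⟨2, ⟨0, by decide⟩⟩] : Fin 12 → Σ i, Fin ((![1, 2, 3] : Fin 3 → ℕ) i)) x.1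
  time := ![0, 2, 4, 6, 8, 14, 16, 18, 10, 12, 20, 22]
  hi := ![![7, 5, 3, 1, 7, 13, 15, 17, 9, 11, 19, 21], ![0, 2, 4, 20, 18, 16, 14, 6, 18, 12, 10, 8], ![17, 17, 13, 13, 15, 7, 3, 11, 5, 9, 9, 1]]
  ho := ![![6, 4, 2, 0, 8, 14, 16, 18, 10, 12, 20, 22], ![1, 3, 5, 19, 17, 15, 7, 0, 13, 11, 9, 0], ![16, 10, 12, 14, 6, 0, 2, 10, 4, 8, 0, 0]]
  tr_first := by decide
  tr_next := by decide
  tr_ne := by decide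
  prev := by decide
  time_lt := by decide
  hpt := by decide
  hpt' := by decide
  hnx := by decide
  hnx' := by decide

theorem lb1 : MAtLeast ![1, 2, 1] 5 := D1.mAtLeast 5 (Nat.card_fin 5).ge
theorem lb2 : MAtLeast ![1, 2, 2] 8 := D2.mAtLeast 8 (Nat.card_fin 8).ge
theorem lb3 : MAtLeast ![1, 2, 3] 12 := D3.mAtLeast 12 (Nat.card_fin 12).ge
end MLow

namespace MLow
open MTwo

inductive Pt (m : ℕ) : Type
  | pre (i : Fin 7)
  | J (k : Fin (m + 2))
  | a (k : Fin (m + 1))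
  | b (k : Fin (m + 1))
  | ec (j : Fin (m + 4))
  | eb (i : Fin 2)

namespace Pt
variable {m : ℕ}

def equ : Pt m ≃ (Fin 7 ⊕ Fin (m + 2) ⊕ Fin (m + 1) ⊕ Fin (m + 1) ⊕ Fin (m + 4) ⊕ Fin 2) where
  toFun
    | pre i => Sum.inl i
    | J k => Sum.inr (Sum.inl k)
    | a k => Sum.inr (Sum.inr (Sum.inl k))
    | b k => Sum.inr (Sum.inr (Sum.inr (Sum.inl k)))
    | ec k => Sum.inr (Sum.inr (Sum.inr (Sum.inr (Sum.inl k))))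
    | eb k => Sum.inr (Sum.inr (Sum.inr (Sum.inr (Sum.inr k))))
  invFun
    | Sum.inl i => pre i
    | Sum.inr (Sum.inl k) => J k
    | Sum.inr (Sum.inr (Sum.inl k)) => a k
    | Sum.inr (Sum.inr (Sum.inr (Sum.inl k))) => b k
    | Sum.inr (Sum.inr (Sum.inr (Sum.inr (Sum.inl k)))) => ec k
    | Sum.inr (Sum.inr (Sum.inr (Sum.inr (Sum.inr k)))) => eb k
  left_inv := by rintro (_ | _ | _ | _ | _ | _) <;> rfl
  right_inv := by rintro (_ | _ | _ | _ | _ | _) <;> rfl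

noncomputable def fint : Fintype (Pt m) := Fintype.ofEquiv _ equ.symm

theorem card : Nat.card (Pt m) = 4 * (m + 4) + 1 := by
  rw [Nat.card_congr equ, Nat.card_eq_fintype_card]
  simp; omega

abbrev Tk (m : ℕ) := (Σ i, Fin ((![1, 2, m + 4] : Fin 3 → ℕ) i))
def tA : Tk m := ⟨0, ⟨0, Nat.one_pos⟩⟩
def tB (k : ℕ) : Tk m := ⟨1, ⟨k % 2, Nat.mod_lt _ (Nat.succ_pos 1)⟩⟩
def tC (k : Fin (m + 4)) : Tk m := ⟨2, k⟩

def c0 : Fin (m + 4) := ⟨0, by omega⟩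
def c1 : Fin (m + 4) := ⟨1, by omega⟩
def c2 : Fin (m + 4) := ⟨2, by omega⟩
def ck (k : Fin (m + 1)) : Fin (m + 4) := ⟨k.1 + 3, by omega⟩

def tr : Pt m × Bool → Tk m
  | (pre i, false) => if i.1 < 3 then tB 0 else tB 1
  | (pre i, true) => ![tC c0, tC c1, tC c2, tC c0, tC c1, tC c2, tC c0] i
  | (J k, false) => tB k
  | (J _, true) => tC c0
  | (a k, false) => tB k
  | (a k, true) => tC (ck k)
  | (b k, false) => tB (k + 1)
  | (b k, true) => tC (ck k)
  | (ec _, false) => tA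
  | (ec j, true) => tC j
  | (eb _, false) => tA
  | (eb i, true) => tB i

def fC (j : Fin (m + 4)) : Pt m :=
  if j.1 = 0 then pre 3 else if j.1 = 1 then pre 1 else if j.1 = 2 then pre 2 else
    a ⟨j.1 - 3, by omega⟩

def next : Pt m × Bool → Option (Pt m × Bool)
  | (pre i, false) => ![some (pre 1, false), some (pre 2, false), some (J ⟨0, by omega⟩, false),
      some (pre 4, false), some (pre 5, false), some (pre 6, false), some (b ⟨0, by omega⟩, false)] i
  | (pre i, true) => ![some (pre 6, true), some (pre 4, true), some (pre 5, true),
      some (pre 0, true), none, none, some (J ⟨0, by omega⟩, true)] i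
  | (J k, false) => if h : k.1 < m + 1 then some (a ⟨k, h⟩, false) else none
  | (J k, true) => if h : k.1 + 1 < m + 2 then some (J ⟨k + 1, h⟩, true) else none
  | (a k, false) => if h : k.1 + 1 < m + 1 then some (b ⟨k + 1, h⟩, false) else none
  | (a k, true) => some (b k, true)
  | (b k, false) => some (J ⟨k + 1, by omega⟩, false)
  | (b _, true) => none
  | (ec j, false) => if h : j.1 + 1 < m + 4 then some (ec ⟨j + 1, h⟩, false) else some (eb 0, false)
  | (ec j, true) => some (fC j, true)
  | (eb i, false) => ![some (eb 1, false), none] i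
  | (eb i, true) => ![some (pre 0, false), some (pre 3, false)] i

def first : Tk m → Pt m × Bool
  | ⟨0, _⟩ => (ec c0, false)
  | ⟨1, i⟩ => (eb i, true)
  | ⟨2, j⟩ => (ec j, true)

def time : Pt m → ℕ
  | pre i => m + 6 + ![1, 2, 3, 0, 4, 5, 6] i
  | J k => m + 16 + 3 * k
  | a k => m + 16 + 3 * k + 1
  | b k => m + 16 + 3 * k + 2
  | ec j => j
  | eb i => m + 4 + i

def hi : Fin 3 → Pt m → ℤ
  | 0, ec j => - 2 * j
  | 0, eb i => - 2 * (m + 4 + i)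
  | 0, p => 2 * time p + 1
  | 1, pre i => (![31, 23, 21, 32, 29, 27, 25] : Fin 7 → ℤ) i
  | 1, J k => - 10 * k + 13
  | 1, a k => - 10 * k + 1
  | 1, b k => - 10 * k + 5
  | 1, ec j => - 12 * m - 50 + 2 * j
  | 1, eb i => 35 + i
  | 2, pre i => (![2 * m + 26, 2 * m + 30, 2 * m + 30, 2 * m + 28, 2 * m + 28, -2, 2] : Fin 7 → ℤ) i
  | 2, J k => - 2 * k
  | 2, a _ => 2 * m + 20
  | 2, b k => 10 + 2 * k
  | 2, ec _ => 2 * m + 32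
  | 2, eb i => 2 * m + 22 + 2 * i

def ho : Fin 3 → Pt m → ℤ
  | 0, ec j => - 2 * j - 1
  | 0, eb i => - 2 * (m + 4 + i) - 1
  | 0, p => 2 * time p + 2
  | 1, pre i => (![24, 22, 20, 30, 28, 26, 6] : Fin 7 → ℤ) i
  | 1, J k => - 10 * k + 2
  | 1, a k => - 10 * k
  | 1, b k => - 10 * k + 4
  | 1, ec j => - 12 * m - 50 + 2 * j + 1
  | 1, eb i => 33 + i
  | 2, pre i => (![3, 2 * m + 29, -1, 2 * m + 27, -3, -3, 1] : Fin 7 → ℤ) i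
  | 2, J k => - 2 * k - 1
  | 2, a k => 11 + 2 * k
  | 2, b _ => - 2 * m - 7
  | 2, ec j => if j.1 < 3 then 2 * m + 31 else 2 * m + 21
  | 2, eb i => 2 * m + 23 + 2 * i

theorem next_cases {x y : Pt m × Bool} (h : next x = some y) (Q : Pt m × Bool → Pt m × Bool → Prop)
    (h0 : Q (pre 0, false) (pre 1, false)) (h1 : Q (pre 1, false) (pre 2, false))
    (h2 : Q (pre 2, false) (J ⟨0, by omega⟩, false)) (h3 : Q (pre 3, false) (pre 4, false))
    (h4 : Q (pre 4, false) (pre 5, false)) (h5 : Q (pre 5, false) (pre 6, false))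
    (h6 : Q (pre 6, false) (b ⟨0, by omega⟩, false)) (h7 : Q (pre 0, true) (pre 6, true))
    (h8 : Q (pre 1, true) (pre 4, true)) (h9 : Q (pre 2, true) (pre 5, true))
    (h10 : Q (pre 3, true) (pre 0, true)) (h11 : Q (pre 6, true) (J ⟨0, by omega⟩, true))
    (h12 : ∀ k : Fin (m + 1), Q (J ⟨k, by omega⟩, false) (a k, false))
    (h13 : ∀ k : Fin (m + 1), Q (J ⟨k, by omega⟩, true) (J ⟨k + 1, by omega⟩, true))
    (h14 : ∀ (k : ℕ) (hk : k + 1 < m + 1),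
      Q (a ⟨k, by omega⟩, false) (b ⟨k + 1, by omega⟩, false))
    (h15 : ∀ k, Q (a k, true) (b k, true))
    (h16 : ∀ k : Fin (m + 1), Q (b k, false) (J ⟨k + 1, by omega⟩, false))
    (h17 : ∀ (j : ℕ) (hj : j + 1 < m + 4),
      Q (ec ⟨j, by omega⟩, false) (ec ⟨j + 1, by omega⟩, false))
    (h18 : Q (ec ⟨m + 3, by omega⟩, false) (eb 0, false))
    (h19 : Q (ec c0, true) (pre 3, true)) (h20 : Q (ec c1, true) (pre 1, true))
    (h21 : Q (ec c2, true) (pre 2, true)) (h22 : ∀ k, Q (ec (ck k), true) (a k, true))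
    (h23 : Q (eb 0, false) (eb 1, false)) (h24 : Q (eb 0, true) (pre 0, false))
    (h25 : Q (eb 1, true) (pre 3, false)) : Q x y := by
  obtain ⟨p, s⟩ := x
  rcases p with i | k | k | k | j | i <;> rcases s with _ | _
  · fin_cases i <;> simp [next] at h <;> subst h <;> assumption
  · fin_cases i <;> simp [next] at h <;> subst h <;> assumption
  · simp only [next] at h
    split_ifs at h with hk
    cases h; exact h12 ⟨k, hk⟩
  · simp only [next] at h
    split_ifs at h with hk
    cases h; exact h13 ⟨k, by omega⟩
  · simp only [next] at h
    split_ifs at h with hk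
    cases h; exact h14 k hk
  · cases h; exact h15 k
  · cases h; exact h16 k
  · simp [next] at h
  · simp only [next] at h
    split_ifs at h with hk
    · cases h; exact h17 j hk
    · cases h
      have : j = ⟨m + 3, by omega⟩ := by ext; simp; omega
      rw [this]; exact h18
  · simp only [next, fC, Option.some.injEq] at h
    split_ifs at h with e0 e1 e2
    · subst h; have : j = c0 := by ext; simpa [c0] using e0
      rw [this]; exact h19
    · subst h; have : j = c1 := by ext; simpa [c1] using e1
      rw [this]; exact h20
    · subst h; have : j = c2 := by ext; simpa [c2] using e2
      rw [this]; exact h21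
    · subst h
      have : j = ck ⟨j.1 - 3, by omega⟩ := by ext; simp [ck]; omega
      conv => arg 1; rw [this]
      exact h22 _
  · fin_cases i <;> simp [next] at h <;> subst h <;> assumption
  · fin_cases i <;> simp [next] at h <;> subst h <;> assumption

theorem next_mk (Q : Pt m × Bool → Prop)
    (h : ∀ x, (∃ y, next y = some x) → Q x) (he : ∀ j, Q (ec j, true)) (he0 : Q (ec c0, false))
    (hb : ∀ i, Q (eb i, true)) (x : Pt m × Bool) : Q x := by
  obtain ⟨p, s⟩ := x
  rcases p with i | k | k | k | j | i <;> rcases s with _ | _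
  · apply h
    fin_cases i
    · exact ⟨(eb 0, true), rfl⟩
    · exact ⟨(pre 0, false), rfl⟩
    · exact ⟨(pre 1, false), rfl⟩
    · exact ⟨(eb 1, true), rfl⟩
    · exact ⟨(pre 3, false), rfl⟩
    · exact ⟨(pre 4, false), rfl⟩
    · exact ⟨(pre 5, false), rfl⟩
  · apply h
    fin_cases i
    · exact ⟨(pre 3, true), rfl⟩
    · exact ⟨(ec c1, true), by simp [next, fC, c1]⟩
    · exact ⟨(ec c2, true), by simp [next, fC, c2]⟩
    · exact ⟨(ec c0, true), by simp [next, fC, c0]⟩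
    · exact ⟨(pre 1, true), rfl⟩
    · exact ⟨(pre 2, true), rfl⟩
    · exact ⟨(pre 0, true), rfl⟩
  · apply h
    obtain ⟨k, hk⟩ := k
    rcases k with _ | k
    · exact ⟨(pre 2, false), rfl⟩
    · exact ⟨(b ⟨k, by omega⟩, false), rfl⟩
  · apply h
    obtain ⟨k, hk⟩ := k
    rcases k with _ | k
    · exact ⟨(pre 6, true), rfl⟩
    · exact ⟨(J ⟨k, by omega⟩, true), by simp [next]; omega⟩
  · apply h
    exact ⟨(J ⟨k, by omega⟩, false), by simp only [next]; rw [dif_pos k.2]⟩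
  · apply h
    refine ⟨(ec (ck k), true), by simp [next, fC, ck]⟩
  · apply h
    obtain ⟨k, hk⟩ := k
    rcases k with _ | k
    · exact ⟨(pre 6, false), rfl⟩
    · exact ⟨(a ⟨k, by omega⟩, false), by simp [next]; omega⟩
  · apply h
    exact ⟨(a k, true), rfl⟩
  · obtain ⟨k, hk⟩ := j
    rcases k with _ | k
    · exact he0
    · exact h _ ⟨(ec ⟨k, by omega⟩, false), by simp only [next]; rw [dif_pos hk]⟩
  · exact he j
  · apply h
    fin_cases i
    · exact ⟨(ec ⟨m + 3, by omega⟩, false), by simp [next]⟩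
    · exact ⟨(eb 0, false), rfl⟩
  · exact hb i

noncomputable def DF (m : ℕ) : LBData ![1, 2, m + 4] where
  P := Pt m
  fin := fint
  first := first
  next := next
  tr := tr
  time := time
  hi := hi
  ho := ho
  tr_first := by
    rintro ⟨i, k⟩
    fin_cases i
    · simp only [first, tr, tA]
      congr 1
      change Fin 1 at k
      exact (Subsingleton.elim (α := Fin 1) _ _)
    · simp only [first, tr, tB]
      change Fin 2 at k
      have : k.1 % 2 = k.1 := Nat.mod_eq_of_lt k.2
      congr 1
      exact Fin.ext this
    · rfl
  tr_next := by
    intro x y h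
    refine next_cases h (fun x y => tr y = tr x) ?_ ?_ ?_ ?_ ?_ ?_ ?_ ?_ ?_ ?_ ?_ ?_ ?_ ?_ ?_ ?_
      ?_ ?_ ?_ ?_ ?_ ?_ ?_ ?_ ?_ ?_ <;> try rfl
    · intro k; rfl
    · intro k; rfl
    · intro k hk; simp only [tr, tB]; congr 2; omega
    · intro k; rfl
    · intro k; rfl
    · intro k hk; rfl
    · intro k; rfl
  tr_ne := by
    rintro (i | k | k | k | j | i)
    · fin_cases i <;> simp [tr, tB, tC]
    all_goals simp [tr, tB, tC, tA]
  prev := by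
    apply next_mk
    · intro x hx; exact Or.inr hx
    · intro j; left; rfl
    · left; rfl
    · intro i; left; fin_cases i <;> rfl
  time_lt := by
    intro x y h
    refine next_cases h (fun x y => time x.1 < time y.1) ?_ ?_ ?_ ?_ ?_ ?_ ?_ ?_ ?_ ?_ ?_ ?_ ?_ ?_
      ?_ ?_ ?_ ?_ ?_ ?_ ?_ ?_ ?_ ?_ ?_ ?_ <;> simp [time, c0, c1, c2, ck] <;> intros <;> omega
  hpt := by
    intro i p h
    obtain ⟨s, hs⟩ := h
    rcases p with q | k | k | k | j | q
    · fin_cases q <;> fin_cases s <;> simp [tr, tB, tC] at hs <;> subst hs <;> simp [hi, ho] <;>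
        omega
    all_goals fin_cases s <;> simp [tr, tB, tC, tA] at hs <;> subst hs <;> simp [hi, ho] <;>
      (try split_ifs) <;> omega
  hpt' := by
    intro i p h
    have h1 := fun hh => h ⟨false, hh⟩
    have h2 := fun hh => h ⟨true, hh⟩
    rcases p with q | k | k | k | j | q
    · fin_cases q <;> fin_cases i <;> simp [tr, tB, tC] at h1 h2 <;> simp [hi, ho]
    all_goals fin_cases i <;> simp [tr, tB, tC, tA] at h1 h2 <;> simp [hi, ho]
  hnx := by
    intro i x y h
    refine next_cases h (fun x y => (tr x).1 = i → hi i y.1 < ho i x.1) ?_ ?_ ?_ ?_ ?_ ?_ ?_ ?_ ?_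
      ?_ ?_ ?_ ?_ ?_ ?_ ?_ ?_ ?_ ?_ ?_ ?_ ?_ ?_ ?_ ?_ ?_ <;> intros <;> rename_i hs <;>
      simp [tr, tB, tC, tA] at hs <;> subst hs <;> simp [hi, ho, c0, c1, c2, ck, time] <;> omega
  hnx' := by
    intro i x y h
    refine next_cases h (fun x y => (tr x).1 ≠ i → ho i x.1 < hi i y.1) ?_ ?_ ?_ ?_ ?_ ?_ ?_ ?_ ?_
      ?_ ?_ ?_ ?_ ?_ ?_ ?_ ?_ ?_ ?_ ?_ ?_ ?_ ?_ ?_ ?_ ?_ <;> intros <;> rename_i hs <;>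
      fin_cases i <;>
      simp [tr, tB, tC, tA] at hs <;> simp [hi, ho, c0, c1, c2, ck, time] <;> (try split_ifs) <;>
      omega

end Pt

theorem lb4 (m : ℕ) : MAtLeast ![1, 2, m + 4] (4 * (m + 4) + 1) :=
  (Pt.DF m).mAtLeast _ Pt.card.ge

end MLow

namespace MTwo
open Relation

section word
variable {P : Type} [LinearOrder P] {β κ : Type}

/-- immediate predecessor inside a colour class -/
def prv {β : Type} (f : P → β) (q p : P) : Prop :=
  q < p ∧ f q = f p ∧ ∀ x, q < x → x < p → f x ≠ f p

/-- arcs of the reduced residual graph -/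
def Darc {β κ : Type} (f : P → β) (g : P → κ) (p q : P) : Prop :=
  prv f q p ∨ ∃ p', prv g p p' ∧ prv f q p'

theorem exists_prv [Finite P] (f : P → β) {q p : P} (h : q < p) (e : f q = f p) :
    ∃ r, prv f r p ∧ q ≤ r := by
  classical
  obtain ⟨r, hr, hm⟩ := Set.exists_max_image {x | q ≤ x ∧ x < p ∧ f x = f p} id
    (Set.toFinite _) ⟨q, le_rfl, h, e⟩
  refine ⟨r, ⟨hr.2.1, hr.2.2, fun x h1 h2 h3 => ?_⟩, hr.1⟩
  exact absurd (hm x ⟨hr.1.trans h1.le, h2, h3⟩) (not_le.2 h1)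

theorem exists_nxt [Finite P] (f : P → β) {q p : P} (h : q < p) (e : f q = f p) :
    ∃ r, prv f q r ∧ r ≤ p := by
  classical
  obtain ⟨r, hr, hm⟩ := Set.exists_min_image {x | q < x ∧ x ≤ p ∧ f x = f p} id
    (Set.toFinite _) ⟨p, h, le_rfl, rfl⟩
  refine ⟨r, ⟨hr.1, e.trans hr.2.2.symm, fun x h1 h2 h3 => ?_⟩, hr.2.1⟩
  exact absurd (hm x ⟨h1, h2.le.trans hr.2.1, h3.trans hr.2.2⟩) (not_le.2 h2)

theorem prv_le {f : P → β} {q p x : P} (h : prv f q p) (hx : x < p) (e : f x = f p) : x ≤ q := by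
  by_contra hc
  exact h.2.2 x (not_le.1 hc) hx e

theorem prv_uniq {f : P → β} {q q' p : P} (h : prv f q p) (h' : prv f q' p) : q = q' :=
  le_antisymm (prv_le h' h.1 h.2.1) (prv_le h h'.1 h'.2.1)

theorem chain_arc [Finite P] (f : P → β) (g : P → κ) (q : P) :
    ∀ p, q ≤ p → f q = f p → ReflTransGen (Darc f g) p q := by
  have wf : WellFounded (fun a b : P => a < b) := wellFounded_lt
  intro p
  induction p using wf.induction with
  | _ p ih =>
    intro h e
    rcases h.eq_or_lt with rfl | h
    · exact .refl
    · obtain ⟨r, hr, hq⟩ := exists_prv f h e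
      exact (ReflTransGen.single (show Darc f g p r from Or.inl hr)).trans (ih r hr.1 hq (e.trans hr.2.1.symm))

variable [Finite P] {b : P → Bool} {c : P → κ}
  (h1 : ∀ p, ¬ TransGen (Darc b c) p p) (h2 : ∀ p, ¬ TransGen (Darc c b) p p)

include h1 in
theorem wF0 {p p' : P} (h : prv c p p') : b p ≠ b p' := by
  intro e
  obtain ⟨q, hq, hle⟩ := exists_prv b h.1 e
  exact h1 p (TransGen.trans_left (.single (Or.inr ⟨p', h, hq⟩))
    (chain_arc b c p q hle (e.trans hq.2.1.symm)))

include h1 in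
theorem wF1 {x x' y y' : P} (h : prv c x y) (h' : prv c y' x') (e : b x = b x')
    (hx : x < x') : y ≤ y' := by
  by_contra hc
  have hc := not_le.1 hc
  have e1 := wF0 h1 h
  have e2 := wF0 h1 h'
  have ey : b y' = b y := by
    revert e e1 e2; cases b x <;> cases b y <;> cases b x' <;> cases b y' <;> simp
  obtain ⟨q, hq, hle⟩ := exists_prv b hc ey
  obtain ⟨r, hr, hle'⟩ := exists_prv b hx e
  have d1 : Darc b c x q := Or.inr ⟨y, h, hq⟩
  have d2 : Darc b c y' r := Or.inr ⟨x', h', hr⟩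
  have a1 := TransGen.trans_left (TransGen.single d1)
    (chain_arc b c y' q hle (ey.trans hq.2.1.symm))
  have a2 := TransGen.trans_left (TransGen.single d2)
    (chain_arc b c x r hle' (e.trans hr.2.1.symm))
  exact h1 x (a1.trans a2)

/-- targets of the walk -/
def Ys (b : P → Bool) (c : P → κ) (z : P) : Set P := {y | ∃ x, x ≤ z ∧ b x = b z ∧ prv c y x}

def Pi (b : P → Bool) (c : P → κ) (z : P) : Set P :=
  {u | (b u = b z ∧ u ≤ z) ∨ (b u ≠ b z ∧ ∃ y ∈ Ys b c z, u ≤ y)}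

def Inter (c : P → κ) (u : P) : Prop := (∃ y, prv c y u) ∧ ∃ y, prv c u y

def Int (b : P → Bool) (c : P → κ) (z : P) : Set P := {u | u ∈ Pi b c z ∧ u ≠ z ∧ Inter c u}

omit [Finite P] in
theorem Ys_lt {z y : P} (h : y ∈ Ys b c z) : y < z := by
  obtain ⟨x, hx, _, hp⟩ := h
  exact hp.1.trans_le hx

include h1 in
theorem Ys_b {z y : P} (h : y ∈ Ys b c z) : b y ≠ b z := by
  obtain ⟨x, hx, e, hp⟩ := h
  rw [← e]; exact wF0 h1 hp

omit [Finite P] in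
theorem Pi_le {z u : P} (h : u ∈ Pi b c z) : u ≤ z := by
  rcases h with h | ⟨_, y, hy, h⟩
  · exact h.2
  · exact h.trans (Ys_lt hy).le

include h1 in
theorem Ys_Pi {z y : P} (h : y ∈ Ys b c z) : y ∈ Pi b c z :=
  Or.inr ⟨Ys_b h1 h, y, h, le_rfl⟩

omit [Finite P] in
theorem init_le [Finite P] {x w : P} (h : ¬ ∃ y, prv c y x) (e : c w = c x) : x ≤ w := by
  by_contra hc
  obtain ⟨r, hr, _⟩ := exists_prv c (not_le.1 hc) e
  exact h ⟨r, hr⟩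

theorem bne {x y z : Bool} (h : x ≠ y) (h' : z ≠ y) : x = z := by
  cases x <;> cases y <;> cases z <;> simp_all

/-- adding new colours -/
theorem card_new {S T : Set P} (hST : S ⊆ T) {x : P} (hx : x ∈ T) (hn : ∀ w ∈ S, c w ≠ c x) :
    (c '' S).ncard + 1 ≤ (c '' T).ncard := by
  have : insert (c x) (c '' S) ⊆ c '' T := by
    rintro _ (rfl | ⟨w, hw, rfl⟩)
    · exact ⟨x, hx, rfl⟩
    · exact ⟨w, hST hw, rfl⟩
  have h := Set.ncard_le_ncard this (Set.toFinite _)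
  rwa [Set.ncard_insert_of_notMem] at h
  rintro ⟨w, hw, e⟩
  exact hn w hw e

include h1 h2 in
theorem wPhi : ∀ (z y1 ys : P), prv c y1 z → IsGreatest (Ys b c z) ys →
    (Int b c z).ncard + 1 ≤ (c '' Pi b c z).ncard ∧
    ((Int b c z).ncard + 1 = (c '' Pi b c z).ncard → ReflTransGen (Darc c b) y1 ys) := by
  have wf : WellFounded (fun a b : P => a < b) := wellFounded_lt
  intro z
  induction z using wf.induction with
  | _ z ih =>
  intro y1 ys hy1 hys
  have hzPi : z ∈ Pi b c z := Or.inl ⟨rfl, le_rfl⟩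
  have hy1Y : y1 ∈ Ys b c z := ⟨z, le_rfl, rfl, hy1⟩
  have hysPi := Ys_Pi h1 hys.1
  rcases (Int b c z).eq_empty_or_nonempty with hE | hne
  · -- no interior point
    rw [hE, Set.ncard_empty]
    constructor
    · exact (Set.ncard_pos (Set.toFinite _)).2 ⟨_, z, hzPi, rfl⟩
    · intro hc
      obtain ⟨a, ha⟩ := Set.ncard_eq_one.1 hc.symm
      have e1 : c z = a := by
        have : c z ∈ c '' Pi b c z := ⟨z, hzPi, rfl⟩
        rwa [ha] at this
      have e2 : c ys = a := by
        have : c ys ∈ c '' Pi b c z := ⟨ys, hysPi, rfl⟩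
        rwa [ha] at this
      have : ys = y1 := le_antisymm (prv_le hy1 (Ys_lt hys.1) (e2.trans e1.symm)) (hys.2 hy1Y)
      rw [this]
  obtain ⟨v, hv, hvm⟩ := Set.exists_max_image (Int b c z) id (Set.toFinite _) hne
  simp only [id] at hvm
  have hvz : v < z := lt_of_le_of_ne (Pi_le hv.1) hv.2.1
  obtain ⟨⟨pv, hpv⟩, ⟨nv, hnv⟩⟩ := hv.2.2
  -- points of Ys later than v are initial
  have key : ∀ y ∈ Ys b c z, v < y → ¬ ∃ w, prv c w y := by
    rintro y hy hlt hw
    obtain ⟨x, hx, e, hp⟩ := id hy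
    exact absurd (hvm y ⟨Ys_Pi h1 hy, (Ys_lt hy).ne, hw, x, hp⟩) (not_le.2 hlt)
  by_cases hb : b v = b z
  · have hle := wF1 h1 hnv hy1 hb hvz
    have hne : nv ≠ y1 := by
      rintro rfl
      exact key nv hy1Y hnv.1 ⟨v, hnv⟩
    have hlt := lt_of_le_of_ne hle hne
    have hin := key y1 hy1Y (hnv.1.trans hlt)
    have hbn : b nv ≠ b z := by rw [← hb]; exact (wF0 h1 hnv).symm
    obtain ⟨yy, hyy, hyym⟩ := Set.exists_max_image (Ys b c nv) id (Set.toFinite _)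
      ⟨v, nv, le_rfl, rfl, hnv⟩
    have I := (ih nv (hlt.trans hy1.1) v yy hnv ⟨hyy, hyym⟩).1
    have hsub : Pi b c nv ⊆ Pi b c z := by
      rintro u hu
      have hle' := Pi_le hu
      by_cases hbu : b u = b z
      · exact Or.inl ⟨hbu, hle'.trans (hlt.le.trans hy1.1.le)⟩
      · exact Or.inr ⟨hbu, y1, hy1Y, hle'.trans hle⟩
    have hint : Int b c z ⊆ Int b c nv := by
      intro u hu
      have huv := hvm u hu
      refine ⟨?_, (huv.trans_lt hnv.1).ne, hu.2.2⟩
      by_cases hbu : b u = b nv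
      · exact Or.inl ⟨hbu, huv.trans hnv.1.le⟩
      · exact Or.inr ⟨hbu, v, ⟨nv, le_rfl, rfl, hnv⟩, huv⟩
    have hnew := card_new (c := c) hsub (Ys_Pi h1 hy1Y) (fun w hw e =>
      absurd (init_le hin e) (not_le.2 ((Pi_le hw).trans_lt hlt)))
    have := Set.ncard_le_ncard hint (Set.toFinite _)
    exact ⟨by omega, fun h => by omega⟩
  · -- other side
    obtain ⟨xs, hxs, hxsm⟩ := Set.exists_max_image (Ys b c v) id (Set.toFinite _)
      ⟨pv, v, le_rfl, rfl, hpv⟩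
    simp only [id] at hxsm
    have hpvxs : pv ≤ xs := hxsm pv ⟨v, le_rfl, rfl, hpv⟩
    obtain ⟨I1, I2⟩ := ih v hvz pv xs hpv ⟨hxs, hxsm⟩
    have hxb : b xs = b z := bne (Ys_b h1 hxs) (Ne.symm hb)
    have hpb : b pv = b z := bne (wF0 h1 hpv) (Ne.symm hb)
    have hxsv := Ys_lt hxs
    obtain ⟨x1, hx1, hx1z⟩ := exists_nxt b (hxsv.trans hvz) hxb
    have hx1b : b x1 = b z := hx1.2.1.symm.trans hxb
    have hx1Pi : x1 ∈ Pi b c z := Or.inl ⟨hx1b, hx1z⟩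
    have hvY : ∃ y ∈ Ys b c z, v ≤ y := by
      rcases hv.1 with h | h
      · exact absurd h.1 hb
      · exact h.2
    have hsub : Pi b c v ⊆ Pi b c z := by
      intro u hu
      have hle' := Pi_le hu
      by_cases hbu : b u = b z
      · exact Or.inl ⟨hbu, hle'.trans hvz.le⟩
      · obtain ⟨y, hy, hvy⟩ := hvY
        exact Or.inr ⟨hbu, y, hy, hle'.trans hvy⟩
    have hPixs : ∀ u ∈ Pi b c v, b u ≠ b v → u ≤ xs := by
      rintro u (hu | ⟨_, y, hy, hle⟩) hn
      · exact absurd hu.1 hn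
      · exact hle.trans (hxsm y hy)
    have hint : Int b c z ⊆ insert v (Int b c v) := by
      intro u hu
      have huv := hvm u hu
      by_cases huv' : u = v
      · exact Or.inl huv'
      refine Or.inr ⟨?_, huv', hu.2.2⟩
      by_cases hbu : b u = b v
      · exact Or.inl ⟨hbu, huv⟩
      · refine Or.inr ⟨hbu, xs, hxs, ?_⟩
        by_contra hc
        have hc := not_le.1 hc
        obtain ⟨⟨w, hw⟩, _⟩ := hu.2.2
        have := wF1 h1 hpv hw (hpb.trans (bne hbu (Ne.symm hb)).symm) (hpvxs.trans_lt hc)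
        exact absurd (this.trans_lt hw.1) (not_lt.2 huv)
    have hcard : (Int b c z).ncard ≤ (Int b c v).ncard + 1 :=
      (Set.ncard_le_ncard hint (Set.toFinite _)).trans (Set.ncard_insert_le _ _)
    -- new colours
    have newY : ∀ y ∈ Ys b c z, v < y → ∀ w ∈ Pi b c v, c w ≠ c y := fun y hy hlt w hw e =>
      absurd (init_le (key y hy hlt) e) (not_le.2 ((Pi_le hw).trans_lt hlt))
    have hvy1 : v ≤ y1 := wF1 h1 hpv hy1 hpb (hpv.1.trans hvz)
    -- two new colours
    have two : ∀ y y' : P, y ∈ Pi b c z → y' ∈ Pi b c z → (∀ w ∈ Pi b c v, c w ≠ c y) →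
        (∀ w ∈ Pi b c v, c w ≠ c y') → c y ≠ c y' →
        (c '' Pi b c v).ncard + 2 ≤ (c '' Pi b c z).ncard := by
      intro y y' hy hy' hn hn' hyy
      have a1 := card_new (c := c) (S := Pi b c v) (T := insert y (Pi b c v))
        (Set.subset_insert _ _) (Set.mem_insert _ _) hn
      have a2 := card_new (c := c) (S := insert y (Pi b c v)) (T := Pi b c z)
        (Set.insert_subset hy hsub) hy' (by
          rintro w (rfl | hw)
          · exact hyy
          · exact hn' w hw)
      omega
    have ysgt : ys ≠ y1 → v < ys := fun h =>
      hvy1.trans_lt (lt_of_le_of_ne (hys.2 hy1Y) (Ne.symm h))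
    by_cases hx1i : ∃ y, prv c y x1
    · obtain ⟨y', hy'⟩ := hx1i
      have hvy' : v ≤ y' := wF1 h1 hpv hy' (hpb.trans hx1b.symm) (hpvxs.trans_lt hx1.1)
      have hy'Y : y' ∈ Ys b c z := ⟨x1, hx1z, hx1b, hy'⟩
      rcases hvy'.eq_or_lt with rfl | hlt
      · have hstrict : (Int b c v).ncard + 1 ≠ (c '' Pi b c v).ncard := by
          intro h
          have a1 : Darc c b xs v := Or.inr ⟨x1, hx1, hy'⟩
          have a2 : Darc c b v pv := Or.inl hpv
          exact h2 xs (TransGen.trans_left ((TransGen.single a1).trans (TransGen.single a2)) (I2 h))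
        have hmono : (c '' Pi b c v).ncard ≤ (c '' Pi b c z).ncard :=
          Set.ncard_le_ncard (Set.image_mono hsub) (Set.toFinite _)
        refine ⟨by omega, fun h => ?_⟩
        by_cases hyy : ys = y1
        · rw [hyy]
        · have := card_new (c := c) hsub hysPi (newY ys hys.1 (ysgt hyy))
          omega
      · have hc1 := card_new (c := c) hsub (Ys_Pi h1 hy'Y) (newY y' hy'Y hlt)
        refine ⟨by omega, fun h => ?_⟩
        by_cases hyy : ys = y1
        · rw [hyy]
        have hgt := ysgt hyy
        have ceq : ∀ y ∈ Ys b c z, v < y → y ≠ ys → False := by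
          intro y hy hlt hne
          have := two y ys (Ys_Pi h1 hy) hysPi (newY y hy hlt) (newY ys hys.1 hgt) (fun e =>
            hne (le_antisymm (init_le (key y hy hlt) e.symm) (init_le (key ys hys.1 hgt) e)))
          omega
        have e1 : y' = ys := by
          by_contra hne
          exact ceq y' hy'Y hlt hne
        have e2 : v = y1 := by
          by_contra hne
          exact ceq y1 hy1Y (lt_of_le_of_ne hvy1 hne) (Ne.symm hyy)
        subst e1; subst e2
        have a2 : Darc c b v pv := Or.inl hpv
        have a3 : Darc c b xs y' := Or.inr ⟨x1, hx1, hy'⟩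
        exact ((ReflTransGen.single a2).trans (I2 (by omega))).trans (.single a3)
    · have hnx : ∀ w ∈ Pi b c v, c w ≠ c x1 := by
        intro w hw e
        have hle := init_le hx1i e
        by_cases hbw : b w = b v
        · have hne : x1 ≠ w := by
            rintro rfl
            exact hb (hbw.symm.trans hx1b)
          obtain ⟨a, ha, hale⟩ := exists_prv c (lt_of_le_of_ne hle hne) e.symm
          have := hxsm a ⟨w, Pi_le hw, hbw, ha⟩
          exact absurd (this.trans_lt hx1.1) (not_lt.2 hale)
        · exact absurd ((hPixs w hw hbw).trans_lt hx1.1) (not_lt.2 hle)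
      have hc1 := card_new (c := c) hsub hx1Pi hnx
      refine ⟨by omega, fun h => ?_⟩
      by_cases hyy : ys = y1
      · rw [hyy]
      have hgt := ysgt hyy
      have := two x1 ys hx1Pi hysPi hnx (newY ys hys.1 hgt) (fun e => by
        have : x1 = ys := le_antisymm (init_le hx1i e.symm) (init_le (key ys hys.1 hgt) e)
        exact Ys_b h1 hys.1 (this ▸ hx1b))
      omega

theorem word_bound (n : ℕ) (hn : 1 ≤ n) {c : P → Fin n} 
    (h1 : ∀ p, ¬ TransGen (Darc b c) p p) (h2 : ∀ p, ¬ TransGen (Darc c b) p p) :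
    Nat.card P ≤ 3 * n - 1 := by
  classical
  have hI : {u : P | Inter c u}.ncard ≤ n - 1 := by
    rcases {u : P | Inter c u}.eq_empty_or_nonempty with hE | hne
    · rw [hE]; simp
    obtain ⟨v, hv, hvm⟩ := Set.exists_max_image {u : P | Inter c u} id (Set.toFinite _) hne
    simp only [id] at hvm
    obtain ⟨_, z, hz⟩ := id hv
    obtain ⟨yy, hyy, hyym⟩ := Set.exists_max_image (Ys b c z) id (Set.toFinite _)
      ⟨v, z, le_rfl, rfl, hz⟩
    have I := (wPhi h1 h2 z v yy hz ⟨hyy, hyym⟩).1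
    have hsub : {u : P | Inter c u} ⊆ Int b c z := by
      intro u hu
      have huv := hvm u hu
      refine ⟨?_, (huv.trans_lt hz.1).ne, hu⟩
      by_cases hbu : b u = b z
      · exact Or.inl ⟨hbu, huv.trans hz.1.le⟩
      · exact Or.inr ⟨hbu, v, ⟨z, le_rfl, rfl, hz⟩, huv⟩
    have a1 := Set.ncard_le_ncard hsub (Set.toFinite _)
    have a2 : (c '' Pi b c z).ncard ≤ n := by
      have := Set.ncard_le_card (c '' Pi b c z)
      simpa using this
    omega
  have hA : {u : P | ¬ ∃ y, prv c y u}.ncard ≤ n := by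
    have := Set.ncard_le_ncard_of_injOn (s := {u : P | ¬ ∃ y, prv c y u}) (t := Set.univ) c
      (fun _ _ => Set.mem_univ _) (fun x hx y hy e =>
        le_antisymm (init_le hx e.symm) (init_le hy e))
    simpa [Set.ncard_univ] using this
  have hB : {u : P | ¬ ∃ y, prv c u y}.ncard ≤ n := by
    have := Set.ncard_le_ncard_of_injOn (s := {u : P | ¬ ∃ y, prv c u y}) (t := Set.univ) c
      (fun _ _ => Set.mem_univ _) (fun x hx y hy e => by
        rcases lt_trichotomy x y with h | h | h
        · obtain ⟨r, hr, _⟩ := exists_nxt c h e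
          exact absurd ⟨r, hr⟩ hx
        · exact h
        · obtain ⟨r, hr, _⟩ := exists_nxt c h e.symm
          exact absurd ⟨r, hr⟩ hy)
    simpa [Set.ncard_univ] using this
  have hU : (Set.univ : Set P) ⊆ {u : P | ¬ ∃ y, prv c y u} ∪ {u : P | ¬ ∃ y, prv c u y} ∪
      {u : P | Inter c u} := by
    intro u _
    by_cases h : ∃ y, prv c y u
    · by_cases h' : ∃ y, prv c u y
      · exact Or.inr ⟨h, h'⟩
      · exact Or.inl (Or.inr h')
    · exact Or.inl (Or.inl h)
  have := Set.ncard_le_ncard hU (Set.toFinite _)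
  have u1 := Set.ncard_union_le ({u : P | ¬ ∃ y, prv c y u} ∪ {u : P | ¬ ∃ y, prv c u y})
    {u : P | Inter c u}
  have u2 := Set.ncard_union_le {u : P | ¬ ∃ y, prv c y u} {u : P | ¬ ∃ y, prv c u y}
  rw [Set.ncard_univ] at this
  omega

end word
end MTwo

namespace MTwo

def forceN {α : Type} (x : Nat) (k : Nat → α) : α := match x with
  | 0 => k 0
  | y + 1 => k (y + 1)

def forceL {α : Type} : List Nat → (List Nat → α) → α
  | [], k => k []
  | x :: xs, k => forceN x fun x' => forceL xs fun xs' => k (x' :: xs')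

def bt (r i : Nat) : Bool := Nat.beq (Nat.land (Nat.shiftRight r i) 1) 1
def clr (r two : Nat) : Nat := Nat.xor (Nat.lor r two) two

def stepF (M : List Nat) (s t : Nat) : List Nat :=
  let two := Nat.lor (2 ^ s) (2 ^ t)
  let rt := M.getD t 0
  ((M.map fun r => clr (bif bt r s then Nat.lor r rt else r) two).set s
    (Nat.lor (clr rt two) two)).set t (Nat.lor (clr rt two) two)

def stepP (M : List Nat) (s t : Nat) : List Nat :=
  let two := Nat.lor (2 ^ s) (2 ^ t)
  let rs := M.getD s 0
  ((M.map fun r => bif bt r t then Nat.lor (clr (Nat.lor r rs) two) two else clr r two).set s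
    two).set t two

def srch (w : Nat) (L : List (Nat × Nat)) : Nat → Bool → List Nat → List Nat → Bool
  | 0, _, _, _ => true
  | k + 1, ph, MB, MC =>
    (bif ph then false else L.any fun l =>
      bif bt (MB.getD l.1 0) l.2 then false else
      bif bt (MC.getD l.2 0) l.1 then false else
      forceL (stepF MB l.2 l.1) fun MB' => forceL (stepF MC l.1 l.2) fun MC' =>
        srch w L k false MB' MC') ||
    L.any fun l =>
      bif bt (MB.getD (w + l.2) 0) (w + l.1) then false else
      bif bt (MC.getD (w + l.1) 0) (w + l.2) then false else
      forceL (stepP MB (w + l.2) (w + l.1)) fun MB' =>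
      forceL (stepP MC (w + l.1) (w + l.2)) fun MC' =>
        srch w L k true MB' MC'

/-- transitive closure of the initial arcs -/
def initM (w : Nat) (sg : Nat → Bool) : List Nat :=
  -- row of f_u, built from the top
  let rec go : Nat → Nat → List Nat → List Nat → Nat → List Nat
    | 0, _, F, G, _ => F ++ G
    | k + 1, u, F, G, last =>
      let self := Nat.lor (2 ^ u) (2 ^ (w + u))
      let fr := Nat.lor self last
      let gr := bif sg u then 2 ^ (w + u) else fr
      go k (u - 1) (fr :: F) (gr :: G) gr
  go w (w - 1) [] [] 0

def letters (w b1 b2 : Nat) : List (Nat × Nat) :=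
  [b1, b2].flatMap fun b => ((List.range w).filter fun c => !(c == b1 || c == b2)).map fun c => (b, c)


theorem forceN_eq {α : Type} (x : Nat) (k : Nat → α) : forceN x k = k x := by
  cases x <;> rfl

theorem forceL_eq {α : Type} (l : List Nat) : ∀ (k : List Nat → α), forceL l k = k l := by
  induction l with
  | nil => intro k; rfl
  | cons x xs ih => intro k; simp [forceL, forceN_eq, ih]

theorem bt_eq (r i : Nat) : bt r i = r.testBit i := by
  have h : bt r i = ((r >>> i &&& 1) == 1) := by
    rw [Bool.eq_iff_iff, beq_iff_eq, ← Nat.beq_eq]; exact Iff.rfl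
  have h2 : (r >>> i &&& 1) = (r >>> i) % 2 := Nat.and_one_is_mod _
  rw [h, Nat.testBit, Nat.and_comm 1, h2]
  rcases Nat.mod_two_eq_zero_or_one (r >>> i) with h | h <;> simp [h]

theorem bt_lor (a b j : Nat) : bt (Nat.lor a b) j = (bt a j || bt b j) := by
  rw [bt_eq, bt_eq, bt_eq]; exact Nat.testBit_or a b j

theorem bt_two (s t j : Nat) : bt (Nat.lor (2 ^ s) (2 ^ t)) j = (decide (s = j) || decide (t = j)) := by
  rw [bt_lor, bt_eq, bt_eq, Nat.testBit_two_pow, Nat.testBit_two_pow]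

theorem bt_clr (r two j : Nat) : bt (clr r two) j = (bt r j && !bt two j) := by
  have : bt (clr r two) j = ((bt r j || bt two j) ^^ bt two j) := by
    unfold clr
    rw [← bt_lor, bt_eq, bt_eq, bt_eq]; exact Nat.testBit_xor _ _ j
  rw [this]; cases bt r j <;> cases bt two j <;> rfl

theorem getD_set2 (L : List Nat) (s t a i j : Nat)
    (h : bt (((L.set s a).set t a).getD i 0) j = true) :
    ((i = s ∨ i = t) ∧ bt a j = true) ∨ (i ≠ s ∧ i ≠ t ∧ bt (L.getD i 0) j = true) := by
  have z : bt 0 j = false := by rw [bt_eq]; simp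
  rw [List.getD_eq_getElem?_getD, List.getElem?_set] at h
  by_cases ht : t = i
  · subst ht
    rw [if_pos rfl] at h
    split_ifs at h
    · exact Or.inl ⟨Or.inr rfl, by simpa using h⟩
    · simp [z] at h
  rw [if_neg ht, List.getElem?_set] at h
  by_cases hs : s = i
  · subst hs
    rw [if_pos rfl] at h
    split_ifs at h
    · exact Or.inl ⟨Or.inl rfl, by simpa using h⟩
    · simp [z] at h
  rw [if_neg hs] at h
  exact Or.inr ⟨Ne.symm hs, Ne.symm ht, by rw [List.getD_eq_getElem?_getD]; exact h⟩

theorem getD_map_bt (L : List Nat) (f : Nat → Nat) (i j : Nat)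
    (h : bt ((L.map f).getD i 0) j = true) : bt (f (L.getD i 0)) j = true := by
  have z : bt 0 j = false := by rw [bt_eq]; simp
  rw [List.getD_eq_getElem?_getD, List.getElem?_map] at h
  rw [List.getD_eq_getElem?_getD]
  cases hh : L[i]? with
  | none => rw [hh] at h; simp [z] at h
  | some a => rw [hh] at h; simpa using h

open Relation

section sem
variable {X : Type} (r : X → X → Prop)

def InvM (M : List Nat) (nd : Nat → X) : Prop :=
  ∀ i j, bt (M.getD i 0) j = true → ReflTransGen r (nd i) (nd j)

def upd2 (nd : Nat → X) (s t : Nat) (l : X) : Nat → X := fun i => if i = s ∨ i = t then l else nd i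

theorem stepF_inv {M : List Nat} {nd : Nat → X} (h : InvM r M nd) {s t : Nat} {m l : X}
    (h1 : TransGen r (nd s) m) (h2 : ReflTransGen r m (nd t)) (h3 : ReflTransGen r l m) :
    InvM r (stepF M s t) (upd2 nd s t l) := by
  intro i j hb
  unfold stepF at hb
  rcases getD_set2 _ _ _ _ _ _ hb with ⟨hi, hb⟩ | ⟨his, hit, hb⟩
  · have e : upd2 nd s t l i = l := by simp [upd2, hi]
    rw [e]
    rw [bt_lor, bt_clr, bt_two] at hb
    by_cases hj : j = s ∨ j = t
    · have : upd2 nd s t l j = l := by simp [upd2, hj]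
      rw [this]
    · have : upd2 nd s t l j = nd j := by simp [upd2, hj]
      rw [this]
      push Not at hj
      simp [Ne.symm hj.1, Ne.symm hj.2] at hb
      exact (h3.trans h2).trans (h t j (by simpa using hb))
  · have e : upd2 nd s t l i = nd i := by simp [upd2, his, hit]
    rw [e]
    have hb := getD_map_bt _ _ _ _ hb
    rw [bt_clr, bt_two] at hb
    by_cases hj : j = s ∨ j = t
    · rcases hj with rfl | rfl <;> simp at hb
    · have : upd2 nd s t l j = nd j := by simp [upd2, hj]
      rw [this]
      push Not at hj
      simp [Ne.symm hj.1, Ne.symm hj.2] at hb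
      cases hs : bt (M.getD i 0) s
      · simp only [List.getD_eq_getElem?_getD] at hs
        rw [hs] at hb
        exact h i j (by simpa using hb)
      · have hs' := hs
        simp only [List.getD_eq_getElem?_getD] at hs'
        rw [hs', cond_true] at hb
        change bt (Nat.lor _ _) j = true at hb
        rw [bt_lor] at hb
        rcases Bool.or_eq_true_iff.1 hb with hb | hb
        · exact h i j (by simpa using hb)
        · exact (((h i s hs).trans h1.to_reflTransGen).trans h2).trans (h t j (by simpa using hb))

theorem stepP_inv {M : List Nat} {nd : Nat → X} (h : InvM r M nd) {s t : Nat} {m l : X}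
    (h1 : ReflTransGen r (nd t) l) (h2 : TransGen r l (nd s)) (h3 : ReflTransGen r l m) :
    InvM r (stepP M s t) (upd2 nd s t m) := by
  intro i j hb
  unfold stepP at hb
  rcases getD_set2 _ _ _ _ _ _ hb with ⟨hi, hb⟩ | ⟨his, hit, hb⟩
  · have e : upd2 nd s t m i = m := by simp [upd2, hi]
    rw [e]
    rw [bt_two] at hb
    have hj : j = s ∨ j = t := by
      simp at hb; omega
    have : upd2 nd s t m j = m := by simp [upd2, hj]
    rw [this]
  · have e : upd2 nd s t m i = nd i := by simp [upd2, his, hit]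
    rw [e]
    have hb := getD_map_bt _ _ _ _ hb
    cases hs : bt (M.getD i 0) t
    · rw [hs, cond_false, bt_clr, bt_two] at hb
      by_cases hj : j = s ∨ j = t
      · rcases hj with rfl | rfl <;> simp at hb
      · have : upd2 nd s t m j = nd j := by simp [upd2, hj]
        rw [this]
        simp only [Bool.and_eq_true] at hb
        exact h i j hb.1
    · rw [hs, cond_true, bt_lor, bt_clr, bt_two, bt_lor] at hb
      by_cases hj : j = s ∨ j = t
      · have : upd2 nd s t m j = m := by simp [upd2, hj]
        rw [this]
        exact ((h i t hs).trans h1).trans h3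
      · have : upd2 nd s t m j = nd j := by simp [upd2, hj]
        rw [this]
        push Not at hj
        simp [Ne.symm hj.1, Ne.symm hj.2] at hb
        rcases hb with hb | hb
        · exact h i j (by simpa using hb)
        · exact (((h i t hs).trans h1).trans h2.to_reflTransGen).trans (h s j (by simpa using hb))

def Good : (Nat → X) → List (Bool × Nat × Nat) → Prop
  | _, [] => True
  | nd, (false, s, t) :: L => ∃ m l, TransGen r (nd s) m ∧ ReflTransGen r m (nd t) ∧
      ReflTransGen r l m ∧ ¬ TransGen r m m ∧ Good (upd2 nd s t l) L
  | nd, (true, s, t) :: L => ∃ l m, ReflTransGen r (nd t) l ∧ TransGen r l (nd s) ∧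
      ReflTransGen r l m ∧ ¬ TransGen r (nd t) (nd t) ∧ Good (upd2 nd s t m) L

end sem

def ltB (w : Nat) (x : Bool × Nat × Nat) : Bool × Nat × Nat :=
  (x.1, (bif x.1 then w else 0) + x.2.2, (bif x.1 then w else 0) + x.2.1)
def ltC (w : Nat) (x : Bool × Nat × Nat) : Bool × Nat × Nat :=
  (x.1, (bif x.1 then w else 0) + x.2.1, (bif x.1 then w else 0) + x.2.2)

theorem noconfF {X : Type} {r : X → X → Prop} {M : List Nat} {nd : Nat → X} (h : InvM r M nd)
    {s t : Nat} {m : X} (h1 : TransGen r (nd s) m) (h2 : ReflTransGen r m (nd t))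
    (h4 : ¬ TransGen r m m) : bt (M.getD t 0) s = false := by
  by_contra hc
  have hc : bt (M.getD t 0) s = true := by simpa using hc
  exact h4 (TransGen.trans_right (h2.trans (h t s hc)) h1)

theorem noconfP {X : Type} {r : X → X → Prop} {M : List Nat} {nd : Nat → X} (h : InvM r M nd)
    {s t : Nat} {l : X} (h1 : ReflTransGen r (nd t) l) (h2 : TransGen r l (nd s))
    (h4 : ¬ TransGen r (nd t) (nd t)) : bt (M.getD s 0) t = false := by
  by_contra hc
  have hc : bt (M.getD s 0) t = true := by simpa using hc
  exact h4 (TransGen.trans_left (TransGen.trans_right h1 h2) (h s t hc))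

theorem srch_sound {X : Type} (rB rC : X → X → Prop) (w : Nat) (L : List (Nat × Nat)) :
    ∀ (ls : List (Bool × Nat × Nat)) (ph : Bool) (MB MC : List Nat) (nB nC : Nat → X),
      InvM rB MB nB → InvM rC MC nC → (∀ x ∈ ls, x.2 ∈ L) →
      ((ph, 0, 0) :: ls).Pairwise (fun x y => x.1 = true → y.1 = true) →
      Good rB nB (ls.map (ltB w)) → Good rC nC (ls.map (ltC w)) →
      srch w L ls.length ph MB MC = true := by
  intro ls
  induction ls with
  | nil => intros; rfl
  | cons x ls ih =>
    rintro ph MB MC nB nC hB hC hL hP gB gC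
    obtain ⟨p, b, c⟩ := x
    have hmem : (b, c) ∈ L := hL _ List.mem_cons_self
    have hL' : ∀ x ∈ ls, x.2 ∈ L := fun x hx => hL x (List.mem_cons_of_mem _ hx)
    have hP2 : ((p, 0, 0) :: ls).Pairwise (fun x y => x.1 = true → y.1 = true) := by
      rw [List.pairwise_cons] at hP ⊢
      have := hP.2
      rw [List.pairwise_cons] at this
      exact ⟨fun y hy => this.1 y hy, this.2⟩
    have hph : ph = true → p = true := fun h => (List.pairwise_cons.1 hP).1 _ List.mem_cons_self h
    rw [List.length_cons, srch]
    cases p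
    · have hph : ph = false := by cases ph <;> simp_all
      subst hph
      simp only [List.map_cons, ltB, ltC, cond_false, Nat.zero_add, Good] at gB gC
      obtain ⟨m, l, b1, b2, b3, b4, gB⟩ := gB
      obtain ⟨m', l', c1, c2, c3, c4, gC⟩ := gC
      rw [Bool.or_eq_true_iff]
      left
      rw [cond_false, List.any_eq_true]
      refine ⟨(b, c), hmem, ?_⟩
      rw [noconfF hB b1 b2 b4, noconfF hC c1 c2 c4, cond_false, cond_false, forceL_eq, forceL_eq]
      exact ih false _ _ _ _ (stepF_inv rB hB b1 b2 b3) (stepF_inv rC hC c1 c2 c3) hL' hP2 gB gC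
    · simp only [List.map_cons, ltB, ltC, cond_true, Good] at gB gC
      obtain ⟨l, m, b1, b2, b3, b4, gB⟩ := gB
      obtain ⟨l', m', c1, c2, c3, c4, gC⟩ := gC
      rw [Bool.or_eq_true_iff]
      right
      rw [List.any_eq_true]
      refine ⟨(b, c), hmem, ?_⟩
      rw [noconfP hB b1 b2 b4, noconfP hC c1 c2 c4, cond_false, cond_false, forceL_eq, forceL_eq]
      exact ih true _ _ _ _ (stepP_inv rB hB b1 b2 b3) (stepP_inv rC hC c1 c2 c3) hL' hP2 gB gC

def tst (w N : Nat) : Bool :=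
  (List.range w).all fun b2 => (List.range b2).all fun b1 =>
    !(srch w (letters w b1 b2) N false (initM w fun u => u == b1 || u == b2)
      (initM w fun u => !(u == b1 || u == b2)))

theorem initM_go_inv {X : Type} (r : X → X → Prop) (w : Nat) (sg : Nat → Bool) (nd : Nat → X)
    (h1 : ∀ u < w, ReflTransGen r (nd u) (nd (w + u)))
    (h2 : ∀ u, u + 1 < w → ReflTransGen r (nd u) (nd (w + (u + 1))))
    (h3 : ∀ u < w, sg u = false → ReflTransGen r (nd (w + u)) (nd u)) :
    ∀ (k : Nat) (F G : List Nat) (last : Nat), k ≤ w → F.length = w - k → G.length = w - k →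
      (∀ i j, bt (F.getD i 0) j = true → ReflTransGen r (nd (k + i)) (nd j)) →
      (∀ i j, bt (G.getD i 0) j = true → ReflTransGen r (nd (w + (k + i))) (nd j)) →
      (∀ j, bt last j = true → k < w ∧ ReflTransGen r (nd (w + k)) (nd j)) →
      InvM r (initM.go w sg k (k - 1) F G last) nd := by
  have z : ∀ j, bt 0 j = false := fun j => by rw [bt_eq]; simp
  intro k
  induction k with
  | zero =>
    intro F G last _ hF hG iF iG _
    rw [initM.go]
    intro i j hb
    rw [List.getD_eq_getElem?_getD, List.getElem?_append] at hb
    split_ifs at hb with hi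
    · have := iF i j (by rw [List.getD_eq_getElem?_getD]; exact hb)
      simpa using this
    · have := iG (i - F.length) j (by rw [List.getD_eq_getElem?_getD]; exact hb)
      have e : w + (0 + (i - F.length)) = i := by omega
      rwa [e] at this
  | succ k ih =>
    intro F G last hk hF hG iF iG il
    rw [initM.go]
    have e1 : k + 1 - 1 = k := by omega
    simp only [e1]
    have ifr : ∀ j, bt (Nat.lor (Nat.lor (2 ^ k) (2 ^ (w + k))) last) j = true →
        ReflTransGen r (nd k) (nd j) := by
      intro j hj
      rw [bt_lor, bt_two] at hj
      simp only [Bool.or_eq_true, decide_eq_true_eq] at hj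
      rcases hj with (rfl | rfl) | hj
      · exact ReflTransGen.refl
      · exact h1 _ (by omega)
      · obtain ⟨hw, hr⟩ := il j hj
        exact (h2 k (by omega)).trans hr
    have igr : ∀ j, bt (bif sg k then 2 ^ (w + k) else
        Nat.lor (Nat.lor (2 ^ k) (2 ^ (w + k))) last) j = true →
        ReflTransGen r (nd (w + k)) (nd j) := by
      intro j hj
      cases hs : sg k
      · rw [hs, cond_false] at hj
        exact (h3 k (by omega) hs).trans (ifr j hj)
      · rw [hs, cond_true, bt_eq, Nat.testBit_two_pow] at hj
        simp only [decide_eq_true_eq] at hj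
        rw [hj]
    refine ih _ _ _ (by omega) (by simp; omega) (by simp; omega) ?_ ?_ (fun j hj => ⟨by omega, igr j hj⟩)
    · intro i j hb
      cases i with
      | zero => exact ifr j (by simpa using hb)
      | succ i =>
        have := iF i j (by simpa using hb)
        have e : k + (i + 1) = k + 1 + i := by omega
        rw [e]; exact this
    · intro i j hb
      cases i with
      | zero => exact igr j (by simpa using hb)
      | succ i =>
        have := iG i j (by simpa using hb)
        have e : k + (i + 1) = k + 1 + i := by omega
        rw [e]; exact this

theorem initM_inv {X : Type} (r : X → X → Prop) (w : Nat) (sg : Nat → Bool) (nd : Nat → X)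
    (h1 : ∀ u < w, ReflTransGen r (nd u) (nd (w + u)))
    (h2 : ∀ u, u + 1 < w → ReflTransGen r (nd u) (nd (w + (u + 1))))
    (h3 : ∀ u < w, sg u = false → ReflTransGen r (nd (w + u)) (nd u)) :
    InvM r (initM w sg) nd := by
  have z : ∀ j, bt 0 j = false := fun j => by rw [bt_eq]; simp
  refine initM_go_inv r w sg nd h1 h2 h3 w [] [] 0 le_rfl (by simp) (by simp) ?_ ?_ ?_
  · intro i j h; simp [z] at h
  · intro i j h; simp [z] at h
  · intro j h; simp [z] at h

set_option maxRecDepth 100000 in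
set_option maxHeartbeats 0 in
theorem tst2 : tst 4 5 = true := by decide +kernel
set_option maxRecDepth 100000 in
set_option maxHeartbeats 0 in
theorem tst3 : tst 5 8 = true := by decide +kernel

end MTwo

namespace MTwo
open Relation

structure Net (X : Type) where
  adj : X → X → Prop
  rk : X → ℕ
  inj : Function.Injective rk
  mono : ∀ {x y}, adj x y → rk x < rk y

structure Grp {X : Type} (N : Net X) (m : ℕ) where
  s : Fin m → X
  t : Fin m → X
  sinj : Function.Injective s
  tinj : Function.Injective t
  st : ∀ i j, s i ≠ t j
  nos : ∀ x k, ¬ N.adj x (s k)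
  nto : ∀ x k, ¬ N.adj (t k) x

structure Sys {X : Type} {N : Net X} {m : ℕ} (g : Grp N m) where
  σ : Equiv.Perm X
  ts : ∀ k, σ (g.t k) = g.s k
  stp : ∀ x, x ∉ Set.range g.t → σ x = x ∨ N.adj x (σ x)

namespace Sys
variable {X : Type} {N : Net X} {m : ℕ} {g : Grp N m} (B : Sys g)

def St (f e : X) : Prop := B.σ f = e ∧ f ≠ e ∧ f ∉ Set.range g.t
def used (x : X) : Prop := B.σ x ≠ x
def le (x y : X) : Prop := ReflTransGen B.St x y
def On (k : Fin m) (x : X) : Prop := B.le (g.s k) x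

variable {B}

theorem St.adj {f e : X} (h : B.St f e) : N.adj f e := by
  obtain ⟨h1, h2, h3⟩ := h
  rcases B.stp f h3 with h | h
  · exact absurd (h.symm.trans h1) h2
  · rwa [h1] at h

theorem St.lt {f e : X} (h : B.St f e) : N.rk f < N.rk e := N.mono h.adj

theorem St.runiq {f e e' : X} (h : B.St f e) (h' : B.St f e') : e = e' := h.1.symm.trans h'.1

theorem St.luniq {f f' e : X} (h : B.St f e) (h' : B.St f' e) : f = f' :=
  B.σ.injective (h.1.trans h'.1.symm)

theorem St.used_left {f e : X} (h : B.St f e) : B.used f := fun h' => h.2.1 (h'.symm.trans h.1)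

theorem St.used_right {f e : X} (h : B.St f e) : B.used e := fun h' =>
  h.2.1 (B.σ.injective (h.1.trans h'.symm))

theorem used_s (k : Fin m) : B.used (g.s k) := fun h =>
  g.st k k (B.σ.injective (h.trans (B.ts k).symm))

theorem used.pred {x : X} (h : B.used x) (hs : x ∉ Set.range g.s) : ∃ f, B.St f x := by
  refine ⟨B.σ.symm x, by simp, ?_, ?_⟩
  · intro h'
    apply h
    have := congrArg B.σ h'
    simpa using this.symm
  · rintro ⟨k, hk⟩
    apply hs
    refine ⟨k, ?_⟩
    rw [← B.ts k, hk]; simp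

theorem used.pred_adj {x y : X} (h : B.used x) (hs : N.adj y x) : ∃ f, B.St f x :=
  h.pred (by rintro ⟨k, rfl⟩; exact g.nos _ _ hs)

theorem used.succ {x : X} (h : B.used x) (ht : x ∉ Set.range g.t) : ∃ e, B.St x e :=
  ⟨B.σ x, rfl, fun h' => h h'.symm, ht⟩

theorem le.rk {x y : X} (h : B.le x y) : N.rk x ≤ N.rk y := by
  induction h with
  | refl => exact le_rfl
  | tail _ h ih => exact ih.trans h.lt.le

theorem le.rk_lt {x y : X} (h : B.le x y) (hne : x ≠ y) : N.rk x < N.rk y :=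
  lt_of_le_of_ne h.rk fun h' => hne (N.inj h')

theorem not_St_s {f : X} {k : Fin m} : ¬ B.St f (g.s k) := fun h => g.nos _ _ h.adj

theorem le_s {x : X} {k : Fin m} (h : B.le x (g.s k)) : x = g.s k := by
  rcases ReflTransGen.cases_tail h with h | ⟨y, _, h⟩
  · exact h.symm
  · exact absurd h not_St_s

theorem used.on [Finite X] {x : X} (h : B.used x) : ∃ k, B.On k x := by
  induction hn : N.rk x using Nat.strong_induction_on generalizing x with
  | _ n ih =>
    by_cases hs : x ∈ Set.range g.s
    · obtain ⟨k, rfl⟩ := hs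
      exact ⟨k, ReflTransGen.refl⟩
    · obtain ⟨f, hf⟩ := h.pred hs
      obtain ⟨k, hk⟩ := ih _ (hn ▸ hf.lt) hf.used_left rfl
      exact ⟨k, hk.tail hf⟩

theorem le.cmp_right {x y z : X} (h : B.le x y) (h' : B.le x z) : B.le y z ∨ B.le z y :=
  ReflTransGen.total_of_right_unique (fun _ _ _ a b => St.runiq a b) h h'

theorem le.cmp_left {x y z : X} (h : B.le y x) (h' : B.le z x) : B.le y z ∨ B.le z y := by
  have := ReflTransGen.total_of_right_unique (r := Function.swap B.St)
    (fun _ _ _ a b => St.luniq a b) (reflTransGen_swap.2 h) (reflTransGen_swap.2 h')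
  rcases this with h | h
  · exact Or.inr (reflTransGen_swap.1 h)
  · exact Or.inl (reflTransGen_swap.1 h)

theorem On.cmp {k : Fin m} {x y : X} (h : B.On k x) (h' : B.On k y) : B.le x y ∨ B.le y x :=
  le.cmp_right h h'

theorem On.le_of_rk {k : Fin m} {x y : X} (h : B.On k x) (h' : B.On k y) (hr : N.rk x ≤ N.rk y) :
    B.le x y := by
  rcases h.cmp h' with h | h
  · exact h
  · have := N.inj (le_antisymm hr h.rk)
    subst this
    exact h

theorem On.down {k : Fin m} {x y : X} (h : B.On k y) (h' : B.le x y) : B.On k x := by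
  rcases le.cmp_left h h' with h | h
  · exact h
  · rw [le_s h]; exact ReflTransGen.refl

theorem On.up {k : Fin m} {x y : X} (h : B.On k x) (h' : B.le x y) : B.On k y :=
  ReflTransGen.trans h h'

theorem On.uniq {k l : Fin m} {x : X} (h : B.On k x) (h' : B.On l x) : k = l := by
  have := h'.down h
  exact g.sinj (le_s this).symm

theorem On.used {k : Fin m} {x : X} (h : B.On k x) : B.used x := by
  rcases ReflTransGen.cases_tail h with h | ⟨y, _, h⟩
  · rw [h]; exact used_s k
  · exact h.used_right

theorem le.used {x y : X} (h : B.le x y) (hx : B.used x) : B.used y := by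
  rcases ReflTransGen.cases_tail h with h | ⟨y, _, h⟩
  · rwa [h]
  · exact h.used_right

/-- Residual relation. -/
def r (B : Sys g) (F : X → X → Prop) (x y : X) : Prop :=
  y ∉ Set.range g.t ∧ (x = B.σ y ∨ F x (B.σ y))

theorem r_back {F : X → X → Prop} {x y : X} (h : B.St y x) : B.r F x y := ⟨h.2.2, Or.inl h.1.symm⟩

theorem r_fwd {F : X → X → Prop} {x y z : X} (h : B.St y z) (hF : F x z) : B.r F x y :=
  ⟨h.2.2, Or.inr (h.1.symm ▸ hF)⟩

theorem not_used_t {x : X} (h : ¬ B.used x) : x ∉ Set.range g.t := by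
  rintro ⟨k, rfl⟩
  apply h
  intro h'
  exact g.st k k ((B.ts k).symm.trans h')

theorem r_free {F : X → X → Prop} {x z : X} (h : ¬ B.used z) (hF : F x z) : B.r F x z := by
  refine ⟨not_used_t h, Or.inr ?_⟩
  have : B.σ z = z := not_not.1 h
  rwa [this]

theorem r_mono {F F' : X → X → Prop} (h : ∀ x y, F x y → F' x y) {x y : X} (hr : B.r F x y) :
    B.r F' x y := ⟨hr.1, hr.2.imp id (h _ _)⟩

theorem rback {F : X → X → Prop} {x y : X} (h : B.le x y) : ReflTransGen (B.r F) y x := by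
  induction h with
  | refl => exact ReflTransGen.refl
  | tail _ h ih => exact ReflTransGen.head (r_back h) ih

theorem nodup_chain {r : X → X → Prop} {x y : X} (h : ReflTransGen r x y) :
    ∃ l : List X, l.Nodup ∧ List.IsChain r l ∧ l.head? = some x ∧ l.getLast? = some y := by
  induction h using ReflTransGen.head_induction_on with
  | refl => exact ⟨[y], by simp, by simp, by simp, by simp⟩
  | @head a c h1 h2 ih =>
    obtain ⟨l, hl, hc, hh, ht⟩ := ih
    by_cases ha : a ∈ l
    · obtain ⟨l1, l2, rfl⟩ := List.append_of_mem ha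
      refine ⟨a :: l2, (List.nodup_append.1 hl).2.1, (List.isChain_append.1 hc).2.1, rfl, ?_⟩
      rw [List.getLast?_append] at ht
      simpa using ht
    · refine ⟨a :: l, List.nodup_cons.2 ⟨ha, hl⟩, ?_, rfl, ?_⟩
      · rw [List.isChain_cons]
        exact ⟨fun y hy => by rw [hh] at hy; cases hy; exact h1, hc⟩
      · rw [List.getLast?_cons, ht]; rfl

theorem cyc_perm {r : X → X → Prop} {x : X} (h : TransGen r x x) :
    ∃ π : Equiv.Perm X, r x (π x) ∧ ∀ y, π y = y ∨ r y (π y) := by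
  classical
  obtain ⟨y, hxy, hyx⟩ := TransGen.head'_iff.1 h
  obtain ⟨l, hl, hc, hh, ht⟩ := nodup_chain hyx
  have key : ∀ z ∈ l, r z (l.formPerm z) := by
    intro z hz
    obtain ⟨i, hi, rfl⟩ := List.getElem_of_mem hz
    rw [List.formPerm_apply_getElem _ hl]
    by_cases h1 : i + 1 < l.length
    · simp only [Nat.mod_eq_of_lt h1]
      exact List.isChain_iff_getElem.1 hc i h1
    · have h2 : i + 1 = l.length := by omega
      simp only [h2, Nat.mod_self]
      have e1 : l[i] = x := by
        rw [List.getLast?_eq_getElem?, ← h2] at ht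
        simpa [hi] using ht
      have e2 : l[0] = y := by
        rw [List.head?_eq_getElem?] at hh
        rw [List.getElem?_eq_getElem (by omega)] at hh
        simpa using hh
      rw [e1, e2]; exact hxy
  refine ⟨l.formPerm, key x (List.mem_of_getLast? ht), fun z => ?_⟩
  by_cases hz : z ∈ l
  · exact Or.inr (key z hz)
  · exact Or.inl (List.formPerm_apply_of_notMem hz)

theorem NC {F : X → X → Prop} (hF : ∀ x y, F x y → N.adj x y) {x e : X}
    (h : TransGen (B.r F) x x) (h1 : B.St x e) (h2 : ¬ F x e) :
    ∃ B' : Sys g, (∀ x y, B'.St x y → B.St x y ∨ F x y) ∧ ¬ B'.St x e := by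
  obtain ⟨π, hx, hy⟩ := cyc_perm h
  have hT : ∀ y, y ∈ Set.range g.t → π y = y := by
    intro y hyT
    by_contra hne
    have h3 : π y ≠ y := hne
    obtain ⟨z, hz⟩ := π.surjective y
    have hzy : z ≠ π z := by
      intro h4
      rw [hz] at h4; subst h4; exact h3 hz
    rcases hy z with h5 | h5
    · exact hzy h5.symm
    · exact h5.1 (hz ▸ hyT)
  refine ⟨⟨π.trans B.σ, ?_, ?_⟩, ?_, ?_⟩
  · intro k
    show B.σ (π (g.t k)) = _
    rw [hT _ ⟨k, rfl⟩, B.ts]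
  · intro y hyT
    show B.σ (π y) = _ ∨ N.adj y (B.σ (π y))
    rcases hy y with h5 | h5
    · rw [h5]; exact B.stp y hyT
    · rcases h5.2 with h6 | h6
      · exact Or.inl h6.symm
      · exact Or.inr (hF _ _ h6)
  · rintro y z ⟨h3, h4, h5⟩
    change B.σ (π y) = z at h3
    rcases hy y with h6 | h6
    · rw [h6] at h3
      exact Or.inl ⟨h3, h4, h5⟩
    · rcases h6.2 with h7 | h7
      · exact absurd (h7.trans h3) h4
      · exact Or.inr (h3 ▸ h7)
  · rintro ⟨h3, h4, h5⟩
    change B.σ (π x) = e at h3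
    have h6 : π x = x := B.σ.injective (h3.trans h1.1.symm)
    rw [h6] at hx
    rcases hx.2 with h7 | h7
    · exact h4 (h7.trans h1.1)
    · rw [h1.1] at h7; exact h2 h7

end Sys
end MTwo

namespace MTwo
open Relation

section two
variable {X : Type} {N : Net X} {m m' : ℕ} {b : Grp N m} {c : Grp N m'}

def Pt (B : Sys b) (C : Sys c) (p : X) : Prop := ∃ f g, B.St f p ∧ C.St g p ∧ f ≠ g

def Run (B : Sys b) (C : Sys c) (x y : X) : Prop := ReflTransGen (fun a d => B.St a d ∧ C.St a d) x y

def End (B : Sys b) (C : Sys c) (p l : X) : Prop := Run B C p l ∧ ¬ ∃ y, B.St l y ∧ C.St l y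

variable {B : Sys b} {C : Sys c}

theorem Pt.symm {p : X} (h : Pt B C p) : Pt C B p := by
  obtain ⟨f, g, h1, h2, h3⟩ := h
  exact ⟨g, f, h2, h1, h3.symm⟩

theorem Run.symm {x y : X} (h : Run B C x y) : Run C B x y := ReflTransGen.mono (fun _ _ h => ⟨h.2, h.1⟩) _ _ h

theorem End.symm {p l : X} (h : End B C p l) : End C B p l :=
  ⟨h.1.symm, fun ⟨y, h1, h2⟩ => h.2 ⟨y, h2, h1⟩⟩

theorem Run.leL {x y : X} (h : Run B C x y) : B.le x y := ReflTransGen.mono (fun _ _ h => h.1) _ _ h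
theorem Run.leR {x y : X} (h : Run B C x y) : C.le x y := ReflTransGen.mono (fun _ _ h => h.2) _ _ h

theorem exists_end [Finite X] (p : X) : ∃ l, End B C p l := by
  obtain ⟨M, hM⟩ : ∃ M, ∀ x, N.rk x ≤ M := by
    obtain ⟨M, hM⟩ := (Set.finite_range N.rk).bddAbove
    exact ⟨M, fun x => hM ⟨x, rfl⟩⟩
  induction hn : M - N.rk p using Nat.strong_induction_on generalizing p with
  | _ n ih =>
    by_cases h : ∃ y, B.St p y ∧ C.St p y
    · obtain ⟨y, h1, h2⟩ := h
      have := h1.lt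
      have := hM y
      obtain ⟨l, hl1, hl2⟩ := ih (M - N.rk y) (by omega) y rfl
      exact ⟨l, ReflTransGen.head ⟨h1, h2⟩ hl1, hl2⟩
    · exact ⟨p, ReflTransGen.refl, h⟩

theorem run_before {q l p : X} (h : Run B C q l) (hqp : B.le q p) (hne : q ≠ p)
    (hp : ¬ ∃ g, B.St g p ∧ C.St g p) : B.le l p ∧ l ≠ p := by
  induction h with
  | refl => exact ⟨hqp, hne⟩
  | @tail z z' _ h ih =>
    obtain ⟨h1, h2⟩ := ih
    rcases ReflTransGen.cases_head h1 with h3 | ⟨y, h3, h4⟩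
    · exact absurd h3 h2
    · have := h.1.runiq h3
      subst this
      refine ⟨h4, ?_⟩
      rintro rfl
      exact hp ⟨z, h⟩

theorem Pt.not_run {p : X} (h : Pt B C p) : ¬ ∃ g, B.St g p ∧ C.St g p := by
  rintro ⟨g, h1, h2⟩
  obtain ⟨f, f', h3, h4, h5⟩ := h
  exact h5 ((h3.luniq h1).trans (h2.luniq h4))

theorem le_pred {D : Sys b} {x m p : X} (h : D.le x p) (hne : x ≠ p) (hm : D.St m p) : D.le x m := by
  rcases ReflTransGen.cases_tail h with h1 | ⟨y, h1, h2⟩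
  · exact absurd h1.symm hne
  · rwa [h2.luniq hm] at h1

/-- forward walk along `C` in the residual of `B` -/
theorem walkC {F : X → X → Prop} (hF : ∀ x y, C.St x y → F x y) {l g : X} (hlg : C.le l g)
    (hl : ¬ ∃ y, B.St l y ∧ C.St l y)
    (hno : ∀ y, C.le l y → y ≠ l → C.le y g → ¬ Pt B C y) :
    ReflTransGen (B.r F) l g ∧ (g = l ∨ ¬ B.used g) := by
  induction hlg with
  | refl => exact ⟨ReflTransGen.refl, Or.inl rfl⟩
  | @tail z z' hz hst ih =>
    obtain ⟨h1, h2⟩ := ih (fun y a b c => hno y a b (c.tail hst))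
    have hne : z' ≠ l := by
      rintro rfl
      have := Sys.le.rk hz
      have := hst.lt
      omega
    have hu : ¬ B.used z' := by
      intro hu
      obtain ⟨f, hf⟩ := hu.pred_adj hst.adj
      by_cases hfz : f = z
      · subst hfz
        rcases h2 with h2 | h2
        · subst h2; exact hl ⟨z', hf, hst⟩
        · exact h2 hf.used_left
      · exact hno z' (hz.tail hst) hne ReflTransGen.refl ⟨f, z, hf, hst, hfz⟩
    exact ⟨h1.tail (Sys.r_free hu (hF _ _ hst)), Or.inr hu⟩

theorem W1 {F : X → X → Prop} (hF : ∀ x y, C.St x y → F x y) {q p l m : X} {k : Fin m'}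
    (hq : C.On k q) (hp : C.On k p) (hlt : N.rk q < N.rk p) (hl : End B C q l)
    (hP : Pt B C p) (hm : B.St m p)
    (hno : ∀ y, C.On k y → N.rk q < N.rk y → N.rk y < N.rk p → ¬ Pt B C y) :
    TransGen (B.r F) l m := by
  have hle := hq.le_of_rk hp hlt.le
  have hne : q ≠ p := by rintro rfl; omega
  obtain ⟨h1, h2⟩ := run_before hl.1.symm hle hne hP.symm.not_run
  obtain ⟨f, g, _, hg, _⟩ := hP
  have hlg := le_pred h1 h2 hg
  have := (walkC hF hlg hl.2 (fun y h3 h4 h5 => hno y ((hq.up hl.1.leR).up h3) ?_ ?_)).1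
  · exact TransGen.tail' this (Sys.r_fwd hm (hF _ _ hg))
  · have := hl.1.leR.rk
    have := Sys.le.rk_lt h3 (Ne.symm h4)
    omega
  · have := Sys.le.rk h5
    have := hg.lt
    omega

theorem W2 {F : X → X → Prop} {q p l m : X} {k : Fin _}
    (hq : B.On k q) (hp : B.On k p) (hlt : N.rk q < N.rk p) (hl : End B C q l)
    (hP : Pt B C p) (hm : B.St m p) : ReflTransGen (B.r F) m l := by
  have hle := hq.le_of_rk hp hlt.le
  have hne : q ≠ p := by rintro rfl; omega
  obtain ⟨h1, h2⟩ := run_before hl.1 hle hne hP.not_run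
  exact Sys.rback (le_pred h1 h2 hm)

theorem W3 {F : X → X → Prop} {p l m : X} (hl : End B C p l) (hm : B.St m p) :
    TransGen (B.r F) l m :=
  TransGen.tail' (Sys.rback hl.1.leL) (Sys.r_back hm)

/-- acyclicity of the arc relation on points -/
theorem darc_acyclic [Finite X] [LinearOrder {p // Pt B C p}] {β γ : Type}
    (hlt : ∀ p q : {p // Pt B C p}, p < q ↔ N.rk p.1 < N.rk q.1)
    (κ : {p // Pt B C p} → Fin m) (κ' : {p // Pt B C p} → Fin m')
    (h1 : ∀ p, B.On (κ p) p.1) (h2 : ∀ p, C.On (κ' p) p.1)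
    (hmin : ∀ x e, B.St x e → ¬ C.St x e → ¬ TransGen (B.r C.St) x x)
    (ι : Fin m → β) (hι : Function.Injective ι) (ι' : Fin m' → γ) (hι' : Function.Injective ι')
    (p : {p // Pt B C p}) : ¬ TransGen (Darc (ι ∘ κ) (ι' ∘ κ')) p p := by
  choose ℓ hℓ using fun p : {p // Pt B C p} => exists_end (B := B) (C := C) p.1
  have key : ∀ p q, Darc (ι ∘ κ) (ι' ∘ κ') p q → ∃ x e, B.St x e ∧ ¬ C.St x e ∧
      TransGen (B.r C.St) (ℓ p) x ∧ ReflTransGen (B.r C.St) x (ℓ q) := by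
    have prvB : ∀ q p e x, prv (ι ∘ κ) q p → B.St x e → e = p.1 →
        ReflTransGen (B.r C.St) x (ℓ q) := by
      rintro q p e x ⟨h3, h4, _⟩ hx rfl
      have h4 := hι h4
      exact W2 (k := κ p) (h4 ▸ h1 q) (h1 p) ((hlt _ _).1 h3) (hℓ q) p.2 hx
    rintro p q (h | ⟨p', h, h'⟩)
    · obtain ⟨f, g, hf, hg, hfg⟩ := p.2
      refine ⟨f, p.1, hf, fun h' => hfg (h'.luniq hg), W3 (hℓ p) hf, prvB q p _ f h hf rfl⟩
    · obtain ⟨f, g, hf, hg, hfg⟩ := p'.2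
      refine ⟨f, p'.1, hf, fun h' => hfg (h'.luniq hg), ?_, prvB q p' _ f h' hf rfl⟩
      obtain ⟨h3, h4, h5⟩ := h
      have h4 := hι' h4
      refine W1 (fun _ _ h => h) (k := κ' p') (h4 ▸ h2 p) (h2 p') ((hlt _ _).1 h3) (hℓ p) p'.2 hf ?_
      intro y hy ha hb hP
      refine h5 ⟨y, hP⟩ ((hlt _ _).2 ha) ((hlt _ _).2 hb) ?_
      show ι' _ = ι' _
      congr 1
      exact (h2 ⟨y, hP⟩).uniq hy
  intro hcyc
  obtain ⟨q, hpq, hqp⟩ := TransGen.head'_iff.1 hcyc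
  obtain ⟨x, e, hx, hx', h3, h4⟩ := key p q hpq
  refine hmin x e hx hx' (TransGen.trans_right (h4.trans ?_) h3)
  clear h4 hpq h3 hcyc
  induction hqp with
  | refl => exact ReflTransGen.refl
  | tail _ h ih =>
    obtain ⟨x', _, _, _, h5, h6⟩ := key _ _ h
    exact ih.trans (h5.to_reflTransGen.trans h6)

end two

theorem points_bound {X : Type} [Finite X] {N : Net X} {n : ℕ} (hn : 1 ≤ n) {b : Grp N 2}
    {c : Grp N n} {B : Sys b} {C : Sys c}
    (hB : ∀ x e, B.St x e → ¬ C.St x e → ¬ TransGen (B.r C.St) x x)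
    (hC : ∀ x e, C.St x e → ¬ B.St x e → ¬ TransGen (C.r B.St) x x) :
    Set.ncard {p | Pt B C p} ≤ 3 * n - 1 := by
  have e1 : {p | Pt B C p}.ncard = Nat.card {p // Pt B C p} := rfl
  rw [e1]
  letI : LinearOrder {p // Pt B C p} := LinearOrder.lift' (fun p => N.rk p.1)
    (fun p q h => Subtype.ext (N.inj h))
  choose κ hκ using fun p : {p // Pt B C p} =>
    Sys.used.on (show B.used p.1 by obtain ⟨f, g, h, h', _⟩ := p.2; exact h.used_right)
  choose κ' hκ' using fun p : {p // Pt B C p} =>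
    Sys.used.on (show C.used p.1 by obtain ⟨f, g, h, h', _⟩ := p.2; exact h'.used_right)
  refine word_bound n hn (b := finTwoEquiv ∘ κ) (c := id ∘ κ') ?_ ?_
  · exact darc_acyclic (fun _ _ => Iff.rfl) κ κ' hκ hκ' hB _ finTwoEquiv.injective _
      Function.injective_id
  · intro p hp
    let φ : {p // Pt B C p} ≃ {p // Pt C B p} :=
      ⟨fun p => ⟨p.1, p.2.symm⟩, fun p => ⟨p.1, p.2.symm⟩, fun _ => rfl, fun _ => rfl⟩
    letI : LinearOrder {p // Pt C B p} := LinearOrder.lift' (fun p => N.rk p.1)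
      (fun p q h => Subtype.ext (N.inj h))
    have := darc_acyclic (B := C) (C := B) (fun _ _ => Iff.rfl) (κ' ∘ φ.symm) (κ ∘ φ.symm)
      (fun p => hκ' (φ.symm p)) (fun p => hκ (φ.symm p)) hC id Function.injective_id
      finTwoEquiv finTwoEquiv.injective (φ p)
    apply this
    refine TransGen.lift φ ?_ _ _ hp
    rintro x y (⟨h1, h2, h3⟩ | ⟨x', ⟨h1, h2, h3⟩, ⟨h4, h5, h6⟩⟩)
    · exact Or.inl ⟨h1, h2, fun z => h3 (φ.symm z)⟩
    · exact Or.inr ⟨φ x', ⟨h1, h2, fun z => h3 (φ.symm z)⟩, ⟨h4, h5, fun z => h6 (φ.symm z)⟩⟩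

end MTwo

namespace MTwo
open Relation

section three
variable {X : Type} {N : Net X} {n : ℕ} {a : Grp N 1} {b : Grp N 2} {c : Grp N n}

def HH (B : Sys b) (C : Sys c) (x y : X) : Prop := B.St x y ∨ C.St x y
def UU (A : Sys a) (C : Sys c) (x y : X) : Prop := A.St x y ∨ C.St x y

structure Mn (A : Sys a) (B : Sys b) (C : Sys c) : Prop where
  BC : ∀ x e, B.St x e → ¬ C.St x e → ¬ TransGen (B.r C.St) x x
  CB : ∀ x e, C.St x e → ¬ B.St x e → ¬ TransGen (C.r B.St) x x
  AH : ∀ x e, A.St x e → ¬ HH B C x e → ¬ TransGen (A.r (HH B C)) x x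
  BU : ∀ x e, B.St x e → ¬ A.St x e → ¬ C.St x e →
    ¬ TransGen (B.r fun x y => A.St x y ∨ C.St x y) x x
  CU : ∀ x e, C.St x e → ¬ A.St x e → ¬ B.St x e →
    ¬ TransGen (C.r fun x y => A.St x y ∨ B.St x y) x x

def cst1 (A : Sys a) (B : Sys b) (C : Sys c) : Set (X × X) :=
  {z | A.St z.1 z.2 ∨ B.St z.1 z.2 ∨ C.St z.1 z.2}
def cst2 (B : Sys b) (C : Sys c) : Set (X × X) := {z | B.St z.1 z.2 ∨ C.St z.1 z.2}

theorem exists_min [Finite X] (A0 : Sys a) (B0 : Sys b) (C0 : Sys c) :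
    ∃ (A : Sys a) (B : Sys b) (C : Sys c), Mn A B C := by
  let cost : Sys a × Sys b × Sys c → ℕ := fun z =>
    (cst1 z.1 z.2.1 z.2.2).ncard * (Nat.card (X × X) + 1) + (cst2 z.2.1 z.2.2).ncard
  obtain ⟨⟨A, B, C⟩, -, hmin⟩ := (measure cost).wf.has_min Set.univ ⟨(A0, B0, C0), trivial⟩
  have hlt1 : ∀ (A' : Sys a) (B' : Sys b) (C' : Sys c), (cst1 A' B' C') ⊂ (cst1 A B C) → False := by
    intro A' B' C' h
    have h1 := Set.ncard_lt_ncard h (Set.toFinite _)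
    apply hmin (A', B', C') trivial
    show cost _ < cost _
    show (cst1 A' B' C').ncard * (Nat.card (X × X) + 1) + (cst2 B' C').ncard <
      (cst1 A B C).ncard * (Nat.card (X × X) + 1) + (cst2 B C).ncard
    have h2 : (cst2 B' C').ncard ≤ Nat.card (X × X) := Set.ncard_le_card _
    nlinarith
  have hlt2 : ∀ (A' : Sys a) (B' : Sys b) (C' : Sys c), (cst1 A' B' C') ⊆ (cst1 A B C) → (cst2 B' C') ⊂ (cst2 B C) → False := by
    intro A' B' C' h h'
    have h1 := Set.ncard_lt_ncard h' (Set.toFinite _)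
    have h2 := Set.ncard_le_ncard h (Set.toFinite _)
    apply hmin (A', B', C') trivial
    show (cst1 A' B' C').ncard * (Nat.card (X × X) + 1) + (cst2 B' C').ncard <
      (cst1 A B C).ncard * (Nat.card (X × X) + 1) + (cst2 B C).ncard
    nlinarith
  refine ⟨A, B, C, ?_, ?_, ?_, ?_, ?_⟩
  · intro x e h1 h2 h3
    obtain ⟨B', h4, h5⟩ := Sys.NC (fun _ _ h => h.adj) h3 h1 h2
    refine hlt2 A B' C ?_ ?_
    · rintro z (h | h | h)
      · exact Or.inl h
      · rcases h4 _ _ h with h | h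
        · exact Or.inr (Or.inl h)
        · exact Or.inr (Or.inr h)
      · exact Or.inr (Or.inr h)
    · refine Set.ssubset_iff_subset_ne.2 ⟨?_, fun h => ?_⟩
      · rintro z (h | h)
        · exact h4 _ _ h
        · exact Or.inr h
      · have : (x, e) ∈ cst2 B C := Or.inl h1
        rw [← h] at this
        rcases this with h | h
        · exact h5 h
        · exact h2 h
  · intro x e h1 h2 h3
    obtain ⟨B', h4, h5⟩ := Sys.NC (fun _ _ h => h.adj) h3 h1 h2
    refine hlt2 A B B' ?_ ?_
    · rintro z (h | h | h)
      · exact Or.inl h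
      · exact Or.inr (Or.inl h)
      · rcases h4 _ _ h with h | h
        · exact Or.inr (Or.inr h)
        · exact Or.inr (Or.inl h)
    · refine Set.ssubset_iff_subset_ne.2 ⟨?_, fun h => ?_⟩
      · rintro z (h | h)
        · exact Or.inl h
        · exact (h4 _ _ h).symm
      · have : (x, e) ∈ cst2 B C := Or.inr h1
        rw [← h] at this
        rcases this with h | h
        · exact h2 h
        · exact h5 h
  · intro x e h1 h2 h3
    obtain ⟨B', h4, h5⟩ := Sys.NC (fun _ _ h => h.elim (·.adj) (·.adj)) h3 h1 h2
    refine hlt1 B' B C (Set.ssubset_iff_subset_ne.2 ⟨?_, fun h => ?_⟩)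
    · rintro z (h | h | h)
      · exact h4 _ _ h
      · exact Or.inr (Or.inl h)
      · exact Or.inr (Or.inr h)
    · have : (x, e) ∈ cst1 A B C := Or.inl h1
      rw [← h] at this
      rcases this with h | h
      · exact h5 h
      · exact h2 h
  · intro x e h1 h2 h2' h3
    obtain ⟨B', h4, h5⟩ := Sys.NC (fun _ _ h => h.elim (·.adj) (·.adj)) h3 h1
      (fun h => h.elim h2 h2')
    refine hlt1 A B' C (Set.ssubset_iff_subset_ne.2 ⟨?_, fun h => ?_⟩)
    · rintro z (h | h | h)
      · exact Or.inl h
      · rcases h4 _ _ h with h | h | h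
        · exact Or.inr (Or.inl h)
        · exact Or.inl h
        · exact Or.inr (Or.inr h)
      · exact Or.inr (Or.inr h)
    · have : (x, e) ∈ cst1 A B C := Or.inr (Or.inl h1)
      rw [← h] at this
      rcases this with h | h | h
      · exact h2 h
      · exact h5 h
      · exact h2' h
  · intro x e h1 h2 h2' h3
    obtain ⟨B', h4, h5⟩ := Sys.NC (fun _ _ h => h.elim (·.adj) (·.adj)) h3 h1
      (fun h => h.elim h2 h2')
    refine hlt1 A B B' (Set.ssubset_iff_subset_ne.2 ⟨?_, fun h => ?_⟩)
    · rintro z (h | h | h)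
      · exact Or.inl h
      · exact Or.inr (Or.inl h)
      · rcases h4 _ _ h with h | h | h
        · exact Or.inr (Or.inr h)
        · exact Or.inl h
        · exact Or.inr (Or.inl h)
    · have : (x, e) ∈ cst1 A B C := Or.inr (Or.inr h1)
      rw [← h] at this
      rcases this with h | h | h
      · exact h2 h
      · exact h2' h
      · exact h5 h

variable {A : Sys a} {B : Sys b} {C : Sys c}

theorem A_cmp [Finite X] {x y : X} (hx : A.used x) (hy : A.used y) : A.le x y ∨ A.le y x := by
  obtain ⟨k, hk⟩ := hx.on
  obtain ⟨l, hl⟩ := hy.on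
  rw [Subsingleton.elim l k] at hl
  exact hk.cmp hl

theorem A_le [Finite X] {x y : X} (hx : A.used x) (hy : A.used y) (h : N.rk x ≤ N.rk y) : A.le x y := by
  obtain ⟨k, hk⟩ := hx.on
  obtain ⟨l, hl⟩ := hy.on
  rw [Subsingleton.elim l k] at hl
  exact hk.le_of_rk hl h

theorem RL [Finite X] (h : Mn A B C) {w f e u : X} (h1 : A.le w f) (h2 : A.St f e)
    (h3 : ¬ HH B C f e) (h4 : A.le e u) (h5 : ReflTransGen (HH B C) w u) : False := by
  have key : ReflTransGen (A.r (HH B C)) f u ∧ (¬ A.used u ∨ A.le u f) := by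
    clear h4
    induction h5 with
    | refl => exact ⟨Sys.rback h1, Or.inr h1⟩
    | @tail z z' _ hzz' ih =>
      obtain ⟨i1, i2⟩ := ih
      by_cases hu : A.used z'
      · by_cases hle : A.le z' f
        · exact ⟨Sys.rback hle, Or.inr hle⟩
        · exfalso
          have hfz := (A_cmp hu h2.used_left).resolve_left hle
          rcases ReflTransGen.cases_tail hfz with h6 | ⟨g, h6, h7⟩
          · subst h6; exact hle ReflTransGen.refl
          · exact h.AH f e h2 h3 (TransGen.trans_right i1
              (TransGen.head' (Sys.r_fwd h7 hzz') (Sys.rback h6)))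
      · exact ⟨i1.tail (Sys.r_free hu hzz'), Or.inl hu⟩
  rcases key.2 with h6 | h6
  · exact h6 (h4.used h2.used_right)
  · have := h4.rk
    have := h6.rk
    have := h2.lt
    omega

def Ent (A : Sys a) (B : Sys b) (C : Sys c) (e : X) : Prop :=
  ∃ f, A.St f e ∧ ¬ HH B C f e ∧ (B.used e ∨ C.used e)

theorem Ent.usedA {e : X} (h : Ent A B C e) : A.used e := by
  obtain ⟨f, h, _⟩ := h; exact h.used_right

theorem hh_of_leB {x y : X} (h : B.le x y) : ReflTransGen (HH B C) x y :=
  ReflTransGen.mono (fun _ _ h => Or.inl h) _ _ h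
theorem hh_of_leC {x y : X} (h : C.le x y) : ReflTransGen (HH B C) x y :=
  ReflTransGen.mono (fun _ _ h => Or.inr h) _ _ h

theorem hh_rk {x y : X} (h : ReflTransGen (HH B C) x y) : N.rk x ≤ N.rk y := by
  induction h with
  | refl => exact le_rfl
  | tail _ h ih => exact ih.trans (h.elim (·.lt) (·.lt)).le

/-- no H-path from an A-used vertex to a different entry -/
theorem ent_hh [Finite X] (h : Mn A B C) {e e' : X} (he : A.used e) (he' : Ent A B C e')
    (hp : ReflTransGen (HH B C) e e') : e = e' := by
  by_contra hne
  have hr := hh_rk hp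
  have hle := A_le he he'.usedA hr
  obtain ⟨f, h1, h2, _⟩ := he'
  exact RL h (le_pred hle hne h1) h1 h2 ReflTransGen.refl hp

theorem ent_B [Finite X] (h : Mn A B C) {e e' : X} (he : Ent A B C e) (he' : Ent A B C e')
    {k : Fin 2} (h1 : B.On k e) (h2 : B.On k e') : e = e' := by
  rcases h1.cmp h2 with h3 | h3
  · exact ent_hh h he.usedA he' (hh_of_leB h3)
  · exact (ent_hh h he'.usedA he (hh_of_leB h3)).symm

theorem ent_C [Finite X] (h : Mn A B C) {e e' : X} (he : Ent A B C e) (he' : Ent A B C e')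
    {k : Fin n} (h1 : C.On k e) (h2 : C.On k e') : e = e' := by
  rcases h1.cmp h2 with h3 | h3
  · exact ent_hh h he.usedA he' (hh_of_leC h3)
  · exact (ent_hh h he'.usedA he (hh_of_leC h3)).symm

def Mg (A : Sys a) (B : Sys b) (C : Sys c) (x : X) : Prop := Pt A B x ∨ Pt A C x ∨ Pt B C x

theorem Mg.cases {x : X} (h : Mg A B C x) : Pt B C x ∨ Ent A B C x := by
  by_cases hp : Pt B C x
  · exact Or.inl hp
  right
  rcases h with ⟨f, g, h1, h2, h3⟩ | ⟨f, g, h1, h2, h3⟩ | h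
  · refine ⟨f, h1, ?_, Or.inl h2.used_right⟩
    rintro (h4 | h4)
    · exact h3 (h4.luniq h2)
    · exact hp ⟨g, f, h2, h4, h3.symm⟩
  · refine ⟨f, h1, ?_, Or.inr h2.used_right⟩
    rintro (h4 | h4)
    · exact hp ⟨f, g, h4, h2, h3⟩
    · exact h3 (h4.luniq h2)
  · exact absurd h hp

/-- a path carrying an entry -/
def onP (B : Sys b) (C : Sys c) (k : Fin 2 ⊕ Fin n) (x : X) : Prop :=
  match k with
  | Sum.inl k => B.On k x
  | Sum.inr k => C.On k x

theorem ent_inj [Finite X] (h : Mn A B C) {e e' : X} (he : Ent A B C e) (he' : Ent A B C e')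
    {k : Fin 2 ⊕ Fin n} (h1 : onP B C k e) (h2 : onP B C k e') : e = e' := by
  cases k with
  | inl k => exact ent_B h he he' h1 h2
  | inr k => exact ent_C h he he' h1 h2

theorem Ent.onP [Finite X] {e : X} (h : Ent A B C e) : ∃ k, onP B C k e := by
  obtain ⟨f, _, _, h | h⟩ := h
  · obtain ⟨k, hk⟩ := h.on; exact ⟨Sum.inl k, hk⟩
  · obtain ⟨k, hk⟩ := h.on; exact ⟨Sum.inr k, hk⟩

theorem card_ent [Finite X] (h : Mn A B C) : Nat.card {e // Ent A B C e} ≤ n + 2 := by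
  choose κ hκ using fun e : {e // Ent A B C e} => e.2.onP
  have hinj : Function.Injective κ := by
    intro e e' hee
    exact Subtype.ext (ent_inj h e.2 e'.2 (hκ e) (hee ▸ hκ e'))
  have := Nat.card_le_card_of_injective κ hinj
  simp at this
  omega

theorem card_mg [Finite X] (A : Sys a) (B : Sys b) (C : Sys c) :
    Set.ncard {x | Mg A B C x} ≤ Set.ncard {x | Pt B C x} + Nat.card {e // Ent A B C e} := by
  have h1 : {x | Mg A B C x} ⊆ {x | Pt B C x} ∪ {x | Ent A B C x} := fun x hx => Mg.cases hx
  exact (Set.ncard_le_ncard h1 (Set.toFinite _)).trans (Set.ncard_union_le _ _)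

theorem mg_bound [Finite X] (hn : 1 ≤ n) (h : Mn A B C) : Set.ncard {x | Mg A B C x} ≤ 4 * n + 1 := by
  have h1 := card_mg A B C
  have h2 := card_ent h
  have h3 := points_bound hn h.BC h.CB
  omega

end three
end MTwo

namespace MTwo
open Relation MultiDigraph

section tr
variable {G : MultiDigraph} {c : Fin 3 → ℕ} (S R : Fin 3 → G.V)

abbrev EX (G : MultiDigraph) (c : Fin 3 → ℕ) : Type :=
  G.E ⊕ ((Σ i : Fin 3, Fin (c i)) ⊕ (Σ i : Fin 3, Fin (c i)))

def eadj : EX G c → EX G c → Prop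
  | .inl f, .inl e => G.dst f = G.src e
  | .inr (.inl k), .inl e => G.src e = S k.1
  | .inl f, .inr (.inr k) => G.dst f = R k.1
  | _, _ => False

variable {S R}

theorem eadj_s (x : EX G c) (k) : ¬ eadj S R x (.inr (.inl k)) := by
  rcases x with x | x | x <;> exact id

theorem eadj_t (x : EX G c) (k) : ¬ eadj S R (.inr (.inr k)) x := by
  rcases x with x | x | x <;> exact id

theorem eadj_path {e : G.E} {y : EX G c} (h : TransGen (eadj S R) (.inl e) y) :
    ∀ e', y = .inl e' → ∃ p, G.IsPathFrom (G.dst e) (G.dst e') p := by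
  induction h with
  | single h =>
    rintro e' rfl
    exact ⟨[e'], path_single (h : G.dst e = G.src e').symm rfl⟩
  | @tail y z hy h ih =>
    rintro e' rfl
    rcases y with f | k | k
    · obtain ⟨p, hp⟩ := ih f rfl
      refine ⟨p ++ [e'], by simp, ?_, ?_, ?_⟩
      · refine List.isChain_append.2 ⟨hp.2.1, by simp, ?_⟩
        intro x hx y hy
        simp at hy
        subst hy
        rw [hp.2.2.2 x hx]; exact h
      · intro x hx
        rw [List.head?_append_of_ne_nil _ hp.1] at hx
        exact hp.2.2.1 x hx
      · simp
    · exfalso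
      rcases TransGen.tail'_iff.1 hy with ⟨w, _, hw⟩
      exact eadj_s _ _ hw
    · exact absurd h (eadj_t _ _)

theorem eadj_acyc (hG : G.Acyclic) (x : EX G c) : ¬ TransGen (eadj S R) x x := by
  intro h
  rcases x with e | k | k
  · obtain ⟨p, hp⟩ := eadj_path h e rfl
    exact hG _ _ hp
  · rcases TransGen.tail'_iff.1 h with ⟨w, _, hw⟩
    exact eadj_s _ _ hw
  · rcases TransGen.head'_iff.1 h with ⟨w, hw, _⟩
    exact eadj_t _ _ hw

theorem exists_rk {X : Type} [Finite X] {r : X → X → Prop} (h : ∀ x, ¬ TransGen r x x) :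
    ∃ rk : X → ℕ, Function.Injective rk ∧ ∀ {x y}, r x y → rk x < rk y := by
  obtain ⟨m, ⟨φ⟩⟩ := Finite.exists_equiv_fin X
  refine ⟨fun x => Set.ncard {y | TransGen r y x} * (m + 1) + (φ x : ℕ), ?_, ?_⟩
  · intro x y hxy
    have h1 := (φ x).2
    have h2 := (φ y).2
    apply φ.injective
    apply Fin.ext
    have := congrArg (· % (m + 1)) hxy
    simp only [Nat.mul_add_mod_self_right] at this
    rwa [Nat.mod_eq_of_lt (by omega), Nat.mod_eq_of_lt (by omega)] at this
  · intro x y hxy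
    have : Set.ncard {z | TransGen r z x} < Set.ncard {z | TransGen r z y} := by
      apply Set.ncard_lt_ncard _ (Set.toFinite _)
      refine Set.ssubset_iff_subset_ne.2 ⟨fun z hz => TransGen.tail hz hxy, fun he => ?_⟩
      have : x ∈ {z | TransGen r z y} := TransGen.single hxy
      rw [← he] at this
      exact h x this
    have h1 := (φ x).2
    show _ * (m + 1) + _ < _ * (m + 1) + _
    nlinarith

/-- pendants -/
def egrp (N : Net (EX G c)) (hN : N.adj = eadj S R) (i : Fin 3) : Grp N (c i) where
  s k := .inr (.inl ⟨i, k⟩)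
  t k := .inr (.inr ⟨i, k⟩)
  sinj k l h := by simpa using h
  tinj k l h := by simpa using h
  st _ _ h := by simp at h
  nos x k h := by rw [hN] at h; exact eadj_s _ _ h
  nto x k h := by rw [hN] at h; exact eadj_t _ _ h

theorem finEX (G : MultiDigraph) (c : Fin 3 → ℕ) : Finite (EX G c) := by
  haveI := G.fintE
  infer_instance

/-- Menger systems give permutation systems. -/
theorem mp (hG : G.Acyclic) (N : Net (EX G c)) (hN : N.adj = eadj S R) (i : Fin 3)
    {α : Fin (c i) → List G.E} (hα : G.MengerSystem (S i) (R i) (c i) α) :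
    Nonempty (Sys (egrp N hN i)) := by
  classical
  haveI := finEX G c
  let L : Fin (c i) → List (EX G c) := fun k =>
    .inr (.inl ⟨i, k⟩) :: ((α k).map Sum.inl ++ [.inr (.inr ⟨i, k⟩)])
  have hnd : ∀ k, (L k).Nodup := by
    intro k
    have := path_nodup hG (hα.1 k)
    simp only [L, List.nodup_cons, List.nodup_append]
    refine ⟨by simp, List.Nodup.map Sum.inl_injective this, by simp, by simp⟩
  have hch : ∀ k, List.IsChain (eadj S R) (L k) := by
    intro k
    obtain ⟨h1, h2, h3, h4⟩ := hα.1 k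
    simp only [L, List.isChain_cons, List.isChain_append, List.isChain_map]
    refine ⟨?_, h2, by simp, ?_⟩
    · intro y hy
      rw [List.head?_append_of_ne_nil _ (by simpa using h1), List.head?_map] at hy
      simp only [Option.mem_map] at hy
      obtain ⟨e, he, rfl⟩ := hy
      exact h3 e he
    · intro x hx y hy
      rw [List.getLast?_map] at hx
      simp only [Option.mem_map] at hx
      obtain ⟨e, he, rfl⟩ := hx
      simp at hy
      subst hy
      exact h4 e he
  have hdisj : ∀ k l x, x ∈ L k → x ∈ L l → k = l := by
    intro k l x hk hl
    by_contra hne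
    rcases x with e | ⟨j, q⟩ | ⟨j, q⟩
    · simp [L] at hk hl
      exact hα.2 k l hne e hk hl
    · simp [L] at hk hl
      obtain ⟨rfl, h1⟩ := hk
      obtain ⟨-, h2⟩ := hl
      simp at h1 h2
      exact hne (h1.symm.trans h2)
    · simp [L] at hk hl
      obtain ⟨rfl, h1⟩ := hk
      obtain ⟨-, h2⟩ := hl
      simp at h1 h2
      exact hne (h1.symm.trans h2)
  have hstep : ∀ k, ∀ x ∈ L k, (x = .inr (.inr ⟨i, k⟩) ∧ (L k).formPerm x = .inr (.inl ⟨i, k⟩)) ∨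
      eadj S R x ((L k).formPerm x) := by
    intro k x hx
    obtain ⟨q, hq, rfl⟩ := List.getElem_of_mem hx
    rw [List.formPerm_apply_getElem _ (hnd k)]
    by_cases h1 : q + 1 < (L k).length
    · right
      simp only [Nat.mod_eq_of_lt h1]
      exact List.isChain_iff_getElem.1 (hch k) q h1
    · left
      have h2 : q + 1 = (L k).length := by omega
      simp only [h2, Nat.mod_self]
      have hlast : (L k).getLast? = some (.inr (.inr ⟨i, k⟩)) := by
        simp only [L]
        rw [← List.cons_append, List.getLast?_append]; rfl
      refine ⟨?_, by simp [L]⟩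
      rw [List.getLast?_eq_getElem?, ← h2] at hlast
      simpa [hq] using hlast
  let φ : EX G c → EX G c := fun x => if h : ∃ k, x ∈ L k then (L h.choose).formPerm x else x
  have hφ : ∀ k x, x ∈ L k → φ x = (L k).formPerm x := by
    intro k x hx
    have h : ∃ k, x ∈ L k := ⟨k, hx⟩
    simp only [φ, dif_pos h]
    rw [hdisj _ _ _ h.choose_spec hx]
  have hφ' : ∀ x, (¬ ∃ k, x ∈ L k) → φ x = x := fun x hx => dif_neg hx
  have hinj : Function.Injective φ := by
    intro x y hxy
    by_cases hx : ∃ k, x ∈ L k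
    · obtain ⟨k, hk⟩ := hx
      rw [hφ k x hk] at hxy
      have hm : (L k).formPerm x ∈ L k := List.formPerm_apply_mem_of_mem hk
      by_cases hy : ∃ l, y ∈ L l
      · obtain ⟨l, hl⟩ := hy
        rw [hφ l y hl] at hxy
        have hm' : (L l).formPerm y ∈ L l := List.formPerm_apply_mem_of_mem hl
        have := hdisj k l _ hm (hxy ▸ hm')
        subst this
        exact (L k).formPerm.injective hxy
      · rw [hφ' y hy] at hxy
        exact absurd ⟨k, hxy ▸ hm⟩ hy
    · rw [hφ' x hx] at hxy
      by_cases hy : ∃ l, y ∈ L l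
      · obtain ⟨l, hl⟩ := hy
        rw [hφ l y hl] at hxy
        have hm' : (L l).formPerm y ∈ L l := List.formPerm_apply_mem_of_mem hl
        exact absurd ⟨l, hxy ▸ hm'⟩ hx
      · rwa [hφ' y hy] at hxy
  refine ⟨⟨Equiv.ofBijective φ (Finite.injective_iff_bijective.1 hinj), ?_, ?_⟩⟩
  · intro k
    have hk : (.inr (.inr ⟨i, k⟩) : EX G c) ∈ L k := by simp [L]
    show φ (.inr (.inr ⟨i, k⟩)) = .inr (.inl ⟨i, k⟩)
    rw [hφ k _ hk]
    rcases hstep k _ hk with h | h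
    · exact h.2
    · exact absurd h (eadj_t _ _)
  · intro x hx
    show φ x = x ∨ N.adj x (φ x)
    by_cases h : ∃ k, x ∈ L k
    · obtain ⟨k, hk⟩ := h
      right
      rw [hφ k x hk, hN]
      rcases hstep k x hk with h | h
      · exact absurd ⟨k, h.1.symm⟩ hx
      · exact h
    · exact Or.inl (hφ' x h)

theorem st_inl {N : Net (EX G c)} {hN : N.adj = eadj S R} {i : Fin 3} {B : Sys (egrp N hN i)}
    {e : G.E} {y : EX G c} (h : B.St (.inl e) y) :
    (∃ e', y = .inl e' ∧ G.dst e = G.src e') ∨ (G.dst e = R i ∧ ∃ k, y = .inr (.inr ⟨i, k⟩)) := by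
  have ha := h.adj
  rw [hN] at ha
  rcases y with e' | k | ⟨j, k⟩
  · exact Or.inl ⟨e', rfl, ha⟩
  · exact absurd ha (eadj_s _ _)
  · right
    by_cases hj : j = i
    · subst hj; exact ⟨ha, k, rfl⟩
    · exfalso
      have hu := h.used_right
      have : (.inr (.inr ⟨j, k⟩) : EX G c) ∉ Set.range (egrp N hN i).t := by
        rintro ⟨l, hl⟩
        simp [egrp] at hl
        exact hj hl.1.symm
      obtain ⟨z, hz⟩ := hu.succ this
      have := hz.adj
      rw [hN] at this
      exact eadj_t _ _ this

theorem pm_aux {N : Net (EX G c)} {hN : N.adj = eadj S R} {i : Fin 3} (B : Sys (egrp N hN i))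
    (e : G.E) (he : B.used (.inl e)) :
    ∃ p, G.IsPathFrom (G.src e) (R i) (e :: p) ∧ (∀ f ∈ e :: p, B.le (.inl e) (.inl f)) ∧
      ∀ f g, [f, g] <:+: e :: p → B.St (.inl f) (.inl g) := by
  haveI := finEX G c
  obtain ⟨M, hM⟩ : ∃ M, ∀ x, N.rk x ≤ M := by
    obtain ⟨M, hM⟩ := (Set.finite_range N.rk).bddAbove
    exact ⟨M, fun x => hM ⟨x, rfl⟩⟩
  induction hn : M - N.rk (.inl e) using Nat.strong_induction_on generalizing e with
  | _ q ih =>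
    have ht : (.inl e : EX G c) ∉ Set.range (egrp N hN i).t := by
      rintro ⟨l, hl⟩
      simp [egrp] at hl
    obtain ⟨y, hy⟩ := he.succ ht
    rcases st_inl hy with ⟨e', rfl, h1⟩ | ⟨h1, k, rfl⟩
    · have h2 := hy.lt
      have h3 := hM (.inl e')
      obtain ⟨p, hp1, hp2, hp3⟩ := ih (M - N.rk (.inl e')) (by omega) e' hy.used_right rfl
      refine ⟨e' :: p, ?_, ?_, ?_⟩
      · refine ⟨by simp, List.isChain_cons_cons.2 ⟨h1, hp1.2.1⟩, by simp, ?_⟩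
        intro x hx
        rw [List.getLast?_cons_cons] at hx
        exact hp1.2.2.2 x hx
      · intro f hf
        rcases List.mem_cons.1 hf with rfl | hf
        · exact ReflTransGen.refl
        · exact ReflTransGen.head hy (hp2 f hf)
      · intro f g hfg
        rcases List.infix_cons_iff.1 hfg with h | h
        · simp only [List.cons_prefix_cons] at h
          obtain ⟨rfl, rfl, _⟩ := h
          exact hy
        · exact hp3 f g h
    · refine ⟨[], path_single rfl h1, ?_, ?_⟩
      · intro f hf
        simp at hf
        subst hf; exact ReflTransGen.refl
      · intro f g hfg
        have := hfg.length_le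
        simp at this

theorem pm {N : Net (EX G c)} {hN : N.adj = eadj S R} {i : Fin 3} (B : Sys (egrp N hN i)) :
    ∃ α : Fin (c i) → List G.E, G.MengerSystem (S i) (R i) (c i) α ∧
      ∀ k f g, [f, g] <:+: α k → B.St (.inl f) (.inl g) := by
  have h0 : ∀ k : Fin (c i), ∃ p : List G.E, G.IsPathFrom (S i) (R i) p ∧
      (∀ f ∈ p, B.On k (.inl f)) ∧ ∀ f g, [f, g] <:+: p → B.St (.inl f) (.inl g) := by
    intro k
    have ht : (egrp N hN i).s k ∉ Set.range (egrp N hN i).t := by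
      rintro ⟨l, hl⟩
      exact (egrp N hN i).st _ _ hl.symm
    obtain ⟨y, hy⟩ := (Sys.used_s (B := B) k).succ ht
    have ha := hy.adj
    rw [hN] at ha
    rcases y with e | k' | k'
    · obtain ⟨p, h1, h2, h3⟩ := pm_aux B e hy.used_right
      have hs : G.src e = S i := ha
      rw [hs] at h1
      exact ⟨e :: p, h1, fun f hf => ReflTransGen.head hy (h2 f hf), h3⟩
    · exact absurd ha (eadj_s _ _)
    · exact absurd ha id
  choose α h1 h2 h3 using h0
  refine ⟨α, ⟨h1, fun k l hkl e hk hl => hkl ((h2 k e hk).uniq (h2 l e hl))⟩, h3⟩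

def Pt' {X : Type} (r r' : X → X → Prop) (p : X) : Prop := ∃ f g, r f p ∧ r' g p ∧ f ≠ g

theorem atMost_of_net {K : ℕ}
    (hK : ∀ (X : Type) [Finite X] (N : Net X) (g : ∀ i, Grp N (c i)), (∀ i, Sys (g i)) →
      ∃ s : ∀ i, Sys (g i), Set.ncard {x | ∃ i j, i ≠ j ∧ Pt' (s i).St (s j).St x} ≤ K) :
    MAtMost c K := by
  intro G S R ⟨hG, _, hc⟩ _
  haveI := finEX G c
  obtain ⟨rk, h1, h2⟩ := exists_rk (eadj_acyc (c := c) (S := S) (R := R) hG)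
  let N : Net (EX G c) := ⟨eadj S R, rk, h1, h2⟩
  have hs : ∀ i, Nonempty (Sys (egrp N rfl i)) := fun i => by
    obtain ⟨α, hα⟩ := (hc i).1
    exact mp hG N rfl i hα
  obtain ⟨s, hs⟩ := hK (EX G c) N (egrp N rfl) (fun i => (hs i).some)
  choose α hα hst using fun i => pm (s i)
  refine ⟨α, hα, le_trans ?_ hs⟩
  refine Set.ncard_le_ncard_of_injOn (Sum.inl : G.E → EX G c) ?_ (Sum.inl_injective.injOn)
    (Set.toFinite _)
  rintro e ⟨i, j, hij, k, l, f, g, hfg, hf, hg⟩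
  exact ⟨i, j, hij, .inl f, .inl g, hst _ _ _ _ hf, hst _ _ _ _ hg, fun h => hfg (Sum.inl_injective h)⟩

end tr
end MTwo

namespace MTwo
open Relation MultiDigraph

theorem atMost_mn {n K : ℕ} (h : ∀ (X : Type) [Finite X] (N : Net X) (a : Grp N 1) (b : Grp N 2)
    (c : Grp N n) (A : Sys a) (B : Sys b) (C : Sys c), Mn A B C →
      Set.ncard {x | Mg A B C x} ≤ K) : MAtMost ![1, 2, n] K := by
  apply atMost_of_net
  intro X _ N g s0
  obtain ⟨A, B, C, hm⟩ := exists_min (n := n) (a := g 0) (b := g 1) (c := g 2) (s0 0) (s0 1) (s0 2)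
  let s : ∀ i, Sys (g i) := fun i => match i with
    | 0 => A
    | 1 => B
    | 2 => C
  refine ⟨s, le_trans ?_ (h X N (g 0) (g 1) (g 2) A B C hm)⟩
  refine Set.ncard_le_ncard ?_ (Set.toFinite _)
  rintro x ⟨i, j, hij, f, f', h1, h2, h3⟩
  fin_cases i <;> fin_cases j
  · exact absurd rfl hij
  · exact Or.inl ⟨f, f', h1, h2, h3⟩
  · exact Or.inr (Or.inl ⟨f, f', h1, h2, h3⟩)
  · exact Or.inl ⟨f', f, h2, h1, h3.symm⟩
  · exact absurd rfl hij
  · exact Or.inr (Or.inr ⟨f, f', h1, h2, h3⟩)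
  · exact Or.inr (Or.inl ⟨f', f, h2, h1, h3.symm⟩)
  · exact Or.inr (Or.inr ⟨f', f, h2, h1, h3.symm⟩)
  · exact absurd rfl hij

theorem ub {n : ℕ} (hn : 1 ≤ n) : MAtMost ![1, 2, n] (4 * n + 1) :=
  atMost_mn fun _ _ _ _ _ _ _ _ _ h => mg_bound hn h

end MTwo

namespace MTwo
open Relation

section slice
variable {X : Type} {N : Net X} {m m' m0 : ℕ} {a : Grp N m0} {b : Grp N m} {c : Grp N m'}

def orR (S : Sys b) (T : Sys c) (x y : X) : Prop := S.St x y ∨ T.St x y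

structure Slice (A : Sys a) (S : Sys b) (T : Sys c) (w : ℕ) (e : ℕ → X) (iS : Fin m → ℕ)
    (iT : Fin m' → ℕ) : Prop where
  iSinj : Function.Injective iS
  iTinj : Function.Injective iT
  ne : ∀ k l, iS k ≠ iT l
  iSw : ∀ k, iS k < w
  iTw : ∀ k, iT k < w
  cov : ∀ u < w, (∃ k, u = iS k) ∨ ∃ l, u = iT l
  onS : ∀ k, S.On k (e (iS k))
  onT : ∀ k, T.On k (e (iT k))
  nT : ∀ k, ¬ T.used (e (iS k))
  nS : ∀ k, ¬ S.used (e (iT k))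
  ent : ∀ u < w, ∃ f, A.St f (e u) ∧ ¬ S.St f (e u) ∧ ¬ T.St f (e u)
  ent' : ∀ f x, A.St f x → ¬ S.St f x → ¬ T.St f x → S.used x → ∃ u < w, x = e u
  Ale : ∀ x y, A.used x → A.used y → N.rk x ≤ N.rk y → A.le x y
  mono : ∀ u v, u < v → v < w → N.rk (e u) < N.rk (e v)
  ehh : ∀ u v, u < w → v < w → ReflTransGen (orR S T) (e u) (e v) → u = v
  noA : ∀ y, S.used y → T.used y → ¬ A.used y
  res : ∀ x y, S.St x y → ¬ A.St x y → ¬ T.St x y → ¬ TransGen (S.r (orR A T)) x x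

def fut (S : Sys b) (T : Sys c) (w : ℕ) (e : ℕ → X) (p : X) : Prop :=
  ∃ u < w, ReflTransGen (orR S T) (e u) p

variable {A : Sys a} {S : Sys b} {T : Sys c} {w : ℕ} {e : ℕ → X} {iS : Fin m → ℕ}
    {iT : Fin m' → ℕ}

theorem Pt.usedL {p : X} (h : Pt S T p) : S.used p := by
  obtain ⟨_, _, h, _, _⟩ := h; exact h.used_right
theorem Pt.usedR {p : X} (h : Pt S T p) : T.used p := by
  obtain ⟨_, _, _, h, _⟩ := h; exact h.used_right

theorem orR_rk {x y : X} (h : ReflTransGen (orR S T) x y) : N.rk x ≤ N.rk y := by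
  induction h with
  | refl => exact le_rfl
  | tail _ h ih => exact ih.trans (h.elim (·.lt) (·.lt)).le

theorem orR_L {x y : X} (h : S.le x y) : ReflTransGen (orR S T) x y :=
  ReflTransGen.mono (fun _ _ h => Or.inl h) _ _ h
theorem orR_R {x y : X} (h : T.le x y) : ReflTransGen (orR S T) x y :=
  ReflTransGen.mono (fun _ _ h => Or.inr h) _ _ h

namespace Slice
variable (h : Slice A S T w e iS iT)
include h

theorem futS {p : X} (hp : Pt S T p) (hf : fut S T w e p) {k} (hk : S.On k p) :
    S.le (e (iS k)) p ∧ e (iS k) ≠ p := by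
  have hne : e (iS k) ≠ p := fun h1 => h.nT k (h1 ▸ hp.usedR)
  refine ⟨?_, hne⟩
  rcases (h.onS k).cmp hk with h1 | h1
  · exact h1
  · obtain ⟨u, hu, h2⟩ := hf
    have h3 := h2.trans (orR_L h1)
    have h4 := h.ehh _ _ hu (h.iSw k) h3
    subst h4
    exact absurd (N.inj (le_antisymm (orR_rk h2) h1.rk)) hne

theorem futT {p : X} (hp : Pt S T p) (hf : fut S T w e p) {k} (hk : T.On k p) :
    T.le (e (iT k)) p ∧ e (iT k) ≠ p := by
  have hne : e (iT k) ≠ p := fun h1 => h.nS k (h1 ▸ hp.usedL)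
  refine ⟨?_, hne⟩
  rcases (h.onT k).cmp hk with h1 | h1
  · exact h1
  · obtain ⟨u, hu, h2⟩ := hf
    have h3 := h2.trans (orR_R h1)
    have h4 := h.ehh _ _ hu (h.iTw k) h3
    subst h4
    exact absurd (N.inj (le_antisymm (orR_rk h2) h1.rk)) hne

theorem pastS {p : X} (hp : Pt S T p) (hf : ¬ fut S T w e p) {k} (hk : S.On k p) :
    S.le p (e (iS k)) ∧ p ≠ e (iS k) := by
  refine ⟨?_, fun h1 => h.nT k (h1 ▸ hp.usedR)⟩
  rcases (h.onS k).cmp hk with h1 | h1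
  · exact absurd ⟨_, h.iSw k, orR_L h1⟩ hf
  · exact h1

theorem pastT {p : X} (hp : Pt S T p) (hf : ¬ fut S T w e p) {k} (hk : T.On k p) :
    T.le p (e (iT k)) ∧ p ≠ e (iT k) := by
  refine ⟨?_, fun h1 => h.nS k (h1 ▸ hp.usedL)⟩
  rcases (h.onT k).cmp hk with h1 | h1
  · exact absurd ⟨_, h.iTw k, orR_R h1⟩ hf
  · exact h1

theorem costly {p x : X} (hp : Pt S T p) (hx : S.St x p) : ¬ TransGen (S.r (orR A T)) x x := by
  refine h.res x p hx ?_ ?_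
  · intro h1; exact h.noA p hp.usedL hp.usedR h1.used_right
  · intro h1; exact hp.not_run ⟨x, hx, h1⟩

/-- the initial frontier -/
structure Fr (f g : ℕ → X) : Prop where
  fS : ∀ k, End S A (e (iS k)) (f (iS k))
  fT : ∀ l, f (iT l) = e (iT l)
  gS : ∀ k, S.St (g (iS k)) (e (iS k))
  gT : ∀ l, g (iT l) = e (iT l)

omit h in
theorem exists_fr [Finite X] (h : Slice A S T w e iS iT) :
    ∃ f g, Fr (A := A) (S := S) (e := e) (iS := iS) (iT := iT) f g := by
  classical
  choose x hx using fun u => exists_end (B := S) (C := A) (e u)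
  have hg : ∀ k, ∃ y, S.St y (e (iS k)) := fun k => by
    obtain ⟨f, hf, _⟩ := h.ent _ (h.iSw k)
    exact ((h.onS k).used).pred_adj hf.adj
  choose y hy using hg
  refine ⟨fun u => if ∃ k, u = iS k then x u else e u,
    fun u => if hk : ∃ k, u = iS k then y hk.choose else e u, ?_, ?_, ?_, ?_⟩
  · intro k
    have : ∃ k', iS k = iS k' := ⟨k, rfl⟩
    simp only [if_pos this]
    exact hx _
  · intro l
    have : ¬ ∃ k', iT l = iS k' := fun ⟨k', hk⟩ => h.ne k' l hk.symm
    simp only [if_neg this]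
  · intro k
    have : ∃ k', iS k = iS k' := ⟨k, rfl⟩
    simp only [dif_pos this]
    have := h.iSinj this.choose_spec
    rw [← this]
    exact hy k
  · intro l
    have : ¬ ∃ k', iT l = iS k' := fun ⟨k', hk⟩ => h.ne k' l hk.symm
    simp only [dif_neg this]

variable {f g : ℕ → X} (hfg : Fr (A := A) (S := S) (e := e) (iS := iS) (iT := iT) f g)
include hfg

theorem ini1 (u : ℕ) (hu : u < w) : ReflTransGen (S.r (orR A T)) (f u) (g u) := by
  rcases h.cov u hu with ⟨k, rfl⟩ | ⟨l, rfl⟩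
  · exact (W3 (hfg.fS k) (hfg.gS k)).to_reflTransGen
  · rw [hfg.fT, hfg.gT]

theorem ini3 (u : ℕ) (hu : u < w) (hs : ¬ ∃ k, u = iS k) :
    ReflTransGen (S.r (orR A T)) (g u) (f u) := by
  rcases h.cov u hu with hk | ⟨l, rfl⟩
  · exact absurd hk hs
  · rw [hfg.fT, hfg.gT]

theorem ini2 (u : ℕ) (hu : u + 1 < w) : ReflTransGen (S.r (orR A T)) (f u) (g (u + 1)) := by
  obtain ⟨z, hz1, hz2, hz3⟩ := h.ent (u + 1) hu
  obtain ⟨z', hz1', _, _⟩ := h.ent u (by omega)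
  have hm := h.mono u (u + 1) (by omega) hu
  have hle := h.Ale _ _ hz1'.used_right hz1.used_right hm.le
  have hne : e u ≠ e (u + 1) := fun h1 => by rw [h1] at hm; omega
  have hl : A.le (e u) (f u) ∧ A.le (f u) z ∧ ¬ ∃ y, S.St (f u) y ∧ A.St (f u) y := by
    rcases h.cov u (by omega) with ⟨k, rfl⟩ | ⟨l, rfl⟩
    · have hE := hfg.fS k
      obtain ⟨h1, h2⟩ := run_before hE.1.symm hle hne (fun ⟨y, h3, h4⟩ => hz2 (hz1.luniq h3 ▸ h4))
      exact ⟨hE.1.leR, le_pred h1 h2 hz1, hE.2⟩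
    · rw [hfg.fT]
      exact ⟨ReflTransGen.refl, le_pred hle hne hz1, fun ⟨y, h1, _⟩ => h.nS l h1.used_left⟩
  obtain ⟨hl0, hl1, hl2⟩ := hl
  have hw := walkC (B := S) (C := A) (F := orR A T) (fun _ _ h => Or.inl h) hl1 hl2 ?_
  · refine hw.1.tail ?_
    rcases h.cov (u + 1) hu with ⟨k, hk⟩ | ⟨l, hk⟩
    · rw [hk]
      exact Sys.r_fwd (hfg.gS k) (Or.inl (hk ▸ hz1))
    · rw [hk, hfg.gT]
      exact Sys.r_free (h.nS l) (Or.inl (hk ▸ hz1))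
  · rintro y h1 h2 h3 ⟨p, q, hp, hq, hpq⟩
    obtain ⟨v, hv, rfl⟩ := h.ent' q y hq (fun h4 => hpq (hp.luniq h4))
      (fun h4 => h.noA y hp.used_right h4.used_right hq.used_right) hp.used_right
    have r1 := hl0.rk
    have r2 := Sys.le.rk_lt h1 (Ne.symm h2)
    have r3 := Sys.le.rk h3
    have r4 := hz1.lt
    rcases lt_trichotomy v u with h5 | rfl | h5
    · have := h.mono v u h5 (by omega)
      omega
    · omega
    · rcases Nat.lt_or_ge (u + 1) v with h6 | h6
      · have := h.mono _ _ h6 hv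
        omega
      · have : v = u + 1 := by omega
        subst this
        omega

omit hfg in
theorem goodF [Finite X] {pS pT : X → ℕ} (hpS : ∀ p, Pt S T p → ∃ k, S.On k p ∧ pS p = iS k)
    (hpT : ∀ p, Pt S T p → ∃ k, T.On k p ∧ pT p = iT k) (rest : List (Bool × ℕ × ℕ))
    (L : List X) : ∀ (nd : ℕ → X),
    (∀ p ∈ L, Pt S T p ∧ fut S T w e p) →
    L.Pairwise (fun x y => N.rk x < N.rk y) →
    (∀ p ∈ L, ∀ y, Pt S T y → fut S T w e y → N.rk p < N.rk y → y ∈ L) →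
    (∀ p ∈ L, ∀ l x, T.On l p → (∀ y ∈ L, T.On l y → N.rk p ≤ N.rk y) → S.St x p →
      TransGen (S.r (orR A T)) (nd (iT l)) x) →
    (∀ p ∈ L, ∀ k x, S.On k p → S.St x p → ReflTransGen (S.r (orR A T)) x (nd (iS k))) →
    (∀ nd', (∀ i ≥ w, nd' i = nd i) → Good (S.r (orR A T)) nd' rest) →
    Good (S.r (orR A T)) nd (L.map (fun p => (false, pT p, pS p)) ++ rest) := by
  induction L with
  | nil => intro nd _ _ _ _ _ hr; exact hr nd (fun _ _ => rfl)
  | cons p L ih =>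
    intro nd hL hs hc hT hS hr
    obtain ⟨hp, hpf⟩ := hL p List.mem_cons_self
    obtain ⟨k, hk, ek⟩ := hpS p hp
    obtain ⟨l, hl, el⟩ := hpT p hp
    rw [List.map_cons, List.cons_append, ek, el]
    have hp' := hp
    obtain ⟨x, _, hx, _, _⟩ := hp'
    obtain ⟨ℓ, hℓ⟩ := exists_end (B := S) (C := T) p
    rw [List.pairwise_cons] at hs
    refine ⟨x, ℓ, hT p List.mem_cons_self l x hl ?_ hx, hS p List.mem_cons_self k x hk hx,
      (W3 hℓ hx).to_reflTransGen, h.costly hp hx, ?_⟩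
    · intro y hy _
      rcases List.mem_cons.1 hy with rfl | hy
      · exact le_rfl
      · exact (hs.1 y hy).le
    · refine ih _ (fun q hq => hL q (List.mem_cons_of_mem _ hq)) hs.2 ?_ ?_ ?_ ?_
      · intro q hq y hy1 hy2 hy3
        rcases List.mem_cons.1 (hc q (List.mem_cons_of_mem _ hq) y hy1 hy2 hy3) with rfl | h1
        · have := hs.1 q hq
          omega
        · exact h1
      · intro q hq l' z hq1 hq2 hz
        have hqP := hL q (List.mem_cons_of_mem _ hq)
        by_cases hll : l' = l
        · subst hll
          have : upd2 nd (iT l') (iS k) ℓ (iT l') = ℓ := by simp [upd2]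
          rw [this]
          refine W1 (fun _ _ h => Or.inr h) hl hq1 (hs.1 q hq) hℓ hqP.1 hz ?_
          intro y hy1 hy2 hy3 hy4
          have hyf : fut S T w e y := by
            obtain ⟨u, hu, h1⟩ := hpf
            exact ⟨u, hu, h1.trans (orR_R (hl.le_of_rk hy1 hy2.le))⟩
          rcases List.mem_cons.1 (hc p List.mem_cons_self y hy4 hyf hy2) with rfl | h1
          · omega
          · have := hq2 y h1 hy1
            omega
        · have : upd2 nd (iT l) (iS k) ℓ (iT l') = nd (iT l') := by
            have h1 : iT l' ≠ iT l := fun h1 => hll (h.iTinj h1)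
            simp [upd2, h1, (h.ne k l').symm]
          rw [this]
          refine hT q (List.mem_cons_of_mem _ hq) l' z hq1 ?_ hz
          intro y hy hy'
          rcases List.mem_cons.1 hy with rfl | hy
          · exact absurd (hy'.uniq hl) hll
          · exact hq2 y hy hy'
      · intro q hq k' z hq1 hz
        have hqP := hL q (List.mem_cons_of_mem _ hq)
        by_cases hkk : k' = k
        · subst hkk
          have : upd2 nd (iT l) (iS k') ℓ (iS k') = ℓ := by simp [upd2]
          rw [this]
          exact W2 hk hq1 (hs.1 q hq) hℓ hqP.1 hz
        · have : upd2 nd (iT l) (iS k) ℓ (iS k') = nd (iS k') := by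
            have h1 : iS k' ≠ iS k := fun h1 => hkk (h.iSinj h1)
            simp [upd2, h1, h.ne k' l]
          rw [this]
          exact hS q (List.mem_cons_of_mem _ hq) k' z hq1 hz
      · intro nd' hnd
        apply hr
        intro i hi
        rw [hnd i hi]
        have h1 := h.iTw l
        have h2 := h.iSw k
        have h3 : i ≠ iT l := by omega
        have h4 : i ≠ iS k := by omega
        simp [upd2, h3, h4]

omit hfg in
theorem goodP [Finite X] {pS pT : X → ℕ} (hpS : ∀ p, Pt S T p → ∃ k, S.On k p ∧ pS p = iS k)
    (hpT : ∀ p, Pt S T p → ∃ k, T.On k p ∧ pT p = iT k)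
    (L : List X) : ∀ (nd : ℕ → X),
    (∀ p ∈ L, Pt S T p ∧ ¬ fut S T w e p) →
    L.Pairwise (fun x y => N.rk y < N.rk x) →
    (∀ p ∈ L, ∀ y, Pt S T y → ¬ fut S T w e y → N.rk y < N.rk p → y ∈ L) →
    (∀ p ∈ L, ∀ l x, T.On l p → (∀ y ∈ L, T.On l y → N.rk y ≤ N.rk p) → End S T p x →
      TransGen (S.r (orR A T)) x (nd (w + iT l))) →
    (∀ p ∈ L, ∀ k x, S.On k p → End S T p x →
      ReflTransGen (S.r (orR A T)) (nd (w + iS k)) x) →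
    (∀ k, ¬ TransGen (S.r (orR A T)) (nd (w + iS k)) (nd (w + iS k))) →
    Good (S.r (orR A T)) nd (L.map (fun p => (true, w + pT p, w + pS p))) := by
  induction L with
  | nil => intros; trivial
  | cons p L ih =>
    intro nd hL hs hc hT hS hr
    obtain ⟨hp, hpf⟩ := hL p List.mem_cons_self
    obtain ⟨k, hk, ek⟩ := hpS p hp
    obtain ⟨l, hl, el⟩ := hpT p hp
    rw [List.map_cons, ek, el]
    have hp' := hp
    obtain ⟨x, _, hx, _, _⟩ := hp'
    obtain ⟨ℓ, hℓ⟩ := exists_end (B := S) (C := T) p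
    rw [List.pairwise_cons] at hs
    refine ⟨ℓ, x, hS p List.mem_cons_self k ℓ hk hℓ, hT p List.mem_cons_self l ℓ hl ?_ hℓ,
      (W3 hℓ hx).to_reflTransGen, hr k, ?_⟩
    · intro y hy _
      rcases List.mem_cons.1 hy with rfl | hy
      · exact le_rfl
      · exact (hs.1 y hy).le
    · refine ih _ (fun q hq => hL q (List.mem_cons_of_mem _ hq)) hs.2 ?_ ?_ ?_ ?_
      · intro q hq y hy1 hy2 hy3
        rcases List.mem_cons.1 (hc q (List.mem_cons_of_mem _ hq) y hy1 hy2 hy3) with rfl | h1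
        · have := hs.1 q hq
          omega
        · exact h1
      · intro q hq l' z hq1 hq2 hz
        have hqP := hL q (List.mem_cons_of_mem _ hq)
        by_cases hll : l' = l
        · subst hll
          have : upd2 nd (w + iT l') (w + iS k) x (w + iT l') = x := by simp [upd2]
          rw [this]
          refine W1 (fun _ _ h => Or.inr h) hq1 hl (hs.1 q hq) hz hp hx ?_
          intro y hy1 hy2 hy3 hy4
          have hyf : ¬ fut S T w e y := by
            rintro ⟨u, hu, h1⟩
            exact hpf ⟨u, hu, h1.trans (orR_R (hy1.le_of_rk hl hy3.le))⟩
          rcases List.mem_cons.1 (hc p List.mem_cons_self y hy4 hyf hy3) with rfl | h1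
          · omega
          · have := hq2 y h1 hy1
            omega
        · have : upd2 nd (w + iT l) (w + iS k) x (w + iT l') = nd (w + iT l') := by
            have h1 : iT l' ≠ iT l := fun h1 => hll (h.iTinj h1)
            simp [upd2, h1, (h.ne k l').symm]
          rw [this]
          refine hT q (List.mem_cons_of_mem _ hq) l' z hq1 ?_ hz
          intro y hy hy'
          rcases List.mem_cons.1 hy with rfl | hy
          · exact absurd (hy'.uniq hl) hll
          · exact hq2 y hy hy'
      · intro q hq k' z hq1 hz
        have hqP := hL q (List.mem_cons_of_mem _ hq)
        by_cases hkk : k' = k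
        · subst hkk
          have : upd2 nd (w + iT l) (w + iS k') x (w + iS k') = x := by simp [upd2]
          rw [this]
          exact W2 hq1 hk (hs.1 q hq) hz hp hx
        · have : upd2 nd (w + iT l) (w + iS k) x (w + iS k') = nd (w + iS k') := by
            have h1 : iS k' ≠ iS k := fun h1 => hkk (h.iSinj h1)
            simp [upd2, h1, h.ne k' l]
          rw [this]
          exact hS q (List.mem_cons_of_mem _ hq) k' z hq1 hz
      · intro k'
        by_cases hkk : k' = k
        · subst hkk
          have : upd2 nd (w + iT l) (w + iS k') x (w + iS k') = x := by simp [upd2]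
          rw [this]
          exact h.costly hp hx
        · have : upd2 nd (w + iT l) (w + iS k) x (w + iS k') = nd (w + iS k') := by
            have h1 : iS k' ≠ iS k := fun h1 => hkk (h.iSinj h1)
            simp [upd2, h1, h.ne k' l]
          rw [this]
          exact hr k'

theorem good [Finite X] {pS pT : X → ℕ} (hpS : ∀ p, Pt S T p → ∃ k, S.On k p ∧ pS p = iS k)
    (hpT : ∀ p, Pt S T p → ∃ k, T.On k p ∧ pT p = iT k) (Lf Lp : List X)
    (hLf : ∀ p, p ∈ Lf ↔ Pt S T p ∧ fut S T w e p) (hLp : ∀ p, p ∈ Lp ↔ Pt S T p ∧ ¬ fut S T w e p)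
    (hsf : Lf.Pairwise (fun x y => N.rk x < N.rk y)) (hsp : Lp.Pairwise (fun x y => N.rk y < N.rk x))
    (nd : ℕ → X) (hn1 : ∀ u < w, nd u = f u) (hn2 : ∀ u, nd (w + u) = g u) :
    Good (S.r (orR A T)) nd (Lf.map (fun p => (false, pT p, pS p)) ++
      Lp.map (fun p => (true, w + pT p, w + pS p))) := by
  refine h.goodF hpS hpT _ Lf nd (fun p hp => (hLf p).1 hp) hsf
    (fun p _ y h1 h2 _ => (hLf y).2 ⟨h1, h2⟩) ?_ ?_ ?_
  · intro p hp l x hl hmin hx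
    obtain ⟨hP, hF⟩ := (hLf p).1 hp
    rw [hn1 _ (h.iTw l), hfg.fT]
    obtain ⟨h1, h2⟩ := h.futT hP hF hl
    obtain ⟨_, y, _, hy, _⟩ := hP
    have hw := walkC (B := S) (C := T) (F := orR A T) (fun _ _ h => Or.inr h) (le_pred h1 h2 hy)
      (fun ⟨z, hz, _⟩ => h.nS l hz.used_left) ?_
    · exact TransGen.tail' hw.1 (Sys.r_fwd hx (Or.inr hy))
    · intro z hz1 hz2 hz3 hz4
      have hzl : T.On l z := (h.onT l).up hz1
      have := hmin z ((hLf z).2 ⟨hz4, _, h.iTw l, orR_R hz1⟩) hzl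
      have := Sys.le.rk hz3
      have := hy.lt
      omega
  · intro p hp k x hk hx
    obtain ⟨hP, hF⟩ := (hLf p).1 hp
    rw [hn1 _ (h.iSw k)]
    obtain ⟨h1, h2⟩ := h.futS hP hF hk
    have hE := hfg.fS k
    obtain ⟨h3, h4⟩ := run_before hE.1 h1 h2
      (fun ⟨y, _, h6⟩ => h.noA p hP.usedL hP.usedR h6.used_right)
    exact Sys.rback (le_pred h3 h4 hx)
  · intro nd' hnd'
    have hn3 : ∀ u, nd' (w + u) = g u := fun u => by rw [hnd' _ (by omega), hn2]
    refine h.goodP hpS hpT Lp nd' (fun p hp => (hLp p).1 hp) hsp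
      (fun p _ y h1 h2 _ => (hLp y).2 ⟨h1, h2⟩) ?_ ?_ ?_
    · intro p hp l x hl hmin hx
      obtain ⟨hP, hF⟩ := (hLp p).1 hp
      rw [hn3, hfg.gT]
      obtain ⟨h1, h2⟩ := h.pastT hP hF hl
      obtain ⟨h3, h4⟩ := run_before hx.1.symm h1 h2 (fun ⟨y, _, h6⟩ => h.nS l h6.used_right)
      have hw := walkC (B := S) (C := T) (F := orR A T) (fun _ _ h => Or.inr h) h3 hx.2 ?_
      · rcases reflTransGen_iff_eq_or_transGen.1 hw.1 with h5 | h5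
        · exact absurd h5.symm h4
        · exact h5
      · intro z hz1 hz2 hz3 hz4
        have hzl : T.On l z := (hl.up hx.1.leR).up hz1
        have hzf : ¬ fut S T w e z := by
          intro hzf
          obtain ⟨h5, h6⟩ := h.futT hz4 hzf hzl
          exact h6 (N.inj (le_antisymm h5.rk hz3.rk))
        have := hmin z ((hLp z).2 ⟨hz4, hzf⟩) hzl
        have := Sys.le.rk_lt hz1 (Ne.symm hz2)
        have := hx.1.leR.rk
        omega
    · intro p hp k x hk hx
      obtain ⟨hP, hF⟩ := (hLp p).1 hp
      rw [hn3]
      obtain ⟨h1, h2⟩ := h.pastS hP hF hk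
      obtain ⟨h3, h4⟩ := run_before hx.1 h1 h2 (fun ⟨y, _, h6⟩ => h.nT k h6.used_right)
      exact Sys.rback (le_pred h3 h4 (hfg.gS k))
    · intro k
      rw [hn3]
      obtain ⟨z, h1, h2, h3⟩ := h.ent _ (h.iSw k)
      refine h.res _ _ (hfg.gS k) (fun h4 => h2 ?_) (fun h4 => h.nT k h4.used_right)
      rw [h1.luniq h4]
      exact hfg.gS k

end Slice
end slice
end MTwo

namespace MTwo
open Relation

theorem exists_sorted {X : Type} [Finite X] (rk : X → ℕ) (hrk : Function.Injective rk)
    (P : X → Prop) : ∃ L : List X, L.Pairwise (fun x y => rk x < rk y) ∧ ∀ x, x ∈ L ↔ P x := by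
  classical
  haveI := Fintype.ofFinite X
  letI : LinearOrder X := LinearOrder.lift' rk hrk
  refine ⟨(Finset.univ.filter P).sort (· ≤ ·), ?_, by simp⟩
  have := Finset.sortedLT_sort (Finset.univ.filter P)
  exact this.pairwise

section fin
variable {X : Type} {N : Net X} {n : ℕ} {a : Grp N 1} {b : Grp N 2} {c : Grp N n}
  {A : Sys a} {B : Sys b} {C : Sys c}

theorem exists_E [Finite X] (h : Mn A B C) (hc : Nat.card {e // Ent A B C e} = n + 2) :
    ∃ E : Fin 2 ⊕ Fin n → X, (∀ k, Ent A B C (E k)) ∧ (∀ k l, onP B C l (E k) ↔ l = k) ∧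
      ∀ e, Ent A B C e → ∃ k, e = E k := by
  classical
  choose κ hκ using fun e : {e // Ent A B C e} => e.2.onP
  have hinj : Function.Injective κ := by
    intro e e' hee
    exact Subtype.ext (ent_inj h e.2 e'.2 (hκ e) (hee ▸ hκ e'))
  have hbij : Function.Bijective κ := by
    refine (Nat.bijective_iff_injective_and_card κ).2 ⟨hinj, ?_⟩
    rw [hc]; simp; omega
  let φ := Equiv.ofBijective κ hbij
  have hφ : ∀ k, onP B C k (φ.symm k).1 := fun k => by
    have := hκ (φ.symm k)
    have e1 : κ (φ.symm k) = k := φ.apply_symm_apply k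
    rwa [e1] at this
  refine ⟨fun k => (φ.symm k).1, fun k => (φ.symm k).2, ?_, ?_⟩
  · intro k l
    constructor
    · intro hl
      have := ent_inj h (φ.symm k).2 (φ.symm l).2 hl (hφ l)
      exact (φ.symm.injective (Subtype.ext this)).symm
    · rintro rfl; exact hφ l
  · intro e he
    refine ⟨φ ⟨e, he⟩, ?_⟩
    simp

theorem noA_aux [Finite X] (h : Mn A B C) {E : Fin 2 ⊕ Fin n → X} (hE : ∀ k, Ent A B C (E k))
    (hon : ∀ k l, onP B C l (E k) ↔ l = k) (y : X) (h1 : B.used y) (h2 : C.used y)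
    (h3 : A.used y) : False := by
  obtain ⟨k, hk⟩ := h1.on
  obtain ⟨l, hl⟩ := h2.on
  have ek : B.On k (E (Sum.inl k)) := (hon (Sum.inl k) (Sum.inl k)).2 rfl
  have el : C.On l (E (Sum.inr l)) := (hon (Sum.inr l) (Sum.inr l)).2 rfl
  have r1 : ReflTransGen (HH B C) (E (Sum.inl k)) y := by
    rcases ek.cmp hk with h4 | h4
    · exact hh_of_leB h4
    · rw [ent_hh h h3 (hE _) (hh_of_leB h4)]
  have r2 : ReflTransGen (HH B C) (E (Sum.inr l)) y := by
    rcases el.cmp hl with h4 | h4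
    · exact hh_of_leC h4
    · rw [ent_hh h h3 (hE _) (hh_of_leC h4)]
  have hne : E (Sum.inl k) ≠ E (Sum.inr l) := by
    intro h4
    have : onP B C (Sum.inr l) (E (Sum.inl k)) := by rw [h4]; exact el
    have := (hon _ _).1 this
    simp at this
  have key : ∀ x x', Ent A B C x → Ent A B C x' → x ≠ x' → N.rk x ≤ N.rk x' →
      ReflTransGen (HH B C) x y → ReflTransGen (HH B C) x' y → False := by
    intro x x' hx hx' hxx hr i1 i2
    have hA := A_le hx.usedA hx'.usedA hr
    have hA2 := A_le hx'.usedA h3 (hh_rk i2)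
    obtain ⟨f, hf1, hf2, _⟩ := hx'
    exact RL h (le_pred hA hxx hf1) hf1 hf2 hA2 i1
  rcases le_total (N.rk (E (Sum.inl k))) (N.rk (E (Sum.inr l))) with h4 | h4
  · exact key _ _ (hE _) (hE _) hne h4 r1 r2
  · exact key _ _ (hE _) (hE _) hne.symm h4 r2 r1

theorem exists_slice [Finite X] (h : Mn A B C) (hc : Nat.card {e // Ent A B C e} = n + 2) :
    ∃ (e : ℕ → X) (iB : Fin 2 → ℕ) (iC : Fin n → ℕ),
      Slice A B C (n + 2) e iB iC ∧ Slice A C B (n + 2) e iC iB := by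
  classical
  obtain ⟨E, hE, hon, hcov⟩ := exists_E h hc
  have Einj : Function.Injective E := by
    intro k l hkl
    have := (hon l l).2 rfl
    rw [← hkl] at this
    exact ((hon k l).1 this).symm
  let ν : Fin 2 ⊕ Fin n → ℕ := fun k => Set.ncard {l | N.rk (E l) < N.rk (E k)}
  have νle : ∀ k l, N.rk (E k) ≤ N.rk (E l) → ν k ≤ ν l := fun k l hkl =>
    Set.ncard_le_ncard (fun z (hz : _ < _) => lt_of_lt_of_le hz hkl) (Set.toFinite _)
  have νlt : ∀ k l, N.rk (E k) < N.rk (E l) → ν k < ν l := by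
    intro k l hkl
    refine Set.ncard_lt_ncard (Set.ssubset_iff_subset_ne.2 ⟨fun z (hz : _ < _) => hz.trans hkl, ?_⟩)
      (Set.toFinite _)
    intro he
    have : k ∈ {z | N.rk (E z) < N.rk (E l)} := hkl
    rw [← he] at this
    exact lt_irrefl (N.rk (E k)) this
  have νinj : Function.Injective ν := by
    intro k l hkl
    rcases lt_trichotomy (N.rk (E k)) (N.rk (E l)) with h1 | h1 | h1
    · have := νlt _ _ h1; omega
    · exact Einj (N.inj h1)
    · have := νlt _ _ h1; omega
  have νw : ∀ k, ν k < n + 2 := by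
    intro k
    have : ν k < Set.ncard (Set.univ : Set (Fin 2 ⊕ Fin n)) := by
      refine Set.ncard_lt_ncard (Set.ssubset_iff_subset_ne.2 ⟨Set.subset_univ _, ?_⟩) (Set.toFinite _)
      intro he
      have : k ∈ (Set.univ : Set (Fin 2 ⊕ Fin n)) := trivial
      rw [← he] at this
      exact lt_irrefl (N.rk (E k)) this
    rw [Set.ncard_univ] at this
    simp at this
    omega
  have νsurj : ∀ u < n + 2, ∃ k, ν k = u := by
    have : Function.Bijective (fun k => (⟨ν k, νw k⟩ : Fin (n + 2))) := by
      refine (Fintype.bijective_iff_injective_and_card _).2 ⟨fun k l hkl => νinj (by simpa using hkl), ?_⟩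
      simp; omega
    intro u hu
    obtain ⟨k, hk⟩ := this.2 ⟨u, hu⟩
    exact ⟨k, by simpa using hk⟩
  let e : ℕ → X := fun u => if hk : ∃ k, ν k = u then E hk.choose else E (Sum.inl 0)
  have he : ∀ k, e (ν k) = E k := by
    intro k
    have hk : ∃ k', ν k' = ν k := ⟨k, rfl⟩
    simp only [e, dif_pos hk]
    rw [νinj hk.choose_spec]
  have hmono : ∀ u v, u < v → v < n + 2 → N.rk (e u) < N.rk (e v) := by
    intro u v huv hv
    obtain ⟨k, rfl⟩ := νsurj u (by omega)
    obtain ⟨l, rfl⟩ := νsurj v hv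
    rw [he, he]
    by_contra hcon
    have := νle _ _ (not_lt.1 hcon)
    omega
  have hnoA := noA_aux h hE hon
  have hent : ∀ u < n + 2, ∃ f, A.St f (e u) ∧ ¬ B.St f (e u) ∧ ¬ C.St f (e u) := by
    intro u hu
    obtain ⟨k, rfl⟩ := νsurj u hu
    rw [he]
    obtain ⟨f, h1, h2, _⟩ := hE k
    exact ⟨f, h1, fun h3 => h2 (Or.inl h3), fun h3 => h2 (Or.inr h3)⟩
  have hehh : ∀ u v, u < n + 2 → v < n + 2 → ReflTransGen (HH B C) (e u) (e v) → u = v := by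
    intro u v hu hv hr
    obtain ⟨k, rfl⟩ := νsurj u hu
    obtain ⟨l, rfl⟩ := νsurj v hv
    rw [he, he] at hr
    rw [Einj (ent_hh h (hE k).usedA (hE l) hr)]
  have hnC : ∀ k, ¬ C.used (e (ν (Sum.inl k))) := by
    intro k hu
    rw [he] at hu
    obtain ⟨l, hl⟩ := hu.on
    have := (hon (Sum.inl k) (Sum.inr l)).1 hl
    simp at this
  have hnB : ∀ k, ¬ B.used (e (ν (Sum.inr k))) := by
    intro k hu
    rw [he] at hu
    obtain ⟨l, hl⟩ := hu.on
    have := (hon (Sum.inr k) (Sum.inl l)).1 hl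
    simp at this
  have hcv : ∀ x, Ent A B C x → ∃ u < n + 2, x = e u := by
    intro x hx
    obtain ⟨k, rfl⟩ := hcov x hx
    exact ⟨ν k, νw k, (he k).symm⟩
  refine ⟨e, fun k => ν (Sum.inl k), fun k => ν (Sum.inr k), ?_, ?_⟩
  · refine ⟨fun k l hkl => by simpa using νinj hkl, fun k l hkl => by simpa using νinj hkl,
      fun k l hkl => by simpa using νinj hkl, fun k => νw _, fun k => νw _, ?_, ?_, ?_, hnC, hnB, hent,
      ?_, fun x y => A_le, hmono, hehh, hnoA, ?_⟩
    · intro u hu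
      obtain ⟨k | k, rfl⟩ := νsurj u hu
      · exact Or.inl ⟨k, rfl⟩
      · exact Or.inr ⟨k, rfl⟩
    · intro k; rw [he]; exact (hon (Sum.inl k) (Sum.inl k)).2 rfl
    · intro k; rw [he]; exact (hon (Sum.inr k) (Sum.inr k)).2 rfl
    · intro f x h1 h2 h3 h4
      exact hcv x ⟨f, h1, fun h5 => h5.elim h2 h3, Or.inl h4⟩
    · exact h.BU
  · refine ⟨fun k l hkl => by simpa using νinj hkl, fun k l hkl => by simpa using νinj hkl,
      fun k l hkl => by simpa using νinj hkl, fun k => νw _, fun k => νw _, ?_, ?_, ?_, hnB, hnC, ?_,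
      ?_, fun x y => A_le, hmono, ?_, fun y h1 h2 => hnoA y h2 h1, ?_⟩
    · intro u hu
      obtain ⟨k | k, rfl⟩ := νsurj u hu
      · exact Or.inr ⟨k, rfl⟩
      · exact Or.inl ⟨k, rfl⟩
    · intro k; rw [he]; exact (hon (Sum.inr k) (Sum.inr k)).2 rfl
    · intro k; rw [he]; exact (hon (Sum.inl k) (Sum.inl k)).2 rfl
    · intro u hu
      obtain ⟨f, h1, h2, h3⟩ := hent u hu
      exact ⟨f, h1, h3, h2⟩
    · intro f x h1 h2 h3 h4
      exact hcv x ⟨f, h1, fun h5 => h5.elim h3 h2, Or.inr h4⟩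
    · intro u v hu hv hr
      exact hehh u v hu hv (ReflTransGen.mono (fun _ _ h => h.symm) _ _ hr)
    · exact h.CU

theorem fut_swap {w : ℕ} {e : ℕ → X} {p : X} (h : fut B C w e p) : fut C B w e p := by
  obtain ⟨u, hu, hr⟩ := h
  exact ⟨u, hu, ReflTransGen.mono (fun _ _ h => h.symm) _ _ hr⟩

theorem fut_swap' {w : ℕ} {e : ℕ → X} {p : X} (h : fut C B w e p) : fut B C w e p := by
  obtain ⟨u, hu, hr⟩ := h
  exact ⟨u, hu, ReflTransGen.mono (fun _ _ h => h.symm) _ _ hr⟩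

theorem refine_false [Finite X] (h : Mn A B C) (hc : Nat.card {e // Ent A B C e} = n + 2)
    (ht : tst (n + 2) (Set.ncard {p | Pt B C p}) = true) : False := by
  classical
  obtain ⟨e, iB, iC, hB, hC⟩ := exists_slice h hc
  obtain ⟨fB, gB, hfB⟩ := Slice.exists_fr hB
  obtain ⟨fC, gC, hfC⟩ := Slice.exists_fr hC
  generalize hw : n + 2 = w at *
  -- path indices
  have hpB : ∀ p, ∃ u, Pt B C p → ∃ k, B.On k p ∧ u = iB k := by
    intro p
    by_cases hp : Pt B C p
    · obtain ⟨k, hk⟩ := hp.usedL.on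
      exact ⟨iB k, fun _ => ⟨k, hk, rfl⟩⟩
    · exact ⟨0, fun h => absurd h hp⟩
  have hpC : ∀ p, ∃ u, Pt B C p → ∃ k, C.On k p ∧ u = iC k := by
    intro p
    by_cases hp : Pt B C p
    · obtain ⟨k, hk⟩ := hp.usedR.on
      exact ⟨iC k, fun _ => ⟨k, hk, rfl⟩⟩
    · exact ⟨0, fun h => absurd h hp⟩
  choose pB hpB using hpB
  choose pC hpC using hpC
  obtain ⟨Lf, hsf, hLf⟩ := exists_sorted N.rk N.inj (fun p => Pt B C p ∧ fut B C w e p)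
  obtain ⟨Lp0, hsp0, hLp0⟩ := exists_sorted N.rk N.inj (fun p => Pt B C p ∧ ¬ fut B C w e p)
  obtain ⟨Lp, hsp, hLp⟩ : ∃ L : List X, L.Pairwise (fun x y => N.rk y < N.rk x) ∧
      ∀ p, p ∈ L ↔ Pt B C p ∧ ¬ fut B C w e p :=
    ⟨Lp0.reverse, List.pairwise_reverse.2 hsp0, fun p => by rw [List.mem_reverse, hLp0]⟩
  have ndf : Lf.Nodup := hsf.imp (fun {x y} hxy => by rintro rfl; omega)
  have ndp : Lp.Nodup := hsp.imp (fun {x y} hxy => by rintro rfl; omega)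
  have hlen : Set.ncard {p | Pt B C p} = Lf.length + Lp.length := by
    have nd : (Lf ++ Lp).Nodup := by
      refine List.nodup_append.2 ⟨ndf, ndp, ?_⟩
      rintro x hx y hy rfl
      exact ((hLp x).1 hy).2 ((hLf x).1 hx).2
    have : {p | Pt B C p} = ((Lf ++ Lp).toFinset : Set X) := by
      ext p
      simp only [Set.mem_setOf_eq, List.coe_toFinset, List.mem_append, hLf, hLp]
      tauto
    rw [this, Set.ncard_coe_finset, List.toFinset_card_of_nodup nd, List.length_append]
  let ls : List (Bool × ℕ × ℕ) := Lf.map (fun p => (false, pB p, pC p)) ++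
    Lp.map (fun p => (true, pB p, pC p))
  have hls : ls.length = Set.ncard {p | Pt B C p} := by rw [hlen]; simp [ls]
  let nB : ℕ → X := fun i => if i < w then fB i else gB (i - w)
  let nC : ℕ → X := fun i => if i < w then fC i else gC (i - w)
  have nB1 : ∀ u < w, nB u = fB u := fun u hu => if_pos hu
  have nC1 : ∀ u < w, nC u = fC u := fun u hu => if_pos hu
  have nB2 : ∀ u, nB (w + u) = gB u := fun u => by
    have : ¬ w + u < w := by omega
    simp [nB, this]
  have nC2 : ∀ u, nC (w + u) = gC u := fun u => by
    have : ¬ w + u < w := by omega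
    simp [nC, this]
  have goodB : Good (B.r (orR A C)) nB (ls.map (ltB w)) := by
    have := hB.good hfB hpB hpC Lf Lp hLf hLp hsf hsp nB nB1 nB2
    have e1 : ls.map (ltB w) = Lf.map (fun p => (false, pC p, pB p)) ++
        Lp.map (fun p => (true, w + pC p, w + pB p)) := by
      simp [ls, ltB, Function.comp_def]
    rw [e1]; exact this
  have goodC : Good (C.r (orR A B)) nC (ls.map (ltC w)) := by
    have := hC.good hfC (fun p hp => hpC p hp.symm) (fun p hp => hpB p hp.symm) Lf Lp
      (fun p => by rw [hLf]; exact ⟨fun h => ⟨h.1.symm, fut_swap h.2⟩, fun h => ⟨h.1.symm, fut_swap' h.2⟩⟩)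
      (fun p => by
        rw [hLp]
        exact ⟨fun h => ⟨h.1.symm, fun h' => h.2 (fut_swap' h')⟩,
          fun h => ⟨h.1.symm, fun h' => h.2 (fut_swap h')⟩⟩) hsf hsp nC nC1 nC2
    have e1 : ls.map (ltC w) = Lf.map (fun p => (false, pB p, pC p)) ++
        Lp.map (fun p => (true, w + pB p, w + pC p)) := by
      simp [ls, ltC, Function.comp_def]
    rw [e1]; exact this
  obtain ⟨b1, b2, h12, hb2, hbb⟩ : ∃ b1 b2, b1 < b2 ∧ b2 < w ∧
      ∀ u, (u = b1 ∨ u = b2) ↔ ∃ k, u = iB k := by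
    have hne : iB 0 ≠ iB 1 := fun h => by simpa using hB.iSinj h
    have hex : ∀ u, (∃ k, u = iB k) ↔ (u = iB 0 ∨ u = iB 1) := by
      intro u
      constructor
      · rintro ⟨k, rfl⟩
        fin_cases k
        · exact Or.inl rfl
        · exact Or.inr rfl
      · rintro (h | h)
        · exact ⟨0, h⟩
        · exact ⟨1, h⟩
    rcases lt_or_gt_of_ne hne with h1 | h1
    · exact ⟨iB 0, iB 1, h1, hB.iSw _, fun u => (hex u).symm⟩
    · exact ⟨iB 1, iB 0, h1, hB.iSw _, fun u => by rw [hex u, or_comm]⟩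
  have hsg : ∀ u, ((u == b1 || u == b2) = true) ↔ ∃ k, u = iB k := by
    intro u; rw [← hbb u]; simp
  have iniB : InvM (B.r (orR A C)) (initM w fun u => u == b1 || u == b2) nB := by
    refine initM_inv _ w _ nB ?_ ?_ ?_
    · intro u hu; rw [nB1 u hu, nB2]; exact hB.ini1 hfB u hu
    · intro u hu; rw [nB1 u (by omega), nB2]; exact hB.ini2 hfB u hu
    · intro u hu hs
      rw [nB1 u hu, nB2]
      refine hB.ini3 hfB u hu (fun hk => ?_)
      rw [(hsg u).2 hk] at hs
      cases hs
  have iniC : InvM (C.r (orR A B)) (initM w fun u => !(u == b1 || u == b2)) nC := by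
    refine initM_inv _ w _ nC ?_ ?_ ?_
    · intro u hu; rw [nC1 u hu, nC2]; exact hC.ini1 hfC u hu
    · intro u hu; rw [nC1 u (by omega), nC2]; exact hC.ini2 hfC u hu
    · intro u hu hs
      rw [nC1 u hu, nC2]
      refine hC.ini3 hfC u hu (fun ⟨l, hl⟩ => ?_)
      have hs' : (u == b1 || u == b2) = true := by
        revert hs; cases (u == b1 || u == b2) <;> simp
      obtain ⟨k, hk⟩ := (hsg u).1 hs'
      exact hB.ne k l (hk.symm.trans hl)
  have hlet : ∀ p, Pt B C p → (pB p, pC p) ∈ letters w b1 b2 := by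
    intro p hp
    obtain ⟨k, _, hk⟩ := hpB p hp
    obtain ⟨l, _, hl⟩ := hpC p hp
    have h1 := (hbb (pB p)).2 ⟨k, hk⟩
    have h2 : ¬ (pC p = b1 ∨ pC p = b2) := fun h3 => by
      obtain ⟨k', hk'⟩ := (hbb _).1 h3
      exact hB.ne k' l (hk'.symm.trans hl)
    have h3 : pC p < w := hl ▸ hB.iTw l
    push Not at h2
    simp only [letters, List.mem_flatMap, List.mem_map, List.mem_filter, List.mem_range]
    refine ⟨pB p, by simpa using h1, pC p, ⟨h3, by simp [h2.1, h2.2]⟩, rfl⟩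
  have hmem : ∀ x ∈ ls, x.2 ∈ letters w b1 b2 := by
    intro x hx
    simp only [ls, List.mem_append, List.mem_map] at hx
    rcases hx with ⟨p, hp, rfl⟩ | ⟨p, hp, rfl⟩
    · exact hlet p ((hLf p).1 hp).1
    · exact hlet p ((hLp p).1 hp).1
  have hpw : ((false, 0, 0) :: ls).Pairwise (fun x y => x.1 = true → y.1 = true) := by
    refine List.pairwise_cons.2 ⟨fun y _ h => (by simp at h), ?_⟩
    refine List.pairwise_append.2 ⟨?_, ?_, ?_⟩
    · rw [List.pairwise_map]
      refine List.Pairwise.imp (R := fun _ _ => True) ?_ (List.pairwise_of_forall (fun _ _ => trivial))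
      intro x y _ h
      simp at h
    · rw [List.pairwise_map]
      refine List.Pairwise.imp (R := fun _ _ => True) ?_ (List.pairwise_of_forall (fun _ _ => trivial))
      intro x y _ h
      rfl
    · intro x hx y hy h
      obtain ⟨p, _, rfl⟩ := List.mem_map.1 hx
      simp at h
  have hs := srch_sound _ _ w (letters w b1 b2) ls false _ _ nB nC iniB iniC hmem hpw goodB goodC
  rw [hls] at hs
  simp only [tst, List.all_eq_true, List.mem_range] at ht
  have := ht b2 hb2 b1 h12
  rw [hs] at this
  cases this

theorem mg_refine [Finite X] (hn : 1 ≤ n) (h : Mn A B C) (ht : tst (n + 2) (3 * n - 1) = true) :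
    Set.ncard {x | Mg A B C x} ≤ 4 * n := by
  by_contra hcon
  have h1 := card_mg A B C
  have h2 := card_ent h
  have h3 := points_bound hn h.BC h.CB
  refine refine_false h (by omega) ?_
  have : Set.ncard {p | Pt B C p} = 3 * n - 1 := by omega
  rw [this]; exact ht

end fin

theorem ub2 : MAtMost ![1, 2, 2] 8 :=
  atMost_mn fun _ _ _ _ _ _ _ _ _ h => mg_refine (n := 2) (by norm_num) h tst2

theorem ub3 : MAtMost ![1, 2, 3] 12 :=
  atMost_mn fun _ _ _ _ _ _ _ _ _ h => mg_refine (n := 3) (by norm_num) h tst3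

end MTwo

/-- For every positive integer `n`, `M(1, 2, n) = 4n` if `n = 2` or
`n = 3`, and `M(1, 2, n) = 4n + 1` if `n = 1` or `n ≥ 4`. -/
theorem M_one_two_n (n : ℕ) (hn : 0 < n) :
    ((n = 2 ∨ n = 3) → MEq ![1, 2, n] (4 * n)) ∧
      ((n = 1 ∨ 4 ≤ n) → MEq ![1, 2, n] (4 * n + 1)) := by
  refine ⟨?_, ?_⟩
  · rintro (rfl | rfl)
    · exact ⟨MTwo.ub2, MLow.lb2⟩
    · exact ⟨MTwo.ub3, MLow.lb3⟩
  · rintro (rfl | h)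
    · exact ⟨MTwo.ub le_rfl, MLow.lb1⟩
    · obtain ⟨m, rfl⟩ := Nat.exists_eq_add_of_le' h
      exact ⟨MTwo.ub (by omega), MLow.lb4 m⟩
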